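/- Let N > 1 be an integer, α > 0, b ≤ 0 < k with (−b)^{1/α}·√(1+k²) < k·N, and fix initial data u₀ ∈ C²([0,1]) with u₀'(0) = 0, u₀'(1) = k, whose initial mean curvature satisfies H(r,0) > 0 and H(r,0)^α + b > 0 for all r ∈ [0,1]. Then the flow has a unique global classical solution u on [0, ∞) with initial data u₀ and H(r,t) > 0 for all (r,t), and there exists M ∈ ℝ such that sup_{r ∈ [0,1]} |u(r,t) − Φ̃(r) − c̃(b,k)·t| → M as t → ∞. -/

import Mathlib

open Set Filter Topology

/-- Signed power: the usual real power for nonnegative arguments, extended oddly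
to negative arguments (matching `x^{e}` for `1/e = p/q` with `p, q` odd). -/
noncomputable def oddPow (x e : ℝ) : ℝ := if 0 ≤ x then x ^ e else -((-x) ^ e)

/-- `φ`, with first derivative `φ'` and second derivative `φ''`, solves the
translating-profile equation
`φ''/(1+φ'²) + ((N−1)/r)·φ' = (c/√(1+φ'²) − b)^{1/α}·√(1+φ'²)` for `r ∈ J`, `r ≠ 0`,
with the initial conditions `φ(0) = φ'(0) = 0`. -/
def IsProfileSolOn (N : ℕ) (α b c : ℝ) (J : Set ℝ) (φ φ' φ'' : ℝ → ℝ) : Prop :=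
  φ 0 = 0 ∧ φ' 0 = 0 ∧
  (∀ r ∈ J, HasDerivWithinAt φ (φ' r) J r) ∧
  (∀ r ∈ J, HasDerivWithinAt φ' (φ'' r) J r) ∧
  (∀ r ∈ J, r ≠ 0 →
    φ'' r / (1 + φ' r ^ 2) + (((N : ℝ) - 1) / r) * φ' r
      = oddPow (c / Real.sqrt (1 + φ' r ^ 2) - b) (1 / α) * Real.sqrt (1 + φ' r ^ 2))

/-- `φ` is the unique solution of the translating-profile problem, defined on its
maximal existence interval `[0, R)`: it is a solution there, and any solution on any
interval `[0, S)` satisfies `S ≤ R` and coincides with `φ` on `[0, S)`. -/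
def IsMaxProfileSol (N : ℕ) (α b c R : ℝ) (φ φ' φ'' : ℝ → ℝ) : Prop :=
  0 < R ∧ IsProfileSolOn N α b c (Set.Ico 0 R) φ φ' φ'' ∧
  ∀ S ψ ψ' ψ'', 0 < S → IsProfileSolOn N α b c (Set.Ico 0 S) ψ ψ' ψ'' →
    S ≤ R ∧ Set.EqOn ψ φ (Set.Ico 0 S)

open scoped ENNReal

/-- The mean curvature of the radially symmetric graph with slope `ur` and second
derivative `urr` at radius `r`; at `r = 0` it equals `N·u_rr(0)`. -/
noncomputable def meanCurv (N : ℕ) (r ur urr : ℝ) : ℝ :=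
  if r = 0 then (N : ℝ) * urr
  else urr / (1 + ur ^ 2) ^ ((3 : ℝ) / 2)
    + ((N : ℝ) - 1) * ur / (r * Real.sqrt (1 + ur ^ 2))

/-- `u₀` is `C²` initial data on `[0,1]`, with derivative `u₀'`, second derivative
`u₀''`, and boundary slopes `u₀'(0) = 0`, `u₀'(1) = k`. -/
def IsC2Data (k : ℝ) (u₀ u₀' u₀'' : ℝ → ℝ) : Prop :=
  (∀ r ∈ Set.Icc (0:ℝ) 1, HasDerivWithinAt u₀ (u₀' r) (Set.Icc 0 1) r) ∧
  (∀ r ∈ Set.Icc (0:ℝ) 1, HasDerivWithinAt u₀' (u₀'' r) (Set.Icc 0 1) r) ∧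
  ContinuousOn u₀'' (Set.Icc (0:ℝ) 1) ∧ u₀' 0 = 0 ∧ u₀' 1 = k

/-- `u` (with spatial derivatives `ur`, `urr` and time derivative `ut`) is a classical
solution of the flow `u_t = (H^α + b)·√(1+u_r²)` on `[0,1] × I`, with initial data
`u₀` (whose derivatives are `u₀'`, `u₀''`) and boundary slopes `u_r(0,t) = 0`,
`u_r(1,t) = k`. -/
def IsFlowSol (N : ℕ) (α b k : ℝ) (u₀ u₀' u₀'' : ℝ → ℝ) (I : Set ℝ)
    (u ur urr ut : ℝ → ℝ → ℝ) : Prop :=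
  ContinuousOn (fun p : ℝ × ℝ => u p.1 p.2) (Set.Icc 0 1 ×ˢ I) ∧
  ContinuousOn (fun p : ℝ × ℝ => ur p.1 p.2) (Set.Icc 0 1 ×ˢ I) ∧
  ContinuousOn (fun p : ℝ × ℝ => urr p.1 p.2) (Set.Icc 0 1 ×ˢ I) ∧
  ContinuousOn (fun p : ℝ × ℝ => ut p.1 p.2) (Set.Icc 0 1 ×ˢ I) ∧
  (∀ t ∈ I, ∀ r ∈ Set.Icc (0:ℝ) 1,
    HasDerivWithinAt (fun s => u s t) (ur r t) (Set.Icc 0 1) r) ∧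
  (∀ t ∈ I, ∀ r ∈ Set.Icc (0:ℝ) 1,
    HasDerivWithinAt (fun s => ur s t) (urr r t) (Set.Icc 0 1) r) ∧
  (∀ r ∈ Set.Icc (0:ℝ) 1, ∀ t ∈ I, HasDerivWithinAt (fun s => u r s) (ut r t) I t) ∧
  (∀ r ∈ Set.Icc (0:ℝ) 1, u r 0 = u₀ r ∧ ur r 0 = u₀' r ∧ urr r 0 = u₀'' r) ∧
  (∀ t ∈ I, ur 0 t = 0 ∧ ur 1 t = k) ∧
  (∀ t ∈ I, ∀ r ∈ Set.Ioc (0:ℝ) 1,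
    ut r t = (oddPow (meanCurv N r (ur r t) (urr r t)) α + b) * Real.sqrt (1 + ur r t ^ 2))

/-- The time interval `[0, T)` for `T ∈ (0, ∞]`, as a set of real numbers. -/
def timeSet (T : ℝ≥0∞) : Set ℝ := {t : ℝ | 0 ≤ t ∧ ENNReal.ofReal t < T}



namespace RF

noncomputable def Sf (X U : ℝ) : ℝ := Real.sqrt (1 + 4 * X * U ^ 2)
noncomputable def Vf (X U : ℝ) : ℝ := 2 * U / Sf X U
noncomputable def Rf (X U U' : ℝ) : ℝ := Sf X U + 4 * X * U * (U' - U) / (Sf X U + Sf X U')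
noncomputable def cf (X U U' : ℝ) : ℝ := 2 / (Sf X U * Sf X U' * Rf X U U')

lemma Sf_sq {X U : ℝ} (hX : 0 ≤ X) : Sf X U ^ 2 = 1 + 4 * X * U ^ 2 := by
  unfold Sf
  rw [Real.sq_sqrt]
  positivity

lemma Sf_ge_one {X U : ℝ} (hX : 0 ≤ X) : 1 ≤ Sf X U := by
  unfold Sf
  rw [Real.one_le_sqrt]
  have : 0 ≤ 4 * X * U ^ 2 := by positivity
  linarith

lemma Sf_pos {X U : ℝ} (hX : 0 ≤ X) : 0 < Sf X U := lt_of_lt_of_le one_pos (Sf_ge_one hX)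

lemma Sf_sub {X U U' : ℝ} (hX : 0 ≤ X) :
    Sf X U' - Sf X U = 4 * (U' + U) / (Sf X U + Sf X U') * X * (U' - U) := by
  have h1 := Sf_pos (U := U) hX
  have h2 := Sf_pos (U := U') hX
  have e1 := Sf_sq (U := U) hX
  have e2 := Sf_sq (U := U') hX
  have : Sf X U + Sf X U' ≠ 0 := by positivity
  field_simp
  linear_combination e2 - e1

lemma Rf_mul {X U U' : ℝ} (hX : 0 ≤ X) :
    Rf X U U' * (U + U') = U' * Sf X U + U * Sf X U' := by
  have h1 := Sf_pos (U := U) hX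
  have h2 := Sf_pos (U := U') hX
  have e1 := Sf_sq (U := U) hX
  have e2 := Sf_sq (U := U') hX
  have : Sf X U + Sf X U' ≠ 0 := by positivity
  unfold Rf
  field_simp
  linear_combination U * (e1 - e2)

lemma Rf_ge_one {X U U' : ℝ} (hX : 0 ≤ X) (hU : 0 < U) (hU' : 0 < U') : 1 ≤ Rf X U U' := by
  have h1 := Sf_ge_one (U := U) hX
  have h2 := Sf_ge_one (U := U') hX
  have := Rf_mul (U := U) (U' := U') hX
  by_contra h
  push Not at h
  nlinarith

lemma Rf_le {X U U' S : ℝ} (hX : 0 ≤ X) (hU : 0 < U) (hU' : 0 < U')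
    (h1 : Sf X U ≤ S) (h2 : Sf X U' ≤ S) : Rf X U U' ≤ S := by
  have := Rf_mul (U := U) (U' := U') hX
  by_contra h
  push Not at h
  nlinarith

lemma Vf_sub {X U U' : ℝ} (hX : 0 ≤ X) (hU : 0 < U) (hU' : 0 < U') :
    Vf X U' - Vf X U = cf X U U' * (U' - U) := by
  have h1 := Sf_pos (U := U) hX
  have h2 := Sf_pos (U := U') hX
  have e1 := Sf_sq (U := U) hX
  have e2 := Sf_sq (U := U') hX
  have hR := Rf_ge_one hX hU hU'
  have hm := Rf_mul (U := U) (U' := U') hX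
  have hRp : 0 < Rf X U U' := by linarith
  have key : (U' * Sf X U - U * Sf X U') * Rf X U U' = U' - U := by
    have hs : 0 < U + U' := by linarith
    have : (U + U') * ((U' * Sf X U - U * Sf X U') * Rf X U U') = (U + U') * (U' - U) := by
      linear_combination (U' * Sf X U - U * Sf X U') * hm + U' ^ 2 * e1 - U ^ 2 * e2
    exact mul_left_cancel₀ hs.ne' this
  unfold Vf cf
  rw [div_sub_div _ _ h2.ne' h1.ne', div_mul_eq_mul_div, div_eq_div_iff (by positivity) (by positivity)]
  linear_combination 2 * (Sf X U * Sf X U') * key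

lemma cf_le {X U U' : ℝ} (hX : 0 ≤ X) (hU : 0 < U) (hU' : 0 < U') : cf X U U' ≤ 2 := by
  have h1 := Sf_ge_one (U := U) hX
  have h2 := Sf_ge_one (U := U') hX
  have hR := Rf_ge_one hX hU hU'
  unfold cf
  apply div_le_self (by norm_num)
  have : 1 ≤ Sf X U * Sf X U' := one_le_mul_of_one_le_of_one_le h1 h2
  exact one_le_mul_of_one_le_of_one_le this hR

lemma cf_ge {X U U' S : ℝ} (hX : 0 ≤ X) (hU : 0 < U) (hU' : 0 < U')
    (h1 : Sf X U ≤ S) (h2 : Sf X U' ≤ S) : 2 / S ^ 3 ≤ cf X U U' := by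
  have p1 := Sf_pos (U := U) hX
  have p2 := Sf_pos (U := U') hX
  have hR := Rf_ge_one hX hU hU'
  have hR2 := Rf_le hX hU hU' h1 h2
  have hRp : 0 < Rf X U U' := by linarith
  have hS : 0 ≤ S := by linarith
  unfold cf
  apply div_le_div_of_nonneg_left (by norm_num) (by positivity)
  calc Sf X U * Sf X U' * Rf X U U' ≤ S * S * S := by gcongr
    _ = S ^ 3 := by ring

/-- difference of `2/(abc)` -/
lemma inv3_sub {a b c a' b' c' e : ℝ} (ha : 1 ≤ a) (hb : 1 ≤ b) (hc : 1 ≤ c)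
    (ha' : 1 ≤ a') (hb' : 1 ≤ b') (hc' : 1 ≤ c')
    (h1 : |a - a'| ≤ e) (h2 : |b - b'| ≤ e) (h3 : |c - c'| ≤ e) :
    |2 / (a * b * c) - 2 / (a' * b' * c')| ≤ 6 * e := by
  have key : 2 / (a * b * c) - 2 / (a' * b' * c') =
      2 * ((a' - a) * (1 / a) * (1 / a') * (1 / b) * (1 / c)
        + (b' - b) * (1 / a') * (1 / b) * (1 / b') * (1 / c)
        + (c' - c) * (1 / a') * (1 / b') * (1 / c) * (1 / c')) := by
    have : a ≠ 0 := by positivity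
    have : b ≠ 0 := by positivity
    have : c ≠ 0 := by positivity
    have : a' ≠ 0 := by positivity
    have : b' ≠ 0 := by positivity
    have : c' ≠ 0 := by positivity
    field_simp
    ring
  have bd : ∀ d x y z w : ℝ, |d| ≤ e → 1 ≤ x → 1 ≤ y → 1 ≤ z → 1 ≤ w →
      |d * (1 / x) * (1 / y) * (1 / z) * (1 / w)| ≤ e := by
    intro d x y z w hd hx hy hz hw
    have i : ∀ x : ℝ, 1 ≤ x → |1 / x| ≤ 1 := by
      intro x hx
      rw [abs_of_nonneg (by positivity)]
      exact div_le_one_of_le₀ hx (by positivity)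
    have he : 0 ≤ e := le_trans (abs_nonneg _) hd
    rw [abs_mul, abs_mul, abs_mul, abs_mul]
    calc |d| * |1 / x| * |1 / y| * |1 / z| * |1 / w| ≤ e * 1 * 1 * 1 * 1 := by
          gcongr <;> first | exact hd | (apply i; assumption)
      _ = e := by ring
  rw [key, abs_mul]
  have t1 := bd (a' - a) a a' b c (by rwa [abs_sub_comm]) ha ha' hb hc
  have t2 := bd (b' - b) a' b b' c (by rwa [abs_sub_comm]) ha' hb hb' hc
  have t3 := bd (c' - c) a' b' c c' (by rwa [abs_sub_comm]) ha' hb' hc hc'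
  have := abs_add_three ((a' - a) * (1 / a) * (1 / a') * (1 / b) * (1 / c))
    ((b' - b) * (1 / a') * (1 / b) * (1 / b') * (1 / c))
    ((c' - c) * (1 / a') * (1 / b') * (1 / c) * (1 / c'))
  rw [abs_of_pos (by norm_num : (0:ℝ) < 2)]
  linarith

/-- Lipschitz bound for S along a grid step. -/
lemma Sf_step {X Y U W e B : ℝ} (hX : 0 ≤ X) (hY : 0 ≤ Y)
    (h : |X * U ^ 2 - Y * W ^ 2| ≤ e) : |Sf X U - Sf Y W| ≤ 4 * e := by
  have h1 := Sf_ge_one (U := U) hX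
  have h2 := Sf_ge_one (U := W) hY
  have e1 := Sf_sq (U := U) hX
  have e2 := Sf_sq (U := W) hY
  have : (Sf X U - Sf Y W) * (Sf X U + Sf Y W) = 4 * (X * U ^ 2 - Y * W ^ 2) := by
    linear_combination e1 - e2
  have h3 : |Sf X U - Sf Y W| * (Sf X U + Sf Y W) = 4 * |X * U ^ 2 - Y * W ^ 2| := by
    rw [← abs_of_pos (by linarith : 0 < Sf X U + Sf Y W), ← abs_mul, this, abs_mul]
    norm_num
  nlinarith [abs_nonneg (Sf X U - Sf Y W)]

/-- product with weight: `X U U' - Y W W'`. -/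
lemma prod_step {X Y U W U' W' B h : ℝ} (hX : 0 ≤ X) (hY : 0 ≤ Y)
    (hXY : |X - Y| ≤ h) (hU' : |U'| ≤ B) (hW : |W| ≤ B) (hW' : |W'| ≤ B)
    (h1 : X * |U - W| ≤ B * h) (h2 : X * |U' - W'| ≤ B * h) :
    |X * (U * U') - Y * (W * W')| ≤ 3 * B ^ 2 * h := by
  have hB : 0 ≤ B := le_trans (abs_nonneg _) hW
  have e : X * (U * U') - Y * (W * W') =
      (X * (U - W)) * U' + W * (X * (U' - W')) + (X - Y) * (W * W') := by ring
  rw [e]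
  have a1 : |(X * (U - W)) * U'| ≤ (B * h) * B := by
    rw [abs_mul, abs_mul, abs_of_nonneg hX]; gcongr
    exact le_trans (by positivity) h1
  have a2 : |W * (X * (U' - W'))| ≤ B * (B * h) := by
    rw [abs_mul, abs_mul, abs_of_nonneg hX]; gcongr
  have a3 : |(X - Y) * (W * W')| ≤ h * (B * B) := by
    rw [abs_mul, abs_mul]; gcongr
    exact le_trans (abs_nonneg _) hXY
  have := abs_add_three ((X * (U - W)) * U') (W * (X * (U' - W'))) ((X - Y) * (W * W'))
  nlinarith

lemma cf_step {X Y U W U' W' B h : ℝ} (hX : 0 ≤ X) (hY : 0 ≤ Y)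
    (hXY : |X - Y| ≤ h) (hU : 0 < U) (hUB : U ≤ B) (hU' : 0 < U') (hUB' : U' ≤ B)
    (hW : 0 < W) (hWB : W ≤ B) (hW' : 0 < W') (hWB' : W' ≤ B)
    (hX1 : X ≤ 1)
    (h1 : X * |U - W| ≤ B * h) (h2 : X * |U' - W'| ≤ B * h) :
    |cf X U U' - cf Y W W'| ≤ 6 * (12 * B ^ 2 * h + 12 * B ^ 2 * h + 48 * B ^ 4 * h) := by
  have aU : |U| ≤ B := by rw [abs_of_pos hU]; exact hUB
  have aU' : |U'| ≤ B := by rw [abs_of_pos hU']; exact hUB'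
  have aW : |W| ≤ B := by rw [abs_of_pos hW]; exact hWB
  have aW' : |W'| ≤ B := by rw [abs_of_pos hW']; exact hWB'
  have hh : 0 ≤ h := le_trans (abs_nonneg _) hXY
  have hB : 0 < B := by linarith
  have p1 := prod_step (U := U) (U' := U) hX hY hXY aU aW aW h1 h1
  have p2 := prod_step (U := U') (U' := U') hX hY hXY aU' aW' aW' h2 h2
  have p3 := prod_step (U := U) (U' := U') hX hY hXY aU' aW aW' h1 h2
  have s1 : |Sf X U - Sf Y W| ≤ 12 * B ^ 2 * h := by
    have := Sf_step (B := B) (U := U) (W := W) (e := 3 * B ^ 2 * h) hX hY (by simpa [pow_two, mul_assoc] using p1)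
    linarith
  have s2 : |Sf X U' - Sf Y W'| ≤ 12 * B ^ 2 * h := by
    have := Sf_step (B := B) (U := U') (W := W') (e := 3 * B ^ 2 * h) hX hY (by simpa [pow_two, mul_assoc] using p2)
    linarith
  have q1 := Sf_ge_one (U := U) hX
  have q2 := Sf_ge_one (U := U') hX
  have q3 := Sf_ge_one (U := W) hY
  have q4 := Sf_ge_one (U := W') hY
  have r : |4 * X * U * (U' - U) / (Sf X U + Sf X U') - 4 * Y * W * (W' - W) / (Sf Y W + Sf Y W')|
      ≤ 12 * B ^ 2 * h + 48 * B ^ 4 * h := by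
    have e : 4 * X * U * (U' - U) / (Sf X U + Sf X U') - 4 * Y * W * (W' - W) / (Sf Y W + Sf Y W')
      = 4 * ((X * (U * U') - Y * (W * W')) - (X * (U * U) - Y * (W * W))) * (1 / (Sf Y W + Sf Y W'))
        + 4 * (X * (U * U') - X * (U * U)) * ((Sf Y W - Sf X U + (Sf Y W' - Sf X U')) * (1 / (Sf X U + Sf X U')) * (1 / (Sf Y W + Sf Y W'))) := by
      have : Sf X U + Sf X U' ≠ 0 := by positivity
      have : Sf Y W + Sf Y W' ≠ 0 := by positivity
      field_simp
      ring
    have i1 : |1 / (Sf Y W + Sf Y W')| ≤ 1 / 2 := by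
      rw [abs_of_nonneg (by positivity)]
      exact one_div_le_one_div_of_le (by norm_num) (by linarith)
    have i2 : |1 / (Sf X U + Sf X U')| ≤ 1 / 2 := by
      rw [abs_of_nonneg (by positivity)]
      exact one_div_le_one_div_of_le (by norm_num) (by linarith)
    have j1 : |(X * (U * U') - Y * (W * W')) - (X * (U * U) - Y * (W * W))| ≤ 6 * B ^ 2 * h := by
      have := abs_sub (X * (U * U') - Y * (W * W')) (X * (U * U) - Y * (W * W))
      linarith
    have j2 : |X * (U * U') - X * (U * U)| ≤ 2 * B ^ 2 := by
      have : X * (U * U') - X * (U * U) = X * U * (U' - U) := by ring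
      rw [this, abs_mul, abs_mul, abs_of_nonneg hX]
      have h4 : |U' - U| ≤ 2 * B := by rw [abs_le]; constructor <;> linarith
      calc X * |U| * |U' - U| ≤ 1 * B * (2 * B) := by gcongr
        _ = _ := by ring
    have j3 : |Sf Y W - Sf X U + (Sf Y W' - Sf X U')| ≤ 24 * B ^ 2 * h := by
      have := abs_add_le (Sf Y W - Sf X U) (Sf Y W' - Sf X U')
      rw [abs_sub_comm] at s1 s2
      linarith
    rw [e]
    refine le_trans (abs_add_le _ _) ?_
    have k1 : |4 * ((X * (U * U') - Y * (W * W')) - (X * (U * U) - Y * (W * W))) * (1 / (Sf Y W + Sf Y W'))| ≤ 4 * (6 * B ^ 2 * h) * (1 / 2) := by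
      rw [abs_mul, abs_mul, abs_of_pos (by norm_num : (0:ℝ) < 4)]
      gcongr
    have k2 : |4 * (X * (U * U') - X * (U * U)) * ((Sf Y W - Sf X U + (Sf Y W' - Sf X U')) * (1 / (Sf X U + Sf X U')) * (1 / (Sf Y W + Sf Y W')))| ≤ 4 * (2 * B ^ 2) * ((24 * B ^ 2 * h) * (1 / 2) * (1 / 2)) := by
      rw [abs_mul, abs_mul, abs_mul (_ * _), abs_mul (_ + _), abs_of_pos (by norm_num : (0:ℝ) < 4)]
      gcongr
    nlinarith
  unfold cf
  have rr : |Rf X U U' - Rf Y W W'| ≤ 12 * B ^ 2 * h + 12 * B ^ 2 * h + 48 * B ^ 4 * h := by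
    unfold Rf
    have := abs_add_le (Sf X U - Sf Y W) (4 * X * U * (U' - U) / (Sf X U + Sf X U') - 4 * Y * W * (W' - W) / (Sf Y W + Sf Y W'))
    rw [show Sf X U + 4 * X * U * (U' - U) / (Sf X U + Sf X U') - (Sf Y W + 4 * Y * W * (W' - W) / (Sf Y W + Sf Y W')) = (Sf X U - Sf Y W) + (4 * X * U * (U' - U) / (Sf X U + Sf X U') - 4 * Y * W * (W' - W) / (Sf Y W + Sf Y W')) by ring]
    linarith
  have n1 : 0 ≤ B ^ 2 * h := by positivity
  have n2 : 0 ≤ B ^ 4 * h := by positivity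
  apply inv3_sub q1 q2 (Rf_ge_one hX hU hU') q3 q4 (Rf_ge_one hY hW hW') _ _ rr
  · linarith
  · linarith

end RF


namespace RF

noncomputable def Vd (n : ℕ) (U : ℕ → ℝ) (i : ℕ) : ℝ := Vf ((i:ℝ) / n) (U i)
noncomputable def Sd (n : ℕ) (U : ℕ → ℝ) (i : ℕ) : ℝ := Sf ((i:ℝ) / n) (U i)
noncomputable def Hd (ν : ℝ) (n : ℕ) (U : ℕ → ℝ) (i : ℕ) : ℝ :=
  ν * Vd n U i + 2 * i * (Vd n U i - Vd n U (i - 1))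
noncomputable def Fd (ν α b : ℝ) (n : ℕ) (U : ℕ → ℝ) (i : ℕ) : ℝ :=
  (Hd ν n U i ^ α + b) * Sd n U i

/-- Admissible states. -/
def Adm (ν : ℝ) (n : ℕ) (H1 H2 S : ℝ) (U : ℕ → ℝ) : Prop :=
  ∀ i ≤ n, 0 < U i ∧ H1 ≤ Hd ν n U i ∧ Hd ν n U i ≤ H2 ∧ Sd n U i ≤ S

lemma xg_nonneg (n i : ℕ) : (0:ℝ) ≤ (i:ℝ) / n := by positivity

lemma xg_le_one {n i : ℕ} (h : i ≤ n) : (i:ℝ) / n ≤ 1 := by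
  apply div_le_one_of_le₀ (by exact_mod_cast h) (by positivity)

lemma Vd_pos {n : ℕ} {U : ℕ → ℝ} {i : ℕ} (h : 0 < U i) : 0 < Vd n U i := by
  have := Sf_pos (U := U i) (xg_nonneg n i)
  unfold Vd Vf; positivity

lemma pos_of_Vd_pos {n : ℕ} {U : ℕ → ℝ} {i : ℕ} (h : 0 < Vd n U i) : 0 < U i := by
  have := Sf_pos (U := U i) (xg_nonneg n i)
  unfold Vd Vf at h
  rw [div_pos_iff_of_pos_right this] at h
  linarith

lemma U_eq {n : ℕ} {U : ℕ → ℝ} {i : ℕ} : U i = Vd n U i * Sd n U i / 2 := by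
  have := Sf_pos (U := U i) (xg_nonneg n i)
  unfold Vd Vf Sd; field_simp

/-- positivity of curvature gives positivity of the state -/
lemma U_pos_of_Hd {ν : ℝ} (hν : 0 < ν) {n : ℕ} {U : ℕ → ℝ}
    (hH : ∀ i ≤ n, 0 < Hd ν n U i) : ∀ i ≤ n, 0 < U i := by
  intro i hi
  apply pos_of_Vd_pos (n := n)
  induction i with
  | zero =>
    have := hH 0 hi
    simp only [Hd, Nat.cast_zero, mul_zero, zero_mul, add_zero] at this
    exact pos_of_mul_pos_right this hν.le
  | succ i ih =>
    have h1 := ih (by omega)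
    have := hH (i+1) hi
    simp only [Hd, Nat.add_sub_cancel] at this
    have hi0 : (0:ℝ) < ((i+1:ℕ):ℝ) := by positivity
    by_contra h
    push Not at h
    nlinarith [mul_pos hi0 h1, mul_nonneg hi0.le (neg_nonneg.2 h), mul_nonneg hν.le (neg_nonneg.2 h)]

lemma Vd_bounds {ν : ℝ} (hν : 0 < ν) {n m : ℕ} {U : ℕ → ℝ} {A B : ℝ}
    (hH : ∀ i ≤ m, A ≤ Hd ν n U i ∧ Hd ν n U i ≤ B) :
    ∀ i ≤ m, A / ν ≤ Vd n U i ∧ Vd n U i ≤ B / ν := by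
  intro i hi
  rw [div_le_iff₀ hν, le_div_iff₀ hν]
  induction i with
  | zero =>
    have := hH 0 hi
    simp only [Hd, Nat.cast_zero, mul_zero, zero_mul, add_zero] at this
    constructor <;> linarith
  | succ i ih =>
    have h1 := ih (by omega)
    have := hH (i+1) hi
    simp only [Hd, Nat.add_sub_cancel] at this
    have hi0 : (0:ℝ) < ((i+1:ℕ):ℝ) := by positivity
    set x : ℝ := ((i+1:ℕ):ℝ)
    set V := Vd n U (i+1)
    set W := Vd n U i
    constructor
    · by_contra h
      push Not at h
      have : V < W := by nlinarith
      nlinarith [mul_pos hi0 (sub_pos.2 this)]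
    · by_contra h
      push Not at h
      have : W < V := by nlinarith
      nlinarith [mul_pos hi0 (sub_pos.2 this)]

lemma Vd_step {ν : ℝ} (hν : 0 < ν) {n : ℕ} {U : ℕ → ℝ} {B : ℝ} (hB : 0 ≤ B)
    (hH : ∀ i ≤ n, 0 ≤ Hd ν n U i ∧ Hd ν n U i ≤ B) :
    ∀ i ≤ n, (i:ℝ) * |Vd n U i - Vd n U (i-1)| ≤ B := by
  intro i hi
  have h1 := hH i hi
  have h2 := Vd_bounds hν hH i hi
  rw [zero_div, le_div_iff₀ hν] at h2
  have h3 : 0 ≤ ν * Vd n U i := mul_nonneg hν.le h2.1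
  unfold Hd at h1
  have : (i:ℝ) * |Vd n U i - Vd n U (i-1)| = |(i:ℝ) * (Vd n U i - Vd n U (i-1))| := by
    rw [abs_mul, Nat.abs_cast]
  rw [this, abs_le]
  constructor <;> nlinarith

/-- Uniform bounds for admissible states. -/
lemma adm_bounds {ν H1 H2 S : ℝ} (hν : 0 < ν) (hH1 : 0 < H1) (hH2 : H1 ≤ H2) (hS : 1 ≤ S) :
    ∃ B : ℝ, 0 < B ∧ ∀ n : ℕ, ∀ U, Adm ν n H1 H2 S U → ∀ i ≤ n,
      U i ≤ B ∧ (i:ℝ) * |U i - U (i-1)| ≤ B ∧ H1 / ν ≤ Vd n U i ∧ Vd n U i ≤ H2 / ν ∧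
      (i:ℝ) * |Vd n U i - Vd n U (i-1)| ≤ H2 := by
  have hH2p : 0 < H2 := by linarith
  set Vm := H2 / ν with hVm
  have hVmp : 0 < Vm := by positivity
  refine ⟨Vm * S / 2 + (Vm * (S^4 * (2 * H2 * Vm + Vm^2)) + S * H2), by positivity, ?_⟩
  intro n U hU i hi
  have hHb : ∀ i ≤ n, 0 ≤ Hd ν n U i ∧ Hd ν n U i ≤ H2 :=
    fun i hi => ⟨by linarith [(hU i hi).2.1], (hU i hi).2.2.1⟩
  have hV := Vd_bounds hν (fun i hi => ⟨(hU i hi).2.1, (hU i hi).2.2.1⟩)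
  have hst := Vd_step hν hH2p.le hHb i hi
  have hVi := hV i hi
  have hi' : i - 1 ≤ n := by omega
  have hVi' := hV (i-1) hi'
  have hVp := Vd_pos (n := n) (hU i hi).1
  have hVp' := Vd_pos (n := n) (hU (i-1) hi').1
  have hSi : Sd n U i ≤ S := (hU i hi).2.2.2
  have hSi' : Sd n U (i-1) ≤ S := (hU (i-1) hi').2.2.2
  have hS1 : 1 ≤ Sd n U i := Sf_ge_one (xg_nonneg _ _)
  have hS1' : 1 ≤ Sd n U (i-1) := Sf_ge_one (xg_nonneg _ _)
  have e1 : U i = _ := U_eq (n := n)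
  have e2 : U (i-1) = _ := U_eq (n := n)
  have sq : ∀ l, Sd n U l ^ 2 * (1 - (l:ℝ)/n * Vd n U l ^ 2) = 1 := by
    intro l
    have h1 := Sf_sq (U := U l) (xg_nonneg n l)
    have h2 : U l = _ := U_eq (n := n)
    change Sd n U l ^ 2 = _ at h1
    rw [h2] at h1
    linear_combination h1
  have q1 := sq i
  have q2 := sq (i-1)
  set x : ℝ := (i:ℝ) / n with hx
  set y : ℝ := ((i-1:ℕ):ℝ) / n with hy
  have hx1 : x ≤ 1 := xg_le_one hi
  have hx0 : 0 ≤ x := xg_nonneg _ _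
  have hi0 : (0:ℝ) ≤ i := Nat.cast_nonneg i
  have hxy : (i:ℝ) * |x - y| ≤ 1 := by
    rcases Nat.eq_zero_or_pos i with h | h
    · subst h; simp
    · have : x - y = 1 / n := by
        rw [hx, hy, Nat.cast_sub h]; ring
      rw [this, abs_of_nonneg (by positivity), mul_one_div]
      exact hx1
  set V := Vd n U i
  set W := Vd n U (i-1)
  set P := Sd n U i
  set R := Sd n U (i-1)
  have hd : (i:ℝ) * |x * V^2 - y * W^2| ≤ 2 * H2 * Vm + Vm^2 := by
    have : x * V^2 - y * W^2 = x * ((V - W) * (V + W)) + (x - y) * W^2 := by ring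
    rw [this]
    have a1 : (i:ℝ) * |x * ((V - W) * (V + W))| ≤ 1 * (H2 * (2 * Vm)) := by
      rw [abs_mul, abs_mul, abs_of_nonneg hx0, abs_of_pos (by linarith : 0 < V + W)]
      calc (i:ℝ) * (x * (|V-W| * (V+W))) = x * ((i * |V-W|) * (V+W)) := by ring
        _ ≤ 1 * (H2 * (2 * Vm)) := by gcongr; linarith
    have a2 : (i:ℝ) * |(x - y) * W^2| ≤ 1 * Vm^2 := by
      rw [abs_mul, abs_of_nonneg (sq_nonneg W), ← mul_assoc]
      gcongr; exact hVi'.2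
    nlinarith [abs_add_le (x * ((V - W) * (V + W))) ((x - y) * W^2)]
  have hP : P - R = P^2 * R^2 * (x * V^2 - y * W^2) / (P + R) := by
    have : P + R ≠ 0 := by positivity
    field_simp
    linear_combination R ^ 2 * q1 - P ^ 2 * q2
  have hPR : (i:ℝ) * |P - R| ≤ S^4 * (2 * H2 * Vm + Vm^2) := by
    rw [hP, abs_div, abs_mul, abs_of_pos (by positivity : 0 < P^2 * R^2),
      abs_of_pos (by linarith : 0 < P + R), ← mul_div_assoc]
    apply le_trans (div_le_self (by positivity) (by linarith))
    calc (i:ℝ) * (P^2*R^2 * |x * V^2 - y * W^2|) = (P^2*R^2) * (i * |x * V^2 - y * W^2|) := by ring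
      _ ≤ (S^2*S^2) * (2 * H2 * Vm + Vm^2) := by gcongr
      _ = _ := by ring
  have hS0 : 0 ≤ S := by linarith
  have hn0 : 0 ≤ Vm * (S^4 * (2 * H2 * Vm + Vm^2)) + S * H2 := by positivity
  refine ⟨?_, ?_, hVi.1, hVi.2, hst⟩
  · rw [e1]
    have : V * P ≤ Vm * S := by gcongr; exact hVi.2
    linarith
  · have : U i - U (i-1) = (V * (P - R) + R * (V - W)) / 2 := by
      rw [e1, e2]; ring
    rw [this, abs_div, abs_of_pos (by norm_num : (0:ℝ) < 2)]
    have b1 : (i:ℝ) * |V * (P - R)| ≤ Vm * (S^4 * (2 * H2 * Vm + Vm^2)) := by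
      rw [abs_mul, abs_of_pos hVp]
      calc (i:ℝ) * (V * |P - R|) = V * (i * |P - R|) := by ring
        _ ≤ _ := by gcongr; exact hVi.2
    have b2 : (i:ℝ) * |R * (V - W)| ≤ S * H2 := by
      rw [abs_mul, abs_of_pos (by linarith : 0 < R)]
      calc (i:ℝ) * (R * |V - W|) = R * (i * |V - W|) := by ring
        _ ≤ _ := by gcongr
    have b3 := mul_le_mul_of_nonneg_left (abs_add_le (V * (P - R)) (R * (V - W))) hi0
    have b4 : 0 ≤ Vm * S / 2 := by positivity
    linarith [mul_div_assoc (i:ℝ) |V * (P - R) + R * (V - W)| 2, mul_nonneg hi0 (abs_nonneg (V * (P - R) + R * (V - W)))]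

/-- divided differences of the power function -/
lemma pow_dd {α H1 H2 : ℝ} (hα : 0 < α) (hH1 : 0 < H1) (hH : H1 ≤ H2) :
    ∃ a0 a1 : ℝ, 0 < a0 ∧ a0 ≤ a1 ∧ ∀ x ∈ Icc H1 H2, ∀ y ∈ Icc H1 H2,
      ∃ a, a0 ≤ a ∧ a ≤ a1 ∧ y ^ α - x ^ α = a * (y - x) := by
  have hc : ContinuousOn (fun t : ℝ => α * t ^ (α - 1)) (Icc H1 H2) := by
    apply ContinuousOn.mul continuousOn_const
    apply ContinuousOn.rpow_const continuousOn_id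
    intro x hx; left; exact (lt_of_lt_of_le hH1 hx.1).ne'
  have hne : (Icc H1 H2).Nonempty := ⟨H1, le_refl _, hH⟩
  obtain ⟨x0, hx0, h0⟩ := isCompact_Icc.exists_isMinOn hne hc
  obtain ⟨x1, hx1, h1⟩ := isCompact_Icc.exists_isMaxOn hne hc
  have hx0p : 0 < x0 := lt_of_lt_of_le hH1 hx0.1
  have key : ∀ x ∈ Icc H1 H2, ∀ y ∈ Icc H1 H2, x < y →
      ∃ a, α * x0 ^ (α - 1) ≤ a ∧ a ≤ α * x1 ^ (α - 1) ∧ y ^ α - x ^ α = a * (y - x) := by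
    intro x hx y hy hxy
    have hxp : 0 < x := lt_of_lt_of_le hH1 hx.1
    obtain ⟨c, hc, hce⟩ := exists_hasDerivAt_eq_slope (fun t : ℝ => t ^ α)
      (fun t => α * t ^ (α - 1)) hxy
      (ContinuousOn.rpow_const continuousOn_id (fun z hz => Or.inl (lt_of_lt_of_le hxp hz.1).ne'))
      (fun z hz => Real.hasDerivAt_rpow_const (Or.inl (lt_trans hxp hz.1).ne'))
    have hcm : c ∈ Icc H1 H2 := ⟨by linarith [hx.1, hc.1], by linarith [hy.2, hc.2]⟩
    refine ⟨α * c ^ (α - 1), h0 hcm, h1 hcm, ?_⟩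
    rw [hce, div_mul_cancel₀]
    linarith
  refine ⟨α * x0 ^ (α - 1), α * x1 ^ (α - 1), by positivity, h0 hx1, ?_⟩
  intro x hx y hy
  rcases lt_trichotomy x y with h | h | h
  · exact key x hx y hy h
  · subst h; exact ⟨_, le_refl _, h0 hx1, by ring⟩
  · obtain ⟨a, h1, h2, h3⟩ := key y hy x hx h
    exact ⟨a, h1, h2, by linarith⟩

end RF


namespace RF

def LinCoef (ν l L C : ℝ) (n i : ℕ) (a b : ℝ) : Prop :=
  0 ≤ a ∧ 0 ≤ b ∧ ∃ κ, l ≤ κ ∧ κ ≤ L ∧ |a - κ * (2 * ν + 4 * i)| ≤ C * ((i:ℝ) / n) ∧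
    |b - 4 * κ * i| ≤ C * ((i:ℝ) / n)

lemma Hd_sub {ν : ℝ} {n : ℕ} {U U' : ℕ → ℝ} {i : ℕ}
    (h1 : 0 < U i) (h2 : 0 < U' i) (h3 : 0 < U (i-1)) (h4 : 0 < U' (i-1)) :
    Hd ν n U' i - Hd ν n U i =
      (ν + 2 * i) * cf ((i:ℝ)/n) (U i) (U' i) * (U' i - U i)
       - 2 * i * cf (((i-1:ℕ):ℝ)/n) (U (i-1)) (U' (i-1)) * (U' (i-1) - U (i-1)) := by
  have e1 := Vf_sub (xg_nonneg n i) h1 h2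
  have e2 := Vf_sub (xg_nonneg n (i-1)) h3 h4
  unfold Hd Vd
  linear_combination (ν + 2 * i) * e1 - 2 * i * e2

set_option maxHeartbeats 1000000 in
lemma lin_F {ν α b H1 H2 S : ℝ} (hν : 0 < ν) (hα : 0 < α) (hH1 : 0 < H1) (hH2 : H1 ≤ H2)
    (hS : 1 ≤ S) :
    ∃ l L C : ℝ, 0 < l ∧ l ≤ L ∧ 0 < C ∧ ∀ n : ℕ, 0 < n → ∀ U U', Adm ν n H1 H2 S U →
      Adm ν n H1 H2 S U' → (∀ i ≤ n, 0 ≤ Hd ν n U i ^ α + b) → ∀ i ≤ n,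
      ∃ p q, LinCoef ν l L C n i p q ∧
        Fd ν α b n U' i - Fd ν α b n U i = p * (U' i - U i) - q * (U' (i-1) - U (i-1)) := by
  obtain ⟨B, hB, hbd⟩ := adm_bounds hν hH1 hH2 hS
  obtain ⟨a0, a1, ha0, ha01, hdd⟩ := pow_dd hα hH1 hH2
  have hSp : 0 < S := by linarith
  have hH2p : 0 < H2 := by linarith
  have ha1 : 0 < a1 := by linarith
  set D := 6 * (12 * B ^ 2 + 12 * B ^ 2 + 48 * B ^ 4) with hD
  have hS31 : 1 / S ^ 3 ≤ 1 := div_le_one_of_le₀ (one_le_pow₀ hS) (by positivity)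
  refine ⟨a0 * (1 / S ^ 3), a1 * S, (H2 ^ α + |b|) * (4 * B) + 2 * (a1 * S) * D + 1, by positivity, ?_, by positivity, ?_⟩
  · calc a0 * (1 / S ^ 3) ≤ a1 * 1 := by gcongr
      _ ≤ a1 * S := by gcongr
  intro n hn U U' hU hU' hf i hi
  have hi' : i - 1 ≤ n := by omega
  have A1 := hU i hi
  have A2 := hU' i hi
  have A3 := hU (i-1) hi'
  have A4 := hU' (i-1) hi'
  obtain ⟨af, haf0, haf1, hafe⟩ := hdd _ ⟨A1.2.1, A1.2.2.1⟩ _ ⟨A2.2.1, A2.2.2.1⟩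
  have hHs := Hd_sub (ν := ν) (n := n) A1.1 A2.1 A3.1 A4.1
  have B1 := hbd n U hU i hi
  have B2 := hbd n U' hU' i hi
  have B3 := hbd n U hU (i-1) hi'
  have B4 := hbd n U' hU' (i-1) hi'
  have hX := xg_nonneg n i
  have hY := xg_nonneg n (i-1)
  have hX1 := xg_le_one hi
  have c1 := cf_le hX A1.1 A2.1
  have c2 := cf_ge hX A1.1 A2.1 A1.2.2.2 A2.2.2.2
  have c3 : 0 < cf (((i-1:ℕ):ℝ)/n) (U (i-1)) (U' (i-1)) :=
    lt_of_lt_of_le (by positivity) (cf_ge hY A3.1 A4.1 A3.2.2.2 A4.2.2.2)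
  have hi0 : (0:ℝ) ≤ i := Nat.cast_nonneg i
  have hnp : (0:ℝ) < n := by exact_mod_cast hn
  have hstep : (i:ℝ) * |cf ((i:ℝ)/n) (U i) (U' i) - cf (((i-1:ℕ):ℝ)/n) (U (i-1)) (U' (i-1))|
      ≤ D * ((i:ℝ) / n) := by
    rcases Nat.eq_zero_or_pos i with h | h
    · subst h; simp
    have := cf_step (X := (i:ℝ)/n) (Y := ((i-1:ℕ):ℝ)/n) (h := 1/n) (B := B) hX hY (by
        rw [Nat.cast_sub h, ← sub_div]; simp) A1.1 B1.1 A2.1 B2.1 A3.1 B3.1 A4.1 B4.1 hX1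
        (by rw [mul_one_div, div_mul_eq_mul_div]; gcongr; exact B1.2.1)
        (by rw [mul_one_div, div_mul_eq_mul_div]; gcongr; exact B2.2.1)
    calc (i:ℝ) * _ ≤ i * (6 * (12 * B ^ 2 * (1/n) + 12 * B ^ 2 * (1/n) + 48 * B ^ 4 * (1/n))) := by gcongr
      _ = D * (i / n) := by rw [hD]; field_simp
  have hSs := Sf_sub (U := U i) (U' := U' i) hX
  have q1 : 1 ≤ Sd n U i := Sf_ge_one hX
  have q2 : 1 ≤ Sd n U' i := Sf_ge_one hX
  have q3 : Sd n U' i ≤ S := A2.2.2.2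
  have he0 : 0 ≤ 4 * (U' i + U i) / (Sf ((i:ℝ)/n) (U i) + Sf ((i:ℝ)/n) (U' i)) := by
    have := A1.1; have := A2.1
    unfold Sd at q1 q2; positivity
  have he1 : 4 * (U' i + U i) / (Sf ((i:ℝ)/n) (U i) + Sf ((i:ℝ)/n) (U' i)) ≤ 4 * B := by
    unfold Sd at q1 q2
    rw [div_le_iff₀ (by linarith)]
    have hh : 4 * B * 2 ≤ 4 * B * (Sf ((i:ℝ)/n) (U i) + Sf ((i:ℝ)/n) (U' i)) := by
      gcongr; linarith
    linarith [B1.1, B2.1]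
  have hf0 := hf i hi
  have hf1 : Hd ν n U i ^ α + b ≤ H2 ^ α + |b| := by
    have : Hd ν n U i ^ α ≤ H2 ^ α := Real.rpow_le_rpow (by linarith [A1.2.1]) A1.2.2.1 hα.le
    linarith [le_abs_self b]
  set e := 4 * (U' i + U i) / (Sf ((i:ℝ)/n) (U i) + Sf ((i:ℝ)/n) (U' i))
  set ci := cf ((i:ℝ)/n) (U i) (U' i)
  set cj := cf (((i-1:ℕ):ℝ)/n) (U (i-1)) (U' (i-1))
  have hafp : 0 < af := by linarith
  have hci : 0 < ci := lt_of_lt_of_le (by positivity) c2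
  have hS'p : 0 < Sd n U' i := by linarith
  refine ⟨af * Sd n U' i * (ν + 2 * i) * ci + (Hd ν n U i ^ α + b) * e * ((i:ℝ)/n),
    af * Sd n U' i * (2 * i) * cj, ⟨by positivity, by positivity, af * Sd n U' i * ci / 2, ?_, ?_, ?_, ?_⟩, ?_⟩
  · calc a0 * (1 / S^3) = a0 * 1 * (2 / S^3) / 2 := by ring
      _ ≤ af * Sd n U' i * ci / 2 := by gcongr
  · calc af * Sd n U' i * ci / 2 ≤ a1 * S * 2 / 2 := by gcongr
      _ = a1 * S := by ring
  · rw [show af * Sd n U' i * (ν + 2 * i) * ci + (Hd ν n U i ^ α + b) * e * ((i:ℝ)/n) - af * Sd n U' i * ci / 2 * (2 * ν + 4 * i) = (Hd ν n U i ^ α + b) * e * ((i:ℝ)/n) by ring]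
    rw [abs_of_nonneg (by positivity)]
    have : (Hd ν n U i ^ α + b) * e ≤ (H2 ^ α + |b|) * (4 * B) := by gcongr
    have h2 : 0 ≤ 2 * (a1 * S) * D := by positivity
    gcongr; linarith
  · rw [show af * Sd n U' i * (2 * i) * cj - 4 * (af * Sd n U' i * ci / 2) * i = -(2 * (af * Sd n U' i) * (i * (ci - cj))) by ring, abs_neg, abs_mul, abs_mul (i:ℝ), Nat.abs_cast, abs_of_pos (by positivity)]
    have : 2 * (af * Sd n U' i) * (i * |ci - cj|) ≤ 2 * (a1 * S) * (D * ((i:ℝ)/n)) := by gcongr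
    have h2 : 0 ≤ (H2 ^ α + |b|) * (4 * B) * ((i:ℝ)/n) := by positivity
    have h3 : ((H2 ^ α + |b|) * (4 * B) + 2 * (a1 * S) * D + 1) * ((i:ℝ)/n) = (H2 ^ α + |b|) * (4 * B) * ((i:ℝ)/n) + 2 * (a1 * S) * (D * ((i:ℝ)/n)) + (i:ℝ)/n := by ring
    linarith
  · unfold Fd
    change Sd n U' i - Sd n U i = _ at hSs
    rw [hHs] at hafe
    linear_combination Sd n U' i * hafe + (Hd ν n U i ^ α + b) * hSs

/-- one step of the linearized scheme -/
def LinStep (ν l L C : ℝ) (n : ℕ) (τ e : ℝ) (Z Z' : ℕ → ℝ) : Prop :=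
  ∀ i ≤ n, ∃ a b, LinCoef ν l L C n i a b ∧
    |Z' i - (Z i + τ * n * (a * (if i < n then Z (i+1) - Z i else 0) - b * (Z i - Z (i-1))))| ≤ τ * e

lemma LinStep.neg {ν l L C : ℝ} {n : ℕ} {τ e : ℝ} {Z Z' : ℕ → ℝ}
    (h : LinStep ν l L C n τ e Z Z') : LinStep ν l L C n τ e (fun i => - Z i) (fun i => - Z' i) := by
  intro i hi
  obtain ⟨a, b, h1, h2⟩ := h i hi
  refine ⟨a, b, h1, ?_⟩
  rw [← abs_neg]
  convert h2 using 2
  split_ifs <;> ring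

lemma LinCoef.sum_le {ν l L C : ℝ} {n i : ℕ} {a b : ℝ} (h : LinCoef ν l L C n i a b) (hν : 0 < ν)
    (hC : 0 ≤ C) (hl : 0 < l) (hi : i ≤ n) : a + b ≤ L * (2 * ν + 8 * n) + 2 * C := by
  obtain ⟨h0, h1, κ, k1, k2, h2, h3⟩ := h
  have hx := xg_le_one hi
  have hi' : (i:ℝ) ≤ n := by exact_mod_cast hi
  have i0 : (0:ℝ) ≤ i := Nat.cast_nonneg i
  have := (abs_le.1 h2).2
  have := (abs_le.1 h3).2
  have : C * ((i:ℝ)/n) ≤ C * 1 := by gcongr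
  have : κ * (2 * ν + 8 * i) ≤ L * (2 * ν + 8 * n) := by gcongr; linarith
  linarith

/-- CFL condition -/
def CFL (ν L C : ℝ) (n : ℕ) (τ : ℝ) : Prop := 0 < τ ∧ 2 * τ * n * (L * (2 * ν + 8 * n) + 2 * C) ≤ 1

/-- comparison with a barrier -/
lemma LinStep.barrier {ν l L C : ℝ} {n : ℕ} {τ e om : ℝ} {Z Z' q : ℕ → ℝ}
    (hν : 0 < ν) (hl : 0 < l) (hC : 0 ≤ C) (hcfl : CFL ν L C n τ)
    (h : LinStep ν l L C n τ e Z Z')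
    (hZ : ∀ i ≤ n, Z i ≤ q i)
    (hq : ∀ i ≤ n, ∀ a b, LinCoef ν l L C n i a b →
      n * (a * (if i < n then q (i+1) - q i else 0) - b * (q i - q (i-1))) ≤ om) :
    ∀ i ≤ n, Z' i ≤ q i + τ * (om + e) := by
  intro i hi
  obtain ⟨a, b, hab, hs⟩ := h i hi
  have hq' := hq i hi a b hab
  have h1 := (abs_le.1 hs).2
  have hsum := hab.sum_le hν hC hl hi
  obtain ⟨hτ, hc⟩ := hcfl
  obtain ⟨ha, hb, -⟩ := hab
  have hn0 : (0:ℝ) ≤ n := Nat.cast_nonneg n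
  have hcc : τ * n * (a + b) ≤ 1 := by
    have : τ * n * (a + b) ≤ τ * n * (L * (2 * ν + 8 * n) + 2 * C) := by gcongr
    have : 0 ≤ τ * n * (a + b) := by positivity
    linarith
  have z0 := hZ i hi
  have z1 := hZ (i-1) (by omega)
  have hbt : 0 ≤ τ * n * b := by positivity
  have hat : 0 ≤ τ * n * a := by positivity
  have hq2 := mul_le_mul_of_nonneg_left hq' hτ.le
  split_ifs at h1 hq2 with hin
  · have z2 := hZ (i+1) hin
    nlinarith [mul_nonneg hbt (sub_nonneg.2 z1), mul_nonneg hat (sub_nonneg.2 z2),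
      mul_nonneg (sub_nonneg.2 hcc) (sub_nonneg.2 z0)]
  · nlinarith [mul_nonneg hbt (sub_nonneg.2 z1), mul_nonneg hat (sub_nonneg.2 z0),
      mul_nonneg (sub_nonneg.2 hcc) (sub_nonneg.2 z0)]

lemma LinStep.max {ν l L C : ℝ} {n : ℕ} {τ e Q : ℝ} {Z Z' : ℕ → ℝ}
    (hν : 0 < ν) (hl : 0 < l) (hC : 0 ≤ C) (hcfl : CFL ν L C n τ)
    (h : LinStep ν l L C n τ e Z Z') (hZ : ∀ i ≤ n, Z i ≤ Q) :
    ∀ i ≤ n, Z' i ≤ Q + τ * e := by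
  have := h.barrier (q := fun _ => Q) (om := 0) hν hl hC hcfl hZ (by intros; simp)
  simpa using this

lemma LinStep.min {ν l L C : ℝ} {n : ℕ} {τ e Q : ℝ} {Z Z' : ℕ → ℝ}
    (hν : 0 < ν) (hl : 0 < l) (hC : 0 ≤ C) (hcfl : CFL ν L C n τ)
    (h : LinStep ν l L C n τ e Z Z') (hZ : ∀ i ≤ n, Q ≤ Z i) :
    ∀ i ≤ n, Q - τ * e ≤ Z' i := by
  intro i hi
  have := h.neg.max (Q := -Q) hν hl hC hcfl (fun i hi => neg_le_neg (hZ i hi)) i hi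
  linarith

/-- quadratic barrier -/
lemma LinStep.quad {ν l L C : ℝ} {n p : ℕ} {τ Q K : ℝ} {Z Z' : ℕ → ℝ} (hn : 0 < n)
    (hν : 0 < ν) (hl : 0 < l) (hlL : l ≤ L) (hC : 0 ≤ C) (hK : 0 ≤ K) (hp : p ≤ n) (hcfl : CFL ν L C n τ)
    (h : LinStep ν l L C n τ 0 Z Z')
    (hZ : ∀ i ≤ n, Z i ≤ Q + K * ((i:ℝ)/n - (p:ℝ)/n)^2) :
    ∀ i ≤ n, Z' i ≤ (Q + τ * (K * (6 * ν * L + 6 * C + 8 * L))) + K * ((i:ℝ)/n - (p:ℝ)/n)^2 := by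
  have := h.barrier (q := fun i => Q + K * ((i:ℝ)/n - (p:ℝ)/n)^2)
    (om := K * (6 * ν * L + 6 * C + 8 * L)) hν hl hC hcfl hZ ?_
  · intro i hi
    have := this i hi
    linarith
  intro i hi a b hab
  have hsum := hab.sum_le hν hC hl hi
  obtain ⟨ha, hb, κ, k1, k2, e1, e2⟩ := hab
  have hn1 : (1:ℝ) ≤ n := by exact_mod_cast hn
  have hnp : (0:ℝ) < n := by linarith
  have hi1 : (i:ℝ) ≤ n := by exact_mod_cast hi
  have hp1 : (p:ℝ) ≤ n := by exact_mod_cast hp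
  have hi0 : (0:ℝ) ≤ i := Nat.cast_nonneg i
  have hp0 : (0:ℝ) ≤ p := Nat.cast_nonneg p
  have hx := xg_le_one hi
  have hx0 := xg_nonneg n i
  have hCx : C * ((i:ℝ)/n) ≤ C * 1 := by gcongr
  have hL : 0 < L := by linarith
  have hdiff : |a - b| ≤ 2 * ν * L + 2 * C := by
    have := abs_le.1 e1
    have := abs_le.1 e2
    have h3 : κ * (2 * ν) ≤ L * (2 * ν) := by gcongr
    have h4 : 0 ≤ κ * (2 * ν) := by
      have : 0 < κ := by linarith
      positivity
    rw [abs_le]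
    constructor <;> linarith
  have hsn : (a + b) / n ≤ 2 * ν * L + 8 * L + 2 * C := by
    rw [div_le_iff₀ hnp]
    nlinarith [mul_nonneg (by positivity : 0 ≤ 2 * ν * L + 2 * C) (sub_nonneg.2 hn1)]
  have hbn : b / n ≤ 2 * ν * L + 8 * L + 2 * C := le_trans (by gcongr; linarith) hsn
  have hdx : |((i:ℝ) - p) / n| ≤ 1 := by
    rw [abs_div, abs_of_pos hnp, div_le_one hnp, abs_le]
    constructor <;> linarith
  have hprod : (a - b) * (2 * (((i:ℝ) - p) / n)) ≤ (2 * ν * L + 2 * C) * (2 * 1) := by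
    refine le_trans (le_abs_self _) ?_
    rw [abs_mul, abs_mul, abs_of_pos (by norm_num : (0:ℝ) < 2)]
    gcongr
  -- backward difference
  have hback : b * ((Q + K * ((i:ℝ)/n - (p:ℝ)/n)^2) - (Q + K * (((i-1:ℕ):ℝ)/n - (p:ℝ)/n)^2))
      = b * (K * (2 * ((i:ℝ) - p) - 1) / n^2) := by
    rcases Nat.eq_zero_or_pos i with h0 | h0
    · subst h0
      have : b = 0 := by
        have : |b| ≤ 0 := by simpa using e2
        exact abs_eq_zero.1 (le_antisymm this (abs_nonneg _))
      simp [this]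
    · rw [Nat.cast_sub h0]
      push_cast
      field_simp
      ring
  simp only [hback]
  split_ifs with hin
  · have : (n:ℝ) * (a * ((Q + K * (((i+1:ℕ):ℝ)/n - (p:ℝ)/n)^2) - (Q + K * ((i:ℝ)/n - (p:ℝ)/n)^2)) - b * (K * (2 * ((i:ℝ) - p) - 1) / n^2))
      = K * ((a - b) * (2 * (((i:ℝ) - p) / n)) + (a + b) / n) := by
      push_cast
      field_simp
      ring
    rw [this]
    apply mul_le_mul_of_nonneg_left _ hK
    linarith
  · have hin' : i = n := by omega
    have : (n:ℝ) * (a * 0 - b * (K * (2 * ((i:ℝ) - p) - 1) / n^2))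
      = K * (b / n - 2 * (b * (((i:ℝ) - p)/n))) := by
      field_simp
      ring
    rw [this]
    apply mul_le_mul_of_nonneg_left _ hK
    have : 0 ≤ b * (((i:ℝ) - p)/n) := by
      apply mul_nonneg hb
      rw [hin']
      apply div_nonneg _ hnp.le
      linarith
    have : 0 ≤ ν * L := by positivity
    linarith

/-- two-point comparison -/
lemma LinStep.two {ν l L C : ℝ} {n : ℕ} {τ e Q K κ' : ℝ} {Z Z' : ℕ → ℝ} {ψ : ℕ → ℕ → ℝ}
    (hν : 0 < ν) (hl : 0 < l) (hC : 0 ≤ C) (hQ : 0 ≤ Q) (hK : 0 ≤ K) (he : 0 ≤ e)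
    (hcfl : CFL ν L C n τ)
    (h : LinStep ν l L C n τ e Z Z')
    (hdiag : ∀ i ≤ n, τ * κ' ≤ ψ i i)
    (hmono : ∀ i j, j < i → i ≤ n → ψ i j ≤ ψ (i+1) j)
    (hψ : ∀ i j, j < i → i ≤ n → ∀ a b a' b', LinCoef ν l L C n i a b → LinCoef ν l L C n j a' b' →
      n * (a * (ψ (i+1) j - ψ i j) - b * (ψ i j - ψ (i-1) j)
        + a' * (ψ i (j+1) - ψ i j) - b' * (ψ i j - ψ i (j-1))) ≤ -κ')
    (hZ : ∀ i j, j ≤ i → i ≤ n → Z i - Z j ≤ Q + K * ψ i j) :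
    ∀ i j, j ≤ i → i ≤ n → Z' i - Z' j ≤ Q + K * (ψ i j - τ * κ') + 2 * τ * e := by
  intro i j hji hi
  obtain ⟨hτ, hc⟩ := hcfl
  rcases Nat.eq_or_lt_of_le hji with hij | hij
  · subst hij
    have := hdiag j hi
    have : 0 ≤ K * (ψ j j - τ * κ') := mul_nonneg hK (by linarith)
    have : 0 ≤ 2 * τ * e := by positivity
    linarith
  obtain ⟨a, b, hab, hs⟩ := h i hi
  obtain ⟨a', b', hab', hs'⟩ := h j (by omega)
  have hp := hψ i j hij hi a b a' b' hab hab'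
  have hm := hmono i j hij hi
  have hsum := hab.sum_le hν hC hl hi
  have hsum' := hab'.sum_le hν hC hl (by omega)
  have ha := hab.1
  have hb := hab.2.1
  have ha' := hab'.1
  have hb' := hab'.2.1
  have hn0 : (0:ℝ) ≤ n := Nat.cast_nonneg n
  have hcc : τ * n * (a + b + (a' + b')) ≤ 1 := by
    have : τ * n * (a + b + (a' + b')) ≤ τ * n * ((L * (2 * ν + 8 * n) + 2 * C) + (L * (2 * ν + 8 * n) + 2 * C)) := by gcongr
    linarith
  have h1 := (abs_le.1 hs).2
  have h2 := (abs_le.1 hs').1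
  rw [if_pos (by omega : j < n)] at h2
  have z0 := hZ i j hji hi
  have z1 := hZ (i-1) j (by omega) (by omega)
  have z2 := hZ i (j+1) hij hi
  have z3 := hZ i (j-1) (by omega) hi
  set t := τ * n with ht
  have ht0 : 0 ≤ t := by positivity
  have hp' : t * (K * (a * (ψ (i+1) j - ψ i j) - b * (ψ i j - ψ (i-1) j)
        + a' * (ψ i (j+1) - ψ i j) - b' * (ψ i j - ψ i (j-1)))) ≤ K * (-(τ * κ')) := by
    have := mul_le_mul_of_nonneg_left hp (mul_nonneg hτ.le hK)
    rw [ht]; linarith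
  have y0 := mul_nonneg (sub_nonneg.2 hcc) (sub_nonneg.2 z0)
  have y1 := mul_nonneg (mul_nonneg ht0 hb) (sub_nonneg.2 z1)
  have y2 := mul_nonneg (mul_nonneg ht0 ha') (sub_nonneg.2 z2)
  have y3 := mul_nonneg (mul_nonneg ht0 hb') (sub_nonneg.2 z3)
  split_ifs at h1 with hin
  · have z4 := hZ (i+1) j (by omega) hin
    have y4 := mul_nonneg (mul_nonneg ht0 ha) (sub_nonneg.2 z4)
    linarith
  · have y4 := mul_nonneg (mul_nonneg ht0 ha) (sub_nonneg.2 z0)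
    have y5 := mul_nonneg (mul_nonneg (mul_nonneg ht0 ha) hK) (sub_nonneg.2 hm)
    linarith

end RF


namespace RF

/-- third-order Taylor property on `[0,1]` -/
def T3 (f f1 f2 : ℝ → ℝ) (D : ℝ) : Prop :=
  ∀ x s : ℝ, 0 ≤ x → x ≤ 1 → |s| ≤ 1 → 0 ≤ x + s →
    |f (x + s) - f x - f1 x * s - f2 x * s ^ 2 / 2| ≤ D * |s| ^ 3

lemma T3_of_deriv {f f1 f2 f3 : ℝ → ℝ}
    (h1 : ∀ x ∈ Icc (0:ℝ) 2, HasDerivAt f (f1 x) x) (h2 : ∀ x ∈ Icc (0:ℝ) 2, HasDerivAt f1 (f2 x) x)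
    (h3 : ∀ x ∈ Icc (0:ℝ) 2, HasDerivAt f2 (f3 x) x) (hc : ContinuousOn f3 (Icc 0 2)) :
    ∃ D, 0 ≤ D ∧ T3 f f1 f2 D := by
  obtain ⟨D, hD⟩ := isCompact_Icc.exists_bound_of_continuousOn hc
  have hD0 : 0 ≤ D := le_trans (norm_nonneg _) (hD 0 (by norm_num))
  refine ⟨D, hD0, ?_⟩
  intro x s hx hx1 hs hxs
  have hs2 := abs_le.1 hs
  have hsub : uIcc x (x + s) ⊆ Icc 0 2 := by
    intro y hy
    rw [mem_uIcc] at hy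
    rcases hy with h | h <;> constructor <;> linarith [h.1, h.2]
  have hdist : ∀ y ∈ uIcc x (x+s), |y - x| ≤ |s| := by
    intro y hy
    have := abs_sub_left_of_mem_uIcc hy
    simpa using this
  have hconv : Convex ℝ (uIcc x (x+s)) := convex_uIcc _ _
  have hl : x ∈ uIcc x (x+s) := left_mem_uIcc
  have hr : x + s ∈ uIcc x (x+s) := right_mem_uIcc
  have s1 : ∀ y ∈ uIcc x (x+s), |f2 y - f2 x| ≤ D * |s| := by
    intro y hy
    have := hconv.norm_image_sub_le_of_norm_hasDerivWithin_le (f := f2) (f' := f3) (C := D)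
      (fun z hz => (h3 z (hsub hz)).hasDerivWithinAt) (fun z hz => hD z (hsub hz)) hl hy
    rw [Real.norm_eq_abs, Real.norm_eq_abs] at this
    exact this.trans (mul_le_mul_of_nonneg_left (hdist y hy) (by positivity))
  have s2 : ∀ y ∈ uIcc x (x+s), |f1 y - f1 x - f2 x * (y - x)| ≤ D * |s| * |s| := by
    intro y hy
    have := hconv.norm_image_sub_le_of_norm_hasDerivWithin_le (f := fun y => f1 y - f1 x - f2 x * (y - x)) (f' := fun y => f2 y - f2 x) (C := D * |s|)
      (fun z hz => by
        have := ((h2 z (hsub hz)).sub_const (f1 x)).sub (((hasDerivAt_id z).sub_const x).const_mul (f2 x))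
        exact (this.congr_deriv (by simp)).hasDerivWithinAt) (fun z hz => s1 z hz) hl hy
    simp only [sub_self, mul_zero, sub_zero] at this
    rw [Real.norm_eq_abs, Real.norm_eq_abs] at this
    exact this.trans (mul_le_mul_of_nonneg_left (hdist y hy) (by positivity))
  have := hconv.norm_image_sub_le_of_norm_hasDerivWithin_le (f := fun y => f y - f x - f1 x * (y - x) - f2 x * (y - x)^2/2) (f' := fun y => f1 y - f1 x - f2 x * (y - x)) (C := D * |s| * |s|)
      (fun z hz => by
        have := (((h1 z (hsub hz)).sub_const (f x)).sub (((hasDerivAt_id z).sub_const x).const_mul (f1 x))).sub (((((hasDerivAt_id z).sub_const x).pow 2).const_mul (f2 x)).div_const 2)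
        exact (this.congr_deriv (by simp; ring)).hasDerivWithinAt) (fun z hz => s2 z hz) hl hr
  simp only [sub_self, mul_zero, sub_zero, add_sub_cancel_left] at this
  rw [Real.norm_eq_abs, Real.norm_eq_abs] at this
  calc _ = |f (x + s) - f x - f1 x * s - f2 x * s ^ 2 / 2 - (0 ^2 * f2 x / 2)| := by norm_num
    _ ≤ D * |s| * |s| * |s| := by convert this using 2; ring
    _ = _ := by ring

lemma T3.add {f f1 f2 g g1 g2 : ℝ → ℝ} {D E : ℝ} (hf : T3 f f1 f2 D) (hg : T3 g g1 g2 E) :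
    T3 (fun x => f x + g x) (fun x => f1 x + g1 x) (fun x => f2 x + g2 x) (D + E) := by
  intro x s a b c d
  have := hf x s a b c d
  have := hg x s a b c d
  have := abs_add_le (f (x + s) - f x - f1 x * s - f2 x * s ^ 2 / 2) (g (x + s) - g x - g1 x * s - g2 x * s ^ 2 / 2)
  rw [show f (x+s) + g (x+s) - (f x + g x) - (f1 x + g1 x) * s - (f2 x + g2 x) * s^2/2 = (f (x + s) - f x - f1 x * s - f2 x * s ^ 2 / 2) + (g (x + s) - g x - g1 x * s - g2 x * s ^ 2 / 2) by ring]
  linarith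

lemma T3.smul {f f1 f2 : ℝ → ℝ} {D A c : ℝ} (hf : T3 f f1 f2 D) (hc : |c| ≤ A) (hD : 0 ≤ D) :
    T3 (fun x => c * f x) (fun x => c * f1 x) (fun x => c * f2 x) (A * D) := by
  intro x s a b e d
  have := hf x s a b e d
  rw [show c * f (x+s) - c * f x - c * f1 x * s - c * f2 x * s^2/2 = c * (f (x + s) - f x - f1 x * s - f2 x * s ^ 2 / 2) by ring, abs_mul]
  calc |c| * _ ≤ A * (D * |s|^3) := by gcongr; exact le_trans (abs_nonneg _) hc
    _ = _ := by ring

lemma T3_rpow {η : ℝ} (hη : 0 < η) (β : ℝ) : ∃ D, 0 ≤ D ∧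
    T3 (fun x => (x + η) ^ β) (fun x => β * (x + η) ^ (β - 1)) (fun x => β * (β - 1) * (x + η) ^ (β - 2)) D := by
  have hd : ∀ β x : ℝ, x ∈ Icc (0:ℝ) 2 → HasDerivAt (fun x : ℝ => (x + η) ^ β) (β * (x + η) ^ (β - 1)) x := by
    intro β x hx
    have : x + η ≠ 0 := by linarith [hx.1]
    have := ((hasDerivAt_id x).add_const η).rpow_const (p := β) (Or.inl this)
    simpa using this
  apply T3_of_deriv (f3 := fun x => β * (β - 1) * ((β - 2) * (x + η) ^ (β - 2 - 1))) (hd β)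
  · intro x hx
    have := (hd (β-1) x hx).const_mul β
    exact this.congr_deriv (by rw [show β - 1 - 1 = β - 2 by ring]; ring)
  · intro x hx
    exact (hd (β-2) x hx).const_mul (β * (β - 1))
  · apply ContinuousOn.mul continuousOn_const
    apply ContinuousOn.mul continuousOn_const
    apply ContinuousOn.rpow_const (by fun_prop)
    intro x hx; left; linarith [hx.1]

lemma T3_pow (m : ℕ) : ∃ D, 0 ≤ D ∧
    T3 (fun x => x ^ (m+2)) (fun x => (m+2) * x ^ (m+1)) (fun x => (m+2) * (m+1) * x ^ m) D := by
  apply T3_of_deriv (f3 := fun x => (m+2) * (m+1) * (m * x ^ (m-1)))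
  · intro x hx
    have := hasDerivAt_pow (m+2) x
    simpa using this
  · intro x hx
    have := (hasDerivAt_pow (m+1) x).const_mul ((m:ℝ)+2)
    exact this.congr_deriv (by simp; ring)
  · intro x hx
    exact (hasDerivAt_pow m x).const_mul (((m:ℝ)+2)*(m+1))
  · fun_prop

/-- discrete vs. continuous operator in one direction -/
lemma disc_op {ν l L C D P1 P2 Dp Dm a b : ℝ} {n i : ℕ} (hn : 0 < n) (hi : i ≤ n) (hν : 0 < ν)
    (hl : 0 < l) (hC : 0 ≤ C) (hD : 0 ≤ D) (hab : LinCoef ν l L C n i a b)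
    (hp : |Dp - P1 * (1/n) - P2 * (1/n)^2 / 2| ≤ D * (1/n)^3)
    (hm : 0 < i → |Dm - P1 * (1/n) + P2 * (1/n)^2 / 2| ≤ D * (1/n)^3)
    (hP2 : |P2| ≤ D) :
    ∃ κ, l ≤ κ ∧ κ ≤ L ∧ n * (a * Dp - b * Dm) ≤
      κ * (2 * ν * P1 + 4 * ((i:ℝ)/n) * P2) + 2 * C * ((i:ℝ)/n) * |P1|
        + ((ν * L + C) * D + (L * (2 * ν + 8) + 2 * C) * D) * (1/n) := by
  have hsum := hab.sum_le hν hC hl hi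
  obtain ⟨ha, hb, κ, k1, k2, e1, e2⟩ := hab
  refine ⟨κ, k1, k2, ?_⟩
  have hnp : (0:ℝ) < n := by exact_mod_cast hn
  have hn1 : (1:ℝ) ≤ n := by exact_mod_cast hn
  have hx := xg_le_one hi
  have hx0 := xg_nonneg n i
  obtain ⟨h, hh⟩ : ∃ h : ℝ, h = 1 / n := ⟨_, rfl⟩
  have hnh : n * h = 1 := by rw [hh]; field_simp
  have hh1 : h ≤ 1 := by rw [hh]; exact div_le_one_of_le₀ hn1 hnp.le
  have hh0 : 0 < h := by rw [hh]; positivity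
  have hX : (i:ℝ) / n = i * h := by rw [hh]; ring
  rw [← hh] at hp hm ⊢
  rw [hX] at hx hx0 e1 e2 ⊢
  obtain ⟨ra, hra⟩ : ∃ ra, a = κ * (2 * ν + 4 * i) + ra := ⟨a - κ * (2 * ν + 4 * i), by ring⟩
  obtain ⟨rb, hrb⟩ : ∃ rb, b = 4 * κ * i + rb := ⟨b - 4 * κ * i, by ring⟩
  rw [hra, add_sub_cancel_left] at e1
  rw [hrb, add_sub_cancel_left] at e2
  obtain ⟨ρ, hρ⟩ : ∃ ρ, Dp = P1 * h + P2 * h^2/2 + ρ := ⟨Dp - P1 * h - P2 * h^2/2, by ring⟩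
  rw [hρ] at hp
  have hp' : |ρ| ≤ D * h^3 := by
    rwa [show P1 * h + P2 * h^2/2 + ρ - P1 * h - P2 * h^2/2 = ρ by ring] at hp
  obtain ⟨σ, hσ⟩ : ∃ σ, Dm = P1 * h - P2 * h^2/2 + σ := ⟨Dm - P1 * h + P2 * h^2/2, by ring⟩
  have hbσ : |b * σ| ≤ b * (D * h^3) := by
    rw [abs_mul, abs_of_nonneg hb]
    rcases Nat.eq_zero_or_pos i with h0 | h0
    · have : b = 0 := by
        have : |rb| ≤ 0 := by simpa [h0] using e2
        rw [hrb, h0, abs_eq_zero.1 (le_antisymm this (abs_nonneg _))]; simp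
      rw [this]; simp
    · have := hm h0
      rw [hσ, show P1 * h - P2 * h^2/2 + σ - P1 * h + P2 * h^2/2 = σ by ring] at this
      exact mul_le_mul_of_nonneg_left this hb
  have e : n * (a * Dp - b * Dm) = κ * (2 * ν * P1 + 4 * (i * h) * P2) + (ra - rb) * P1
      + (2 * ν * κ + ra + rb) * P2 * h / 2 + n * (a * ρ - b * σ) := by
    have : (n:ℝ) * (a * Dp - b * Dm) = (n * h) * ((a - b) * P1 + (a + b) * h * P2 / 2) + n * (a * ρ - b * σ) := by
      rw [hρ, hσ]; ring
    rw [this, hnh, hra, hrb]; ring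
  rw [e]
  have t1 : (ra - rb) * P1 ≤ 2 * C * (i * h) * |P1| := by
    refine le_trans (le_abs_self _) ?_
    rw [abs_mul]
    apply mul_le_mul_of_nonneg_right _ (abs_nonneg _)
    have := abs_sub ra rb
    linarith
  have hκ : 0 < κ := by linarith
  have hCx : C * (i * h) ≤ C * 1 := by gcongr
  have hL : 0 < L := by linarith
  have t2 : (2 * ν * κ + ra + rb) * P2 * h / 2 ≤ (ν * L + C) * D * h := by
    have : (2 * ν * κ + ra + rb) * P2 ≤ (2 * ν * L + 2 * C) * D := by
      refine le_trans (le_abs_self _) ?_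
      rw [abs_mul]
      apply mul_le_mul _ hP2 (abs_nonneg _) (by positivity)
      have h1 := abs_add_three (2 * ν * κ) ra rb
      have h2 : |2 * ν * κ| ≤ 2 * ν * L := by rw [abs_of_pos (by positivity)]; gcongr
      linarith
    have := mul_le_mul_of_nonneg_right this hh0.le
    linarith
  have t3 : n * (a * ρ - b * σ) ≤ (L * (2 * ν + 8) + 2 * C) * D * h := by
    have h1 : a * ρ - b * σ ≤ (a + b) * (D * h^3) := by
      have : a * ρ ≤ a * (D * h^3) := by gcongr; exact (abs_le.1 hp').2
      linarith [(abs_le.1 hbσ).1]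
    calc n * (a * ρ - b * σ) ≤ n * ((L * (2 * ν + 8 * n) + 2 * C) * (D * h^3)) := by gcongr; exact h1.trans (by gcongr)
      _ = (n * h) * ((L * (2 * ν * h + 8 * (n * h)) + 2 * C * h) * D * h) := by ring
      _ = (L * (2 * ν * h + 8) + 2 * C * h) * D * h := by rw [hnh]; ring
      _ ≤ (L * (2 * ν * 1 + 8) + 2 * C * 1) * D * h := by gcongr
      _ = _ := by ring
  linarith

end RF


namespace RF

set_option maxHeartbeats 1000000 in
/-- choice of parameters for the doubling function -/
lemma psi_params {ν l L C : ℝ} (hν : 0 < ν) (hl : 0 < l) (hlL : l ≤ L) (hC : 0 < C) :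
    ∃ (m : ℕ) (γ ε κ' : ℝ), 0 < γ ∧ γ < 1 ∧ 0 < ε ∧ ε ≤ 1 ∧ 0 < κ' ∧
    ∀ Z θ Y E kx ky X : ℝ, 0 ≤ Z → Z ≤ θ → θ ≤ 1 → 0 ≤ Y → Y ≤ 1 → Y ≤ 2 * Z → 1 / 2 ≤ E →
      l ≤ kx → kx ≤ L → l ≤ ky → ky ≤ L → 0 ≤ X → X ≤ 1 →
      kx * (2 * ν * ((1+ε)*γ + ((m+2:ℝ)-γ)*(Z^(m+1)*Z) + ε*(1-γ)*Z)
        - 4 * θ * ((1+ε)*γ*(1-γ) + ((m+2:ℝ)-γ)*((m+3:ℝ)-γ)*(Z^(m+1)*Z) + ε*(1-γ)*(2-γ)*Z)) * E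
      + C * X * (((1+ε)*γ + ((m+2:ℝ)-γ)*(Z^(m+1)*Z) + ε*(1-γ)*Z) * E)
      + ky * (-(2 * ν * ((m+2:ℝ)*Z^(m+1) + ε)) - 4 * ((m+2:ℝ)*(m+1)*Z^(m+1))) * E
      + C * Y * (((m+2:ℝ)*Z^(m+1) + ε) * E) ≤ - κ' := by
  have hL : 0 < L := by linarith
  obtain ⟨m, hm⟩ := exists_nat_ge ((2 * C + L * ν^2/4 + 1) / (4 * l))
  have hm' : 2 * C + L * ν^2/4 + 1 ≤ 4 * l * m := by
    rw [div_le_iff₀ (by positivity)] at hm; linarith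
  set K1 := 2 * ν * L + 3 * C with hK1
  have hK1p : 0 < K1 := by positivity
  set z0 := ν * l / K1 with hz0
  have hz0p : 0 < z0 := by positivity
  have hz0K : z0 * K1 = ν * l := by rw [hz0]; field_simp
  set ε := min 1 (z0^(m+1) / K1) with hε
  have hεp : 0 < ε := by rw [hε]; positivity
  have hε1 : ε ≤ 1 := min_le_left _ _
  have hε2 : ε * K1 ≤ z0^(m+1) := by
    rw [← le_div_iff₀ hK1p]; exact min_le_right _ _
  set K2 := 4 * ν * L + 2 * C with hK2
  have hK2p : 0 < K2 := by positivity
  set γ := min (1/2) (ν * l * ε / (2 * K2)) with hγ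
  have hγp : 0 < γ := by rw [hγ]; positivity
  have hγ1 : γ < 1 := lt_of_le_of_lt (min_le_left _ _) (by norm_num)
  have hγ2 : γ * K2 ≤ ν * l * ε / 2 := by
    have := min_le_right (1/2) (ν * l * ε / (2 * K2))
    rw [← hγ, le_div_iff₀ (by positivity)] at this
    linarith
  refine ⟨m, γ, ε, ν * l * ε / 4, hγp, hγ1, hεp, hε1, by positivity, ?_⟩
  intro Z θ Y E kx ky X hZ hZθ hθ hY hY1 hYZ hE hkx hkx' hky hky' hX hX1
  have hZ1 : Z ≤ 1 := by linarith
  have hz : 0 ≤ Z^(m+1) := by positivity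
  have hz1 : Z^(m+1) ≤ 1 := pow_le_one₀ hZ hZ1
  have hsplit : Z^(m+1) * 1 ≥ ε * Z * K1 - ν * l * ε := by
    rcases le_total Z z0 with h | h
    · have : ε * Z * K1 ≤ ε * (z0 * K1) := by
        rw [mul_assoc]; gcongr
      rw [hz0K] at this
      linarith
    · have h1 : z0^(m+1) ≤ Z^(m+1) := by gcongr
      have h2 : ε * Z * K1 ≤ ε * 1 * K1 := by gcongr
      have h3 : 0 ≤ ν * l * ε := by positivity
      linarith
  set z := Z^(m+1)
  set q : ℝ := (m:ℝ) + 2 with hq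
  have hm0 : (0:ℝ) ≤ m := Nat.cast_nonneg m
  have hqγ : 0 ≤ q - γ := by linarith
  have hkxp : 0 < kx := by linarith
  have hkyp : 0 < ky := by linarith
  -- x part
  have x1 : 2 * ν * ((1+ε)*γ + (q-γ)*(z*Z) + ε*(1-γ)*Z)
        - 4 * θ * ((1+ε)*γ*(1-γ) + (q-γ)*((m+3:ℝ)-γ)*(z*Z) + ε*(1-γ)*(2-γ)*Z)
      ≤ 4 * ν * γ + 2 * ν * ε * Z + z * (ν^2/4) := by
    have p1 : 0 ≤ θ * ((1+ε)*γ*(1-γ)) := by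
      have : 0 ≤ 1 - γ := by linarith
      have : 0 ≤ θ := by linarith
      positivity
    have p2 : 0 ≤ θ * (ε*(1-γ)*(2-γ)*Z) := by
      have : 0 ≤ 1 - γ := by linarith
      have : 0 ≤ 2 - γ := by linarith
      have : 0 ≤ θ := by linarith
      positivity
    have p3 : (q-γ)*(z*Z) * ((q-γ)*Z) ≤ θ * ((q-γ)*((m+3:ℝ)-γ)*(z*Z)) := by
      have : (q-γ)*Z ≤ θ * ((m+3:ℝ)-γ) := by
        have : (q-γ)*Z ≤ (q - γ) * θ := by gcongr
        have h2 : θ * ((m+3:ℝ)-γ) = (q - γ) * θ + θ := by rw [hq]; ring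
        linarith
      calc (q-γ)*(z*Z) * ((q-γ)*Z) ≤ (q-γ)*(z*Z) * (θ * ((m+3:ℝ)-γ)) := by gcongr
        _ = _ := by ring
    have p4 : 0 ≤ z * (2 * ((q-γ)*Z) - ν/2)^2 := by positivity
    have p5 : ν * ((1+ε)*γ) ≤ ν * (2 * γ) := by gcongr; linarith
    have p6 : ν * (ε*(1-γ)*Z) ≤ ν * (ε * 1 * Z) := by gcongr; linarith
    linarith
  have x2 : kx * (2 * ν * ((1+ε)*γ + (q-γ)*(z*Z) + ε*(1-γ)*Z)
        - 4 * θ * ((1+ε)*γ*(1-γ) + (q-γ)*((m+3:ℝ)-γ)*(z*Z) + ε*(1-γ)*(2-γ)*Z))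
      ≤ L * (4 * ν * γ + 2 * ν * ε * Z + z * (ν^2/4)) := by
    refine le_trans (mul_le_mul_of_nonneg_left x1 hkxp.le) ?_
    gcongr
  have x3 : C * X * ((1+ε)*γ + (q-γ)*(z*Z) + ε*(1-γ)*Z) ≤ C * 1 * (2 * γ + q * (z * 1) + ε * 1 * Z) := by
    have g0 : 0 ≤ 1 - γ := by linarith
    have g1 : (1+ε)*γ ≤ 2 * γ := mul_le_mul_of_nonneg_right (by linarith) hγp.le
    have g2 : (q-γ)*(z*Z) ≤ q * (z * 1) :=
      mul_le_mul (by linarith) (mul_le_mul_of_nonneg_left hZ1 hz) (by positivity) (by linarith)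
    have g3 : ε*(1-γ)*Z ≤ ε * 1 * Z :=
      mul_le_mul_of_nonneg_right (mul_le_mul_of_nonneg_left (by linarith) hεp.le) hZ
    have g4 : 0 ≤ (1+ε)*γ + (q-γ)*(z*Z) + ε*(1-γ)*Z := by positivity
    exact mul_le_mul (mul_le_mul_of_nonneg_left hX1 hC.le) (by linarith) g4 (by linarith)
  have y1 : ky * (-(2 * ν * (q*z + ε)) - 4 * (q*(m+1)*z)) ≤ - (l * (2 * ν * ε + 4 * (q * m * z))) := by
    have h1 : l * (2 * ν * ε + 4 * (q * m * z)) ≤ ky * (2 * ν * ε + 4 * (q * m * z)) := by gcongr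
    have h2 : 0 ≤ ky * (2 * ν * (q * z) + 4 * (q * z)) := by positivity
    linarith
  have y2 : C * Y * (q*z + ε) ≤ C * (q * z) + C * (2 * Z) * ε := by
    have h1 : C * Y * (q * z) ≤ C * 1 * (q * z) := by gcongr
    have h2 : C * Y * ε ≤ C * (2 * Z) * ε := by gcongr
    linarith
  have hqz : z ≤ q * z := by
    exact le_mul_of_one_le_left hz (by linarith)
  have br : z * (L * ν^2/4) + 2 * C * (q * z) - 4 * l * (q * m * z) ≤ - z := by
    have h1 : (2 * C + L * ν^2/4 + 1) * (q * z) ≤ 4 * l * m * (q * z) := by gcongr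
    have h2 : (L * ν^2/4 + 1) * z ≤ (L * ν^2/4 + 1) * (q * z) := by gcongr
    linarith
  have total : kx * (2 * ν * ((1+ε)*γ + (q-γ)*(z*Z) + ε*(1-γ)*Z)
        - 4 * θ * ((1+ε)*γ*(1-γ) + (q-γ)*((m+3:ℝ)-γ)*(z*Z) + ε*(1-γ)*(2-γ)*Z))
      + C * X * ((1+ε)*γ + (q-γ)*(z*Z) + ε*(1-γ)*Z)
      + ky * (-(2 * ν * (q*z + ε)) - 4 * (q*(m+1)*z))
      + C * Y * (q*z + ε) ≤ - (ν * l * ε / 2) := by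
    have e1 : ε * Z * K1 = ε * Z * (2 * ν * L) + 3 * C * ε * Z := by rw [hK1]; ring
    have e2 : γ * K2 = 4 * ν * L * γ + 2 * C * γ := by rw [hK2]; ring
    linarith
  have hfin := mul_le_mul_of_nonneg_right total (by linarith : 0 ≤ E)
  have hpos : 0 ≤ ν * l * ε := by positivity
  have hpE := mul_nonneg hpos (sub_nonneg.2 hE)
  linarith

end RF


namespace RF

lemma rpow_bdd {η : ℝ} (hη : 0 < η) (β : ℝ) : ∃ R, 0 ≤ R ∧ ∀ x ∈ Icc (0:ℝ) 1, |(x + η) ^ β| ≤ R := by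
  have : ContinuousOn (fun x : ℝ => (x + η) ^ β) (Icc 0 1) := by
    apply ContinuousOn.rpow_const (by fun_prop)
    intro x hx; left; linarith [hx.1]
  obtain ⟨R, hR⟩ := isCompact_Icc.exists_bound_of_continuousOn this
  exact ⟨R, le_trans (norm_nonneg _) (hR 0 (by norm_num)), hR⟩

noncomputable def psi (η γ ε : ℝ) (m : ℕ) (X Y : ℝ) : ℝ :=
  (1 + ε) * (X + η) ^ γ - (X + η) ^ (γ - (m+2)) * Y ^ (m+2) - ε * (X + η) ^ (γ - 1) * Y

lemma rpow_facts {W γ : ℝ} (hW : 0 < W) (m : ℕ) :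
    W ^ γ = W ^ (γ - 1) * W ∧ W ^ (γ - (m+2)) = W ^ (γ - 1) / W ^ (m+1) ∧
    W ^ (γ - (m+2) - 1) = W ^ (γ - 1) / W ^ (m+2) ∧
    W ^ (γ - (m+2) - 2) = W ^ (γ - 1) / W ^ (m+3) ∧
    W ^ (γ - 2) = W ^ (γ - 1) / W ∧ W ^ (γ - 1 - 1) = W ^ (γ - 1) / W ∧
    W ^ (γ - 1 - 2) = W ^ (γ - 1) / W ^ 2 := by
  have h : ∀ p : ℕ, W ^ (γ - 1 - (p:ℝ)) = W ^ (γ - 1) / W ^ p := fun p => Real.rpow_sub_natCast hW.ne' _ _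
  refine ⟨?_, ?_, ?_, ?_, ?_, ?_, ?_⟩
  · rw [Real.rpow_sub_one hW.ne']; field_simp
  · rw [← h]; push_cast; congr 1; ring
  · rw [← h]; push_cast; congr 1; ring
  · rw [← h]; push_cast; congr 1; ring
  · have := h 1
    rw [pow_one] at this; rw [← this]; push_cast; congr 1; ring
  · have := h 1
    rw [pow_one] at this; rw [← this]; push_cast; congr 1
  · have := h 2
    rw [← this]; push_cast; congr 1

lemma psi_eq {η γ ε X Y : ℝ} (m : ℕ) (hW : 0 < X + η) :
    psi η γ ε m X Y = (X + η) ^ (γ - 1) * (X + η) *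
      ((1 - (Y / (X + η)) ^ (m+2)) + ε * (1 - Y / (X + η))) := by
  obtain ⟨f1, f2, -⟩ := rpow_facts (γ := γ) hW m
  unfold psi
  rw [f1, f2]
  set W := X + η
  set E := W ^ (γ - 1)
  obtain ⟨z, hz⟩ : ∃ z, Y = z * W := ⟨Y / W, by field_simp⟩
  rw [hz, mul_div_assoc, div_self hW.ne', mul_one, mul_pow]
  have : E / W ^ (m+1) * (z ^ (m+2) * W ^ (m+2)) = E * z ^ (m+2) * W := by
    rw [pow_succ W (m+1)]; field_simp
  rw [this]; ring

lemma E_ge {W γ : ℝ} (hW : 0 < W) (hW2 : W ≤ 2) (hγ : 0 < γ) (hγ1 : γ < 1) : 1 / 2 ≤ W ^ (γ - 1) := by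
  have h1 : (2:ℝ) ^ (γ - 1) ≤ W ^ (γ - 1) := Real.rpow_le_rpow_of_nonpos hW hW2 (by linarith)
  have h2 : (2:ℝ) ^ (-1:ℝ) ≤ 2 ^ (γ - 1) := Real.rpow_le_rpow_of_exponent_le (by norm_num) (by linarith)
  rw [Real.rpow_neg_one] at h2
  linarith

lemma w1_aux (Y W E γ ε:ℝ) (m:ℕ) : (1+ε) * (γ * E) + -(Y^(m+2)) * ((γ-(m+2)) * (E / W^(m+2))) + -(ε*Y) * ((γ-1) * (E/W))
        = ((1+ε)*γ + ((m+2:ℝ)-γ)*((Y/W)^(m+1)*(Y/W)) + ε*(1-γ)*(Y/W)) * E := by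
      rw [← pow_succ, div_pow]; ring
lemma w2_aux (X Y W E γ ε:ℝ) (m:ℕ) :X * ((1+ε) * (γ * (γ-1) * (E/W)) + -(Y^(m+2)) * ((γ-(m+2)) * (γ-(m+2)-1) * (E / W^(m+3))) + -(ε*Y) * ((γ-1) * (γ-1-1) * (E / W^2)))
        = -((X/W) * ((1+ε)*γ*(1-γ) + ((m+2:ℝ)-γ)*((m+3:ℝ)-γ)*((Y/W)^(m+1)*(Y/W)) + ε*(1-γ)*(2-γ)*(Y/W))) * E := by
      rw [← pow_succ, div_pow]; ring
lemma w3_aux (Y W E ε:ℝ) (m:ℕ) : -(E / W^(m+1)) * ((m+2) * Y^(m+1)) - ε * E = -((((m+2:ℝ))*(Y/W)^(m+1) + ε) * E) := by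
      rw [div_pow]; ring
lemma w4_aux (Y W E:ℝ) (m:ℕ) : Y * (-(E / W^(m+1)) * ((m+2) * (m+1) * Y^m)) = -((m+2:ℝ)*(m+1)*(Y/W)^(m+1)) * E := by
      rw [div_pow]; ring

lemma psi_lower {η γ ε X Y : ℝ} (m : ℕ) (hη : 0 < η) (hη1 : η ≤ 1) (hγ : 0 < γ) (hγ1 : γ < 1)
    (hε : 0 < ε) (hY : 0 ≤ Y) (hYX : Y ≤ X) (hX : X ≤ 1) :
    (X + η - Y) / 2 ≤ psi η γ ε m X Y := by
  have hW : 0 < X + η := by linarith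
  have hE := E_ge hW (by linarith) hγ hγ1
  rw [psi_eq m hW]
  have hZ0 : 0 ≤ Y / (X + η) := by positivity
  have hZ1 : Y / (X + η) ≤ 1 := div_le_one_of_le₀ (by linarith) hW.le
  have hZm : (Y / (X + η)) ^ (m+2) ≤ Y / (X + η) := by
    have := pow_le_of_le_one hZ0 hZ1 (n := m+2) (by omega)
    exact this
  have e : X + η - Y = (X + η) * (1 - Y / (X + η)) := by field_simp
  have h1 : 0 ≤ (X + η) * (1 - Y / (X + η)) := by rw [← e]; linarith
  calc (X + η - Y) / 2 = (1/2) * ((X + η) * (1 - Y / (X + η))) := by rw [← e]; ring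
    _ ≤ (X+η) ^ (γ-1) * ((X + η) * (1 - Y / (X + η))) := by gcongr
    _ = (X+η) ^ (γ-1) * (X + η) * ((1 - Y / (X + η)) + 0) := by ring
    _ ≤ _ := by
      gcongr
      exact mul_nonneg hε.le (by linarith)

lemma psi_upper {η γ ε X Y : ℝ} (m : ℕ) (hη : 0 < η) (hγ : 0 < γ) (hγ1 : γ < 1)
    (hε : 0 < ε) (hε1 : ε ≤ 1) (hY : 0 ≤ Y) (hYX : Y ≤ X) :
    psi η γ ε m X Y ≤ (m + 3) * ((X + η) ^ (γ - 1) * (X + η - Y)) := by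
  have hW : 0 < X + η := by linarith
  rw [psi_eq m hW]
  have hZ0 : 0 ≤ Y / (X + η) := by positivity
  have hZ1 : Y / (X + η) ≤ 1 := div_le_one_of_le₀ (by linarith) hW.le
  have hb : 1 - (Y / (X + η)) ^ (m+2) ≤ (m+2) * (1 - Y / (X + η)) := by
    have := one_add_mul_sub_le_pow (a := Y / (X + η)) (by linarith) (m+2)
    push_cast at this
    linarith
  have e : X + η - Y = (X + η) * (1 - Y / (X + η)) := by field_simp
  rw [e]
  have : 1 - (Y / (X + η)) ^ (m+2) + ε * (1 - Y / (X+η)) ≤ (m+3) * (1 - Y / (X+η)) := by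
    have : ε * (1 - Y / (X+η)) ≤ 1 * (1 - Y / (X+η)) := by
      apply mul_le_mul_of_nonneg_right hε1; linarith
    linarith
  calc _ ≤ (X + η) ^ (γ - 1) * (X + η) * ((m+3) * (1 - Y / (X+η))) := by gcongr
    _ = _ := by ring

set_option maxHeartbeats 1000000 in
lemma psi_exists {ν l L C : ℝ} (hν : 0 < ν) (hl : 0 < l) (hlL : l ≤ L) (hC : 0 < C) :
    ∃ A γ κ' : ℝ, 0 < A ∧ 0 < γ ∧ 0 < κ' ∧ ∀ η, 0 < η → η ≤ 1 → ∃ ψ : ℝ → ℝ → ℝ,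
      (∀ X Y, 0 ≤ Y → Y ≤ X → X ≤ 1 → (X + η - Y) / 2 ≤ ψ X Y ∧ ψ X Y ≤ A / η ∧
        (X - Y ≤ η → ψ X Y ≤ A * η ^ γ)) ∧
      ∃ n0 : ℕ, 0 < n0 ∧ ∀ n ≥ n0,
        (∀ i j : ℕ, j < i → i ≤ n → ψ ((i:ℝ)/n) ((j:ℝ)/n) ≤ ψ (((i+1:ℕ):ℝ)/n) ((j:ℝ)/n)) ∧
        (∀ i j : ℕ, j < i → i ≤ n → ∀ a b a' b', LinCoef ν l L C n i a b → LinCoef ν l L C n j a' b' →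
          n * (a * (ψ (((i+1:ℕ):ℝ)/n) ((j:ℝ)/n) - ψ ((i:ℝ)/n) ((j:ℝ)/n))
            - b * (ψ ((i:ℝ)/n) ((j:ℝ)/n) - ψ (((i-1:ℕ):ℝ)/n) ((j:ℝ)/n))
            + a' * (ψ ((i:ℝ)/n) (((j+1:ℕ):ℝ)/n) - ψ ((i:ℝ)/n) ((j:ℝ)/n))
            - b' * (ψ ((i:ℝ)/n) ((j:ℝ)/n) - ψ ((i:ℝ)/n) (((j-1:ℕ):ℝ)/n))) ≤ -κ') := by
  obtain ⟨m, γ, ε, κ', hγ, hγ1, hε, hε1, hκ', hCI⟩ := psi_params hν hl hlL (C := 2 * C) (by positivity)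
  refine ⟨2 * (m + 3), γ, κ' / 2, by positivity, hγ, by positivity, ?_⟩
  intro η hη hη1
  refine ⟨psi η γ ε m, ?_, ?_⟩
  · intro X Y hY hYX hX
    have hW : 0 < X + η := by linarith
    have hu := psi_upper m hη hγ hγ1 hε hε1 hY hYX
    have hWη : (X + η) ^ (γ - 1) ≤ η ^ (γ - 1) :=
      Real.rpow_le_rpow_of_nonpos hη (by linarith) (by linarith)
    have hηγ : η ^ (γ - 1) = η ^ γ / η := Real.rpow_sub_one hη.ne' _
    have hηg1 : η ^ γ ≤ 1 := Real.rpow_le_one hη.le hη1 hγ.le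
    refine ⟨psi_lower m hη hη1 hγ hγ1 hε hY hYX hX, hu.trans ?_, fun hXY => hu.trans ?_⟩
    · calc (m + 3) * ((X + η) ^ (γ - 1) * (X + η - Y)) ≤ (m+3) * (η ^ γ / η * 2) := by
            rw [hηγ] at hWη
            gcongr
            · linarith
            · linarith
        _ ≤ (m+3) * (1 / η * 2) := by gcongr
        _ = _ := by ring
    · calc (m + 3) * ((X + η) ^ (γ - 1) * (X + η - Y)) ≤ (m+3) * (η ^ γ / η * (2 * η)) := by
            rw [hηγ] at hWη
            gcongr
            · linarith
            · linarith
        _ = _ := by field_simp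
  -- Taylor constants
  obtain ⟨D1, hD1, T1⟩ := T3_rpow hη γ
  obtain ⟨D2, hD2, T2⟩ := T3_rpow hη (γ - (m+2))
  obtain ⟨D3, hD3, T3'⟩ := T3_rpow hη (γ - 1)
  obtain ⟨D4, hD4, T4⟩ := T3_pow m
  obtain ⟨R1, hR1, r1⟩ := rpow_bdd hη (γ - 2)
  obtain ⟨R2, hR2, r2⟩ := rpow_bdd hη (γ - (m+2) - 2)
  obtain ⟨R3, hR3, r3⟩ := rpow_bdd hη (γ - 1 - 2)
  obtain ⟨R4, hR4, r4⟩ := rpow_bdd hη (γ - (m+2))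
  set c1 := (1 + ε) * γ * (γ - 1) with hc1
  set c2 := (γ - (m+2)) * (γ - (m+2) - 1) with hc2
  set c3 := ε * ((γ - 1) * (γ - 1 - 1)) with hc3
  set D := (2 * D1 + 1 * D2 + 1 * D3) + R4 * D4 + (|c1| * R1 + |c2| * R2 + |c3| * R3)
    + (m+2)*(m+1) * R4 with hD
  have hDp : 0 ≤ D := by positivity
  set Er := (ν * L + C) * D + (L * (2 * ν + 8) + 2 * C) * D with hEr
  have hL : 0 < L := by linarith
  have hErp : 0 ≤ Er := by positivity
  obtain ⟨n0, hn0⟩ := exists_nat_ge (4 * Er / κ' + 1)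
  have hn0p : 0 < n0 := by
    have : (0:ℝ) < n0 := lt_of_lt_of_le (by positivity) hn0
    exact_mod_cast this
  refine ⟨n0, hn0p, ?_⟩
  intro n hn
  have hnn : 0 < n := by omega
  have hnp : (0:ℝ) < n := by exact_mod_cast hnn
  have hErn : 2 * Er * (1/n) ≤ κ' / 2 := by
    have : (n0:ℝ) ≤ n := by exact_mod_cast hn
    have : 4 * Er / κ' ≤ n := by linarith
    rw [div_le_iff₀ hκ'] at this
    rw [mul_one_div, div_le_iff₀ hnp]
    linarith
  refine ⟨?_, ?_⟩
  · -- monotonicity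
    intro i j hji hi
    have hX0 := xg_nonneg n i
    have hY0 := xg_nonneg n j
    have hYX : (j:ℝ)/n ≤ (i:ℝ)/n := by gcongr
    have hXX : (i:ℝ)/n ≤ ((i+1:ℕ):ℝ)/n := by gcongr; omega
    set X := (i:ℝ)/n
    set X' := ((i+1:ℕ):ℝ)/n
    set Y := (j:ℝ)/n
    unfold psi
    have a1 : (X+η) ^ γ ≤ (X'+η) ^ γ := by gcongr
    have a2 : (X'+η) ^ (γ-(m+2)) ≤ (X+η) ^ (γ-(m+2)) :=
      Real.rpow_le_rpow_of_nonpos (by linarith) (by linarith) (by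
        have : (0:ℝ) ≤ m := Nat.cast_nonneg m
        linarith)
    have a3 : (X'+η) ^ (γ-1) ≤ (X+η) ^ (γ-1) :=
      Real.rpow_le_rpow_of_nonpos (by linarith) (by linarith) (by linarith)
    gcongr
  · intro i j hji hi a b a' b' hab hab'
    have hj : j ≤ n := by omega
    have hX0 := xg_nonneg n i
    have hY0 := xg_nonneg n j
    have hX1 := xg_le_one hi
    have hY1 := xg_le_one hj
    have hYX : (j:ℝ)/n ≤ (i:ℝ)/n := by gcongr
    have eX' : ((i+1:ℕ):ℝ)/n = (i:ℝ)/n + 1/n := by push_cast; ring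
    have eY' : ((j+1:ℕ):ℝ)/n = (j:ℝ)/n + 1/n := by push_cast; ring
    have eX : ((i-1:ℕ):ℝ)/n = (i:ℝ)/n + -(1/n) := by
      rw [Nat.cast_sub (by omega)]; push_cast; ring
    have eY : 0 < j → ((j-1:ℕ):ℝ)/n = (j:ℝ)/n + -(1/n) := by
      intro h; rw [Nat.cast_sub (by omega)]; push_cast; ring
    have hh0 : (0:ℝ) < 1/n := by positivity
    have hh1 : (1:ℝ)/n ≤ 1 := div_le_one_of_le₀ (by exact_mod_cast hnn) hnp.le
    have hXm : 0 ≤ (i:ℝ)/n + -(1/n) := by rw [← eX]; positivity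
    have hYm : 0 < j → 0 ≤ (j:ℝ)/n + -(1/n) := by intro h; rw [← eY h]; positivity
    have opX := fun P1 P2 Dp Dm => disc_op (P1 := P1) (P2 := P2) (Dp := Dp) (Dm := Dm) hnn hi hν hl hC.le hDp hab
    have opY := fun P1 P2 Dp Dm => disc_op (P1 := P1) (P2 := P2) (Dp := Dp) (Dm := Dm) hnn hj hν hl hC.le hDp hab'
    rw [eX', eY', eX]
    set X := (i:ℝ)/n
    set Y := (j:ℝ)/n
    set h := (1:ℝ)/n with hh
    have hY2 : Y ^ (m+2) ≤ 1 := pow_le_one₀ hY0 hY1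
    -- X direction
    have TX := ((T1.smul (c := 1 + ε) (A := 2) (by rw [abs_of_pos (by positivity)]; linarith) hD1).add
      (T2.smul (c := -(Y^(m+2))) (A := 1) (by rw [abs_neg, abs_of_nonneg (by positivity)]; exact hY2) hD2)).add
      (T3'.smul (c := -(ε*Y)) (A := 1) (by
        rw [abs_neg, abs_of_nonneg (by positivity)]
        exact mul_le_one₀ hε1 hY0 hY1) hD3)
    have TY := T4.smul (c := -((X+η)^(γ-(m+2)))) (A := R4) (by
      rw [abs_neg]; exact r4 X ⟨hX0, hX1⟩) hD4
    have hDX : 2 * D1 + 1 * D2 + 1 * D3 ≤ D := by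
      have : 0 ≤ R4 * D4 + (|c1| * R1 + |c2| * R2 + |c3| * R3) + (m+2)*(m+1) * R4 := by positivity
      linarith
    have hDY : R4 * D4 ≤ D := by
      have : 0 ≤ (2 * D1 + 1 * D2 + 1 * D3) + (|c1| * R1 + |c2| * R2 + |c3| * R3) + (m+2)*(m+1) * R4 := by positivity
      linarith
    have ah : |h| = h := abs_of_pos hh0
    have anh : |-h| = h := by rw [abs_neg, ah]
    have tx1 := TX X h hX0 hX1 (by rw [ah]; exact hh1) (by linarith)
    have tx2 := TX X (-h) hX0 hX1 (by rw [anh]; exact hh1) hXm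
    have ty1 := TY Y h hY0 hY1 (by rw [ah]; exact hh1) (by linarith)
    have ty2 := fun h0 => TY Y (-h) hY0 hY1 (by rw [anh]; exact hh1) (hYm h0)
    rw [ah] at tx1 ty1
    rw [anh] at tx2 ty2
    have hW : 0 < X + η := by linarith
    obtain ⟨κx, kx1, kx2, ox⟩ := opX
      ((1+ε) * (γ * (X+η)^(γ-1)) + -(Y^(m+2)) * ((γ-(m+2)) * (X+η)^(γ-(m+2)-1)) + -(ε*Y) * ((γ-1) * (X+η)^(γ-1-1)))
      ((1+ε) * (γ * (γ-1) * (X+η)^(γ-2)) + -(Y^(m+2)) * ((γ-(m+2)) * (γ-(m+2)-1) * (X+η)^(γ-(m+2)-2)) + -(ε*Y) * ((γ-1) * (γ-1-1) * (X+η)^(γ-1-2)))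
      (psi η γ ε m (X+h) Y - psi η γ ε m X Y) (psi η γ ε m X Y - psi η γ ε m (X+-h) Y)
      (by
        refine le_trans (le_of_eq ?_) (tx1.trans (mul_le_mul_of_nonneg_right hDX (by positivity)))
        unfold psi; congr 1; ring)
      (by
        intro _
        refine le_trans (le_of_eq ?_) (tx2.trans (mul_le_mul_of_nonneg_right hDX (by positivity)))
        rw [← abs_neg]
        unfold psi; congr 1; ring)
      (by
        have b1 : |(1+ε) * (γ * (γ-1) * (X+η)^(γ-2))| ≤ |c1| * R1 := by
          rw [show (1+ε) * (γ * (γ-1) * (X+η)^(γ-2)) = c1 * (X+η)^(γ-2) by rw [hc1]; ring, abs_mul]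
          exact mul_le_mul_of_nonneg_left (r1 X ⟨hX0, hX1⟩) (abs_nonneg _)
        have b2 : |-(Y^(m+2)) * ((γ-(m+2)) * (γ-(m+2)-1) * (X+η)^(γ-(m+2)-2))| ≤ 1 * (|c2| * R2) := by
          rw [abs_mul, abs_mul, abs_neg, abs_of_nonneg (by positivity : 0 ≤ Y^(m+2))]
          exact mul_le_mul hY2 (mul_le_mul_of_nonneg_left (r2 X ⟨hX0, hX1⟩) (abs_nonneg _)) (by positivity) (by norm_num)
        have b3 : |-(ε*Y) * ((γ-1) * (γ-1-1) * (X+η)^(γ-1-2))| ≤ |c3| * R3 * 1 := by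
          rw [show -(ε*Y) * ((γ-1) * (γ-1-1) * (X+η)^(γ-1-2)) = -(c3 * (X+η)^(γ-1-2) * Y) by rw [hc3]; ring, abs_neg, abs_mul, abs_mul, abs_of_nonneg hY0]
          exact mul_le_mul (mul_le_mul_of_nonneg_left (r3 X ⟨hX0, hX1⟩) (abs_nonneg _)) hY1 hY0 (by positivity)
        refine (abs_add_three _ _ _).trans ?_
        have : 0 ≤ (2 * D1 + 1 * D2 + 1 * D3) + R4 * D4 + (m+2)*(m+1) * R4 := by positivity
        linarith)
    obtain ⟨κy, ky1, ky2, oy⟩ := opY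
      (-((X+η)^(γ-(m+2))) * ((m+2) * Y^(m+1)) - ε * (X+η)^(γ-1))
      (-((X+η)^(γ-(m+2))) * ((m+2) * (m+1) * Y^m))
      (psi η γ ε m X (Y+h) - psi η γ ε m X Y) (psi η γ ε m X Y - psi η γ ε m X (((j-1:ℕ):ℝ)/n))
      (by
        refine le_trans (le_of_eq ?_) (ty1.trans (mul_le_mul_of_nonneg_right hDY (by positivity)))
        unfold psi; congr 1; ring)
      (by
        intro h0
        rw [eY h0]
        refine le_trans (le_of_eq ?_) ((ty2 h0).trans (mul_le_mul_of_nonneg_right hDY (by positivity)))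
        rw [← abs_neg]
        unfold psi; congr 1; ring)
      (by
        rw [abs_mul, abs_neg, abs_of_nonneg (by positivity : (0:ℝ) ≤ (m+2)*(m+1)*Y^m)]
        have g1 : Y^m ≤ 1 := pow_le_one₀ hY0 hY1
        have g2 : ((m:ℝ)+2)*(m+1)*Y^m ≤ (m+2)*(m+1)*1 := by gcongr
        have := mul_le_mul (r4 X ⟨hX0, hX1⟩) g2 (by positivity) hR4
        have h0 : 0 ≤ (2 * D1 + 1 * D2 + 1 * D3) + R4 * D4 + (|c1| * R1 + |c2| * R2 + |c3| * R3) := by positivity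
        linarith)
    -- continuous inequality
    obtain ⟨f1, f2, f3, f4, f5, f6, f7⟩ := rpow_facts (γ := γ) hW m
    have hE := E_ge hW (by linarith) hγ hγ1
    set E := (X+η)^(γ-1) with hEdef
    set W := X + η with hWdef
    have hZ0 : 0 ≤ Y / W := by positivity
    have hZθ : Y / W ≤ X / W := by gcongr
    have hθ1 : X / W ≤ 1 := div_le_one_of_le₀ (by linarith) hW.le
    have hYZ : Y ≤ 2 * (Y / W) := by
      rw [mul_div_assoc', le_div_iff₀ hW, mul_comm]
      gcongr; linarith
    have ci := hCI (Y/W) (X/W) Y E κx κy X hZ0 hZθ hθ1 hY0 hY1 hYZ hE kx1 kx2 ky1 ky2 hX0 hX1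
    rw [f3, f6, f5, f4, f7] at ox
    rw [f2] at oy
    have w1 := w1_aux Y W E γ ε m
    have w2 := w2_aux X Y W E γ ε m
    have w3 := w3_aux Y W E ε m
    have w4 := w4_aux Y W E m
    have hm0 : (0:ℝ) ≤ m := Nat.cast_nonneg m
    have n1 : 0 ≤ ((1+ε)*γ + ((m+2:ℝ)-γ)*((Y/W)^(m+1)*(Y/W)) + ε*(1-γ)*(Y/W)) * E := by
      have g1 : 0 ≤ (m+2:ℝ)-γ := by linarith
      have g2 : 0 ≤ 1 - γ := by linarith
      positivity
    have n2 : 0 ≤ (((m+2:ℝ))*(Y/W)^(m+1) + ε) * E := by positivity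
    rw [w1, abs_of_nonneg n1] at ox
    rw [w3, abs_neg, abs_of_nonneg n2] at oy
    set P := ((1+ε)*γ + ((m+2:ℝ)-γ)*((Y/W)^(m+1)*(Y/W)) + ε*(1-γ)*(Y/W))
    set Q := (((m+2:ℝ))*(Y/W)^(m+1) + ε)
    set P2 := (1+ε) * (γ * (γ-1) * (E/W)) + -(Y^(m+2)) * ((γ-(m+2)) * (γ-(m+2)-1) * (E / W^(m+3))) + -(ε*Y) * ((γ-1) * (γ-1-1) * (E / W^2))
    set Q2 := -(E / W^(m+1)) * ((m+2) * (m+1) * Y^m)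
    set T := ((1+ε)*γ*(1-γ) + ((m+2:ℝ)-γ)*((m+3:ℝ)-γ)*((Y/W)^(m+1)*(Y/W)) + ε*(1-γ)*(2-γ)*(Y/W))
    set V := (m+2:ℝ)*(m+1)*(Y/W)^(m+1)
    rw [mul_assoc 4 X P2, w2] at ox
    rw [mul_assoc 4 Y Q2, w4] at oy
    have fin : ∀ u v w x : ℝ, (n:ℝ) * (u - v + w - x) = n * (u - v) + n * (w - x) := by intros; ring
    rw [fin]
    linarith

end RF


namespace RF

noncomputable def Ud (k : ℝ) (n : ℕ) (u : ℕ → ℝ) (i : ℕ) : ℝ :=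
  if i < n then n * (u (i+1) - u i) else k / 2

noncomputable def stp (ν α b k : ℝ) (n : ℕ) (τ : ℝ) (u : ℕ → ℝ) (i : ℕ) : ℝ :=
  u i + τ * Fd ν α b n (Ud k n u) i

def Inv (ν α b : ℝ) (n : ℕ) (m M P : ℝ) (U : ℕ → ℝ) : Prop :=
  ∀ i ≤ n, 0 < Hd ν n U i ∧ m ≤ Fd ν α b n U i ∧ Fd ν α b n U i ≤ M ∧ 4 * ((i:ℝ)/n) * (U i)^2 ≤ P^2

lemma inv_adm {ν α b m M P : ℝ} (hν : 0 < ν) (hα : 0 < α) (hb : b ≤ 0) (hm : 0 < m) (hmM : m ≤ M) :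
    ∃ H1 H2 S : ℝ, 0 < H1 ∧ H1 ≤ H2 ∧ 1 ≤ S ∧ ∀ n U, Inv ν α b n m M P U →
      Adm ν n H1 H2 S U ∧ ∀ i ≤ n, 0 ≤ Hd ν n U i ^ α + b := by
  set S := Real.sqrt (1 + P^2) with hS
  have hS1 : 1 ≤ S := by rw [hS]; apply Real.one_le_sqrt.2; nlinarith [sq_nonneg P]
  have hS0 : 0 < S := by linarith
  have hmS : m / S ≤ M := (div_le_self hm.le hS1).trans hmM
  have hmS0 : 0 < m / S := by positivity
  refine ⟨(m/S - b)^(1/α), (M - b)^(1/α), S, Real.rpow_pos_of_pos (by linarith) _,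
    Real.rpow_le_rpow (by linarith) (by linarith) (by positivity), hS1, ?_⟩
  intro n U hU
  have hpos := U_pos_of_Hd hν (fun i hi => (hU i hi).1)
  have key : ∀ i ≤ n, 1 ≤ Sd n U i ∧ Sd n U i ≤ S ∧ m / S ≤ Hd ν n U i ^ α + b ∧ Hd ν n U i ^ α + b ≤ M := by
    intro i hi
    obtain ⟨h1, h2, h3, h4⟩ := hU i hi
    have s1 : 1 ≤ Sd n U i := Sf_ge_one (xg_nonneg _ _)
    have s2 : Sd n U i ≤ S := by unfold Sd Sf; exact Real.sqrt_le_sqrt (by linarith)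
    unfold Fd at h2 h3
    set g := Hd ν n U i ^ α + b
    have hg : 0 < g := by
      by_contra hg; push Not at hg
      have : g * Sd n U i ≤ 0 := mul_nonpos_of_nonpos_of_nonneg hg (by linarith)
      linarith
    refine ⟨s1, s2, ?_, ?_⟩
    · rw [div_le_iff₀ hS0]; exact h2.trans (mul_le_mul_of_nonneg_left s2 hg.le)
    · exact le_trans (le_mul_of_one_le_right hg.le s1) h3
  refine ⟨fun i hi => ?_, fun i hi => by linarith [(key i hi).2.2.1]⟩
  obtain ⟨s1, s2, g1, g2⟩ := key i hi
  have h1 := (hU i hi).1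
  have e : Hd ν n U i = (Hd ν n U i ^ α) ^ (1/α) := by
    rw [← Real.rpow_mul h1.le, mul_one_div_cancel hα.ne', Real.rpow_one]
  refine ⟨hpos i hi, ?_, ?_, s2⟩
  · rw [e]; exact Real.rpow_le_rpow (by linarith) (by linarith) (by positivity)
  · rw [e]; exact Real.rpow_le_rpow (by positivity) (by linarith) (by positivity)

lemma key_s {ν s : ℝ} (hν : 2 ≤ ν) (hs : 0 < s) (hs1 : s ≤ 1/20) :
    (2 + (2+ν)*s) / Real.sqrt (1+s) + 2 / Real.sqrt (1-s) ≤ 4 + (2+ν)*s - 0.3*s^2 := by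
  have a1 : 1 / Real.sqrt (1+s) ≤ 1 - s/2 + 3/8*s^2 := by
    rw [div_le_iff₀ (Real.sqrt_pos.2 (by linarith))]
    have h0 : 0 < 1 - s/2 + 3/8*s^2 := by nlinarith
    rw [← Real.sqrt_sq h0.le, ← Real.sqrt_mul (by positivity)]
    apply Real.one_le_sqrt.2
    have : (1 - s/2 + 3/8*s^2)^2 * (1+s) = 1 + s^3 * (5/8 - 15/64*s + 9/64*s^2) := by ring
    rw [this]
    have : 0 ≤ s^3 * (5/8 - 15/64*s + 9/64*s^2) := mul_nonneg (by positivity) (by nlinarith)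
    linarith
  have a2 : 1 / Real.sqrt (1-s) ≤ 1 + s/2 + 0.4*s^2 := by
    rw [div_le_iff₀ (Real.sqrt_pos.2 (by linarith))]
    have h0 : 0 < 1 + s/2 + 0.4*s^2 := by positivity
    rw [← Real.sqrt_sq h0.le, ← Real.sqrt_mul (by positivity)]
    apply Real.one_le_sqrt.2
    have : (1 + s/2 + 0.4*s^2)^2 * (1-s) = 1 + s^2 * (0.05 - 0.65*s - 0.24 * s^2 - 0.16*s^3) := by ring
    rw [this]
    have h3 : s^3 ≤ 1/20 := by
      calc s^3 ≤ (1/20)^3 := by gcongr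
        _ ≤ 1/20 := by norm_num
    have : 0 ≤ s^2 * (0.05 - 0.65*s - 0.24 * s^2 - 0.16*s^3) := mul_nonneg (by positivity) (by nlinarith)
    linarith
  have e1 : (2 + (2+ν)*s) / Real.sqrt (1+s) = (2 + (2+ν)*s) * (1 / Real.sqrt (1+s)) := by ring
  have e2 : 2 / Real.sqrt (1-s) = 2 * (1 / Real.sqrt (1-s)) := by ring
  rw [e1, e2]
  have b1 := mul_le_mul_of_nonneg_left a1 (by nlinarith : 0 ≤ 2 + (2+ν)*s)
  have b2 : (ν - 2) * s * (s/2 - 3/8*s^2) ≥ 0 := mul_nonneg (mul_nonneg (by linarith) hs.le) (by nlinarith)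
  have b3 : s^2 * (0.15 - 1.5 * s) ≥ 0 := mul_nonneg (by positivity) (by linarith)
  nlinarith

set_option maxHeartbeats 1000000 in
lemma grad_H {ν P δ p : ℝ} {n i : ℕ} {U : ℕ → ℝ} (hν : 2 ≤ ν) (hP : 0 < P) (hi : 20 ≤ i) (hin : i < n)
    (hU : ∀ i ≤ n, 0 < U i) (hPn : ∀ i ≤ n, 4 * ((i:ℝ)/n) * (U i)^2 ≤ P^2)
    (hp : p = 2 * Real.sqrt ((i:ℝ)/n) * U i) (hpP : P - δ ≤ p) (hδ : 0 ≤ δ) :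
    Hd ν n U (i+1) - Hd ν n U i ≤ - (0.3 * (P / Real.sqrt (1+P^2)) / n) + n * (6 + ν) * δ := by
  set σ := P / Real.sqrt (1+P^2) with hσ
  have hσ0 : 0 < σ := by positivity
  have hn0 : (0:ℝ) < n := by exact_mod_cast (by omega : 0 < n)
  have hi0 : (20:ℝ) ≤ i := by exact_mod_cast hi
  have hi1 : (0:ℝ) < i := by linarith
  have hinr : (i:ℝ) ≤ n := by exact_mod_cast hin.le
  set X := (i:ℝ)/n with hX
  have hX0 : 0 < X := by positivity
  have hX1 : X ≤ 1 := xg_le_one hin.le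
  set x := Real.sqrt X with hx
  have hx0 : 0 < x := Real.sqrt_pos.2 hX0
  have hxX : x^2 = X := Real.sq_sqrt hX0.le
  have hx1 : x ≤ 1 := Real.sqrt_le_one.2 hX1
  set s : ℝ := 1 / i with hs
  have hs0 : 0 < s := by positivity
  have hs1 : s ≤ 1/20 := by rw [hs]; exact one_div_le_one_div_of_le (by norm_num) hi0
  -- general upper bound
  have gen : ∀ j ≤ n, Real.sqrt ((j:ℝ)/n) * Vd n U j ≤ σ := by
    intro j hj
    have h := hPn j hj
    have h0 := xg_nonneg n j
    set Y := (j:ℝ)/n with hY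
    have hq : Real.sqrt Y * Vd n U j = Real.sqrt (4*Y*(U j)^2) / Real.sqrt (1 + 4*Y*(U j)^2) := by
      have : 4*Y*(U j)^2 = (2 * U j)^2 * Y := by ring
      rw [this, Real.sqrt_mul (by positivity), Real.sqrt_sq (by linarith [hU j hj])]
      unfold Vd Vf Sf
      rw [← hY, show (2 * U j)^2 * Y = 4*Y*(U j)^2 by ring]
      ring
    rw [hq, hσ, ← Real.sqrt_div (by positivity), ]
    have : P / Real.sqrt (1+P^2) = Real.sqrt (P^2/(1+P^2)) := by
      rw [Real.sqrt_div (by positivity), Real.sqrt_sq hP.le]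
    rw [this]
    apply Real.sqrt_le_sqrt
    rw [div_le_div_iff₀ (by positivity) (by positivity)]
    nlinarith
  have V1 : Vd n U (i+1) ≤ σ / (x * Real.sqrt (1+s)) := by
    have := gen (i+1) hin
    rw [show (((i+1:ℕ):ℝ)/n) = X * (1+s) by rw [hX, hs]; push_cast; field_simp, Real.sqrt_mul hX0.le] at this
    rw [le_div_iff₀ (mul_pos hx0 (Real.sqrt_pos.2 (by linarith)))]
    linarith
  have V3 : Vd n U (i-1) ≤ σ / (x * Real.sqrt (1-s)) := by
    have := gen (i-1) (by omega)
    rw [show (((i-1:ℕ):ℝ)/n) = X * (1-s) by rw [hX, hs, Nat.cast_sub (by omega)]; push_cast; field_simp, Real.sqrt_mul hX0.le] at this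
    rw [le_div_iff₀ (mul_pos hx0 (Real.sqrt_pos.2 (by linarith)))]
    linarith
  have hUi := hU i hin.le
  have hp0 : 0 < p := by rw [hp]; positivity
  have hp2 : p^2 = 4*X*(U i)^2 := by rw [hp, ← hxX]; ring
  have hpP' : p ≤ P := by
    have := hPn i hin.le
    rw [← hp2] at this
    exact (pow_le_pow_iff_left₀ hp0.le hP.le (by norm_num)).1 this
  have V2 : (σ - δ) / x ≤ Vd n U i := by
    rw [div_le_iff₀ hx0]
    have : Vd n U i * x = p / Real.sqrt (1 + p^2) := by
      unfold Vd Vf Sf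
      rw [← hX, hp2, hp]; ring
    rw [this]
    have s1 : Real.sqrt (1+p^2) ≤ Real.sqrt (1+P^2) := Real.sqrt_le_sqrt (by gcongr)
    have s0 : 1 ≤ Real.sqrt (1+p^2) := Real.one_le_sqrt.2 (by linarith [sq_nonneg p])
    have s2 : σ ≤ P / Real.sqrt (1+p^2) := by rw [hσ]; gcongr
    have s3 : (P - p) / Real.sqrt (1+p^2) ≤ P - p := div_le_self (by linarith) s0
    rw [sub_div] at s3
    linarith
  have hkey := key_s hν hs0 hs1
  have expand : Hd ν n U (i+1) - Hd ν n U i = i * ((2 + (2+ν)*s) * Vd n U (i+1) - (4 + (2+ν)*s) * Vd n U i + 2 * Vd n U (i-1)) := by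
    unfold Hd
    rw [Nat.add_sub_cancel]
    push_cast
    have his : (i:ℝ) * s = 1 := by rw [hs]; exact mul_one_div_cancel hi1.ne'
    generalize Vd n U (i+1) = a
    generalize Vd n U i = b
    generalize Vd n U (i-1) = c
    generalize (i:ℝ) = y at *
    linear_combination (-(2+ν)*(a-b)) * his
  rw [expand]
  have hνs : 0 ≤ (2+ν)*s := mul_nonneg (by linarith) hs0.le
  have hνs' : (2+ν)*s ≤ (2+ν)*1 := mul_le_mul_of_nonneg_left (by linarith) (by linarith)
  have m1 := mul_le_mul_of_nonneg_left V1 (by linarith : 0 ≤ 2 + (2+ν)*s)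
  have m2 := mul_le_mul_of_nonneg_left V2 (by linarith : 0 ≤ 4 + (2+ν)*s)
  have e1 : (2 + (2+ν)*s) * (σ / (x * Real.sqrt (1+s))) = σ / x * ((2 + (2+ν)*s) / Real.sqrt (1+s)) := by
    ring
  have e3 : 2 * (σ / (x * Real.sqrt (1-s))) = σ / x * (2 / Real.sqrt (1-s)) := by
    ring
  have m3 := mul_le_mul_of_nonneg_left hkey (by positivity : 0 ≤ σ / x)
  have e2 : (4 + (2+ν)*s) * ((σ - δ)/x) = σ/x*(4 + (2+ν)*s) - δ/x*(4 + (2+ν)*s) := by ring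
  have m4 : (2 + (2+ν)*s) * Vd n U (i+1) - (4 + (2+ν)*s) * Vd n U i + 2 * Vd n U (i-1) ≤ -(σ/x*(0.3*s^2)) + δ/x*(4 + (2+ν)*s) := by
    linarith
  refine (mul_le_mul_of_nonneg_left m4 hi1.le).trans ?_
  have f1 : (i:ℝ) / x = n * x := by
    rw [div_eq_iff hx0.ne', mul_assoc, ← sq, hxX, hX]; field_simp
  have g1 : 0.3 * σ / n ≤ i * (σ/x*(0.3*s^2)) := by
    have : (i:ℝ) * (σ/x*(0.3*s^2)) = 0.3 * σ / (i * x) := by rw [hs]; field_simp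
    rw [this]
    apply div_le_div_of_nonneg_left (by positivity) (by positivity)
    exact (mul_le_of_le_one_right hi1.le hx1).trans hinr
  have g2 : (i:ℝ) * (δ/x*(4 + (2+ν)*s)) ≤ n * (6+ν) * δ := by
    have : (i:ℝ) * (δ/x*(4 + (2+ν)*s)) = (n * x) * (4 + (2+ν)*s) * δ := by rw [← f1]; ring
    rw [this]
    apply mul_le_mul_of_nonneg_right _ hδ
    apply mul_le_mul _ _ (by linarith) hn0.le
    · exact mul_le_of_le_one_right hn0.le hx1
    · linarith
  linarith

end RF


namespace RF

lemma ev_lin {c : ℝ} (hc : 0 < c) (K : ℝ) : ∀ᶠ n : ℕ in atTop, K ≤ c * n := by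
  have : Tendsto (fun n : ℕ => c * (n:ℝ)) atTop atTop :=
    Tendsto.const_mul_atTop hc tendsto_natCast_atTop_atTop
  exact this.eventually_ge_atTop K

lemma Sf_lip {X U U' d : ℝ} (hX : 0 ≤ X) (hX1 : X ≤ 1) (hU : 0 ≤ U) (hU' : 0 ≤ U') (hd : 0 ≤ d)
    (h : U' ≤ U + d) : Sf X U' ≤ Sf X U + 2 * d := by
  have hS := Sf_pos (U := U) hX
  have hq := Sf_sq (U := U) hX
  have h2 : 2 * X * U ≤ Sf X U := by
    apply le_of_sq_le_sq _ hS.le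
    rw [hq]
    have : X * (4 * X * U^2) ≤ 1 * (4 * X * U^2) := mul_le_mul_of_nonneg_right hX1 (by positivity)
    nlinarith
  apply le_of_sq_le_sq _ (by linarith)
  rw [Sf_sq hX]
  have e : (Sf X U + 2*d)^2 = 1 + 4*X*U^2 + 4*d*Sf X U + 4*d^2 := by rw [← hq]; ring
  rw [e]
  have g1 : U'^2 ≤ (U+d)^2 := by gcongr
  have g2 := mul_le_mul_of_nonneg_left g1 (by positivity : 0 ≤ 4 * X)
  have g3 := mul_le_mul_of_nonneg_left h2 (by positivity : 0 ≤ 4 * d)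
  have g4 : X * d^2 ≤ 1 * d^2 := mul_le_mul_of_nonneg_right hX1 (by positivity)
  linarith

lemma cf_nonneg {X U U' : ℝ} (hX : 0 ≤ X) (hU : 0 < U) (hU' : 0 < U') : 0 ≤ cf X U U' := by
  have h1 := Sf_pos (U := U) hX
  have h2 := Sf_pos (U := U') hX
  have h3 : 0 < Rf X U U' := lt_of_lt_of_le one_pos (Rf_ge_one hX hU hU')
  unfold cf; positivity

lemma adm_pert {ν H1 H2 S d : ℝ} {n : ℕ} {U U' : ℕ → ℝ} (hν : 0 < ν) (hH1 : 0 < H1) (hH2 : H1 ≤ H2) (hS : 1 ≤ S)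
    (hU : Adm ν n H1 H2 S U) (hd : ∀ i ≤ n, |U' i - U i| ≤ d)
    (h1 : d * (2 * ν + 8 * n) ≤ H1 / 2) (h3 : 2 * d ≤ 1) :
    Adm ν n (H1/2) (2*H2) (2*S) U' := by
  have hd0 : 0 ≤ d := (abs_nonneg _).trans (hd 0 (Nat.zero_le _))
  have hV := Vd_bounds hν (fun i hi => ⟨(hU i hi).2.1, (hU i hi).2.2.1⟩)
  have h2 : d * (2*ν) ≤ H1/2 := by
    have : 0 ≤ d * (8 * n) := by positivity
    linarith
  have pos : ∀ i ≤ n, 0 < U' i := by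
    intro i hi
    have a := abs_le.1 (hd i hi)
    have v := (hV i hi).1
    have s : 1 ≤ Sd n U i := Sf_ge_one (xg_nonneg _ _)
    have e : U i = _ := U_eq (n := n)
    have : Vd n U i * 1 ≤ Vd n U i * Sd n U i := mul_le_mul_of_nonneg_left s (Vd_pos (hU i hi).1).le
    have : H1 / ν ≤ 2 * U i := by linarith
    rw [div_le_iff₀ hν] at this
    by_contra hc
    push Not at hc
    have : U i ≤ d := by linarith
    nlinarith
  intro i hi
  have hi' : i - 1 ≤ n := by omega
  have hsub := Hd_sub (ν := ν) (n := n) (hU i hi).1 (pos i hi) (hU (i-1) hi').1 (pos (i-1) hi')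
  have c1 := cf_le (xg_nonneg n i) (hU i hi).1 (pos i hi)
  have c2 := cf_le (xg_nonneg n (i-1)) (hU (i-1) hi').1 (pos (i-1) hi')
  have c1' : 0 ≤ cf ((i:ℝ)/n) (U i) (U' i) := cf_nonneg (xg_nonneg n i) (hU i hi).1 (pos i hi)
  have c2' : 0 ≤ cf (((i-1:ℕ):ℝ)/n) (U (i-1)) (U' (i-1)) := cf_nonneg (xg_nonneg n (i-1)) (hU (i-1) hi').1 (pos (i-1) hi')
  set A := cf ((i:ℝ)/n) (U i) (U' i)
  set D := cf (((i-1:ℕ):ℝ)/n) (U (i-1)) (U' (i-1))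
  have hin : (i:ℝ) ≤ n := by exact_mod_cast hi
  have hi0 : (0:ℝ) ≤ i := Nat.cast_nonneg i
  have hH : |Hd ν n U' i - Hd ν n U i| ≤ H1/2 := by
    rw [hsub]
    refine (abs_sub _ _).trans ?_
    have t1 : |(ν + 2*i) * A * (U' i - U i)| ≤ (ν + 2*n) * 2 * d := by
      rw [abs_mul, abs_of_nonneg (by positivity : 0 ≤ (ν + 2*i) * A)]
      apply mul_le_mul _ (hd i hi) (abs_nonneg _) (by positivity)
      apply mul_le_mul _ c1 c1' (by positivity)
      linarith
    have t2 : |2*i * D * (U' (i-1) - U (i-1))| ≤ (2*n) * 2 * d := by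
      rw [abs_mul, abs_of_nonneg (by positivity : 0 ≤ (2*i) * D)]
      apply mul_le_mul _ (hd (i-1) hi') (abs_nonneg _) (by positivity)
      apply mul_le_mul _ c2 c2' (by positivity)
      linarith
    linarith
  obtain ⟨q1, q2⟩ := abs_le.1 hH
  obtain ⟨r1, r2, r3, r4⟩ := hU i hi
  have hs := Sf_lip (xg_nonneg n i) (xg_le_one hi) r1.le (pos i hi).le hd0
    (by linarith [(abs_le.1 (hd i hi)).2] : U' i ≤ U i + d)
  refine ⟨pos i hi, by linarith, by linarith, ?_⟩
  unfold Sd at r4 ⊢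
  linarith

lemma Ud_stp {ν α b k τ : ℝ} {n : ℕ} {u : ℕ → ℝ} (i : ℕ) :
    Ud k n (stp ν α b k n τ u) i - Ud k n u i = if i < n then
      n * τ * (Fd ν α b n (Ud k n u) (i+1) - Fd ν α b n (Ud k n u) i) else 0 := by
  conv_lhs => unfold Ud
  split_ifs
  · unfold stp; ring
  · ring

lemma LinCoef.b_zero {ν l L C : ℝ} {n : ℕ} {a b : ℝ} (h : LinCoef ν l L C n 0 a b) : b = 0 := by
  obtain ⟨-, -, κ, -, -, -, h⟩ := h
  simp only [Nat.cast_zero, zero_div, mul_zero, sub_zero] at h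
  exact abs_nonpos_iff.1 h

/-- difference quotient identity used for both `G` and `w` -/
lemma lin_ident {n i : ℕ} {τ p q : ℝ} {Y D : ℕ → ℝ} (hi : i ≤ n) (hq : i = 0 → q = 0)
    (hD : ∀ i, D i = if i < n then n * τ * (Y (i+1) - Y i) else 0) :
    p * D i - q * D (i-1) = τ * n * (p * (if i < n then Y (i+1) - Y i else 0) - q * (Y i - Y (i-1))) := by
  rw [hD i, hD (i-1)]
  rcases Nat.eq_zero_or_pos i with h | h
  · rw [hq h]; split_ifs <;> ring
  · rw [if_pos (by omega : i - 1 < n), Nat.sub_add_cancel h]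
    split_ifs <;> ring

set_option maxHeartbeats 1000000 in
lemma grad_step {ν α b k m M P B H1 H2 a0 : ℝ} {n : ℕ} {u : ℕ → ℝ} (hν : 2 ≤ ν) (hm : 0 < m)
    (hmM : m ≤ M) (hk : 0 < k) (hkP : k ≤ P) (hB : 0 < B) (ha0 : 0 < a0)
    (hdd : ∀ x ∈ Icc H1 H2, ∀ y ∈ Icc H1 H2, ∃ a, a0 ≤ a ∧ y ^ α - x ^ α = a * (y - x))
    (hinv : Inv ν α b n m M P (Ud k n u))
    (hH : ∀ i ≤ n, H1 ≤ Hd ν n (Ud k n u) i ∧ Hd ν n (Ud k n u) i ≤ H2 ∧ 0 < Ud k n u i ∧ Ud k n u i ≤ B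
      ∧ 0 ≤ Hd ν n (Ud k n u) i ^ α + b)
    (hU' : ∀ i ≤ n, 0 < Ud k n (stp ν α b k n (1/(n:ℝ)^4) u) i)
    (hn : 1 ≤ n)
    (c1 : 320 * B^2 ≤ P^2 * n) (c2 : 4 * M ≤ P * n)
    (c3 : 20 * M * (6+ν) ≤ P / Real.sqrt (1+P^2) * n)
    (c4 : 20 * M^2 + 1 ≤ a0 * (P / Real.sqrt (1+P^2)) * n) :
    ∀ i ≤ n, 4 * ((i:ℝ)/n) * (Ud k n (stp ν α b k n (1/(n:ℝ)^4) u) i)^2 ≤ P^2 := by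
  intro i hi
  have hP : 0 < P := by linarith
  have hM : 0 < M := by linarith
  have hn1 : (1:ℝ) ≤ n := by exact_mod_cast hn
  have hn0 : (0:ℝ) < n := by linarith
  rcases hi.lt_or_eq with hin | hin
  swap
  · subst hin
    rw [Ud, if_neg (by omega), div_self hn0.ne']
    have : k^2 ≤ P^2 := by gcongr
    linarith
  by_contra hc
  push Not at hc
  have hst := Ud_stp (ν := ν) (α := α) (b := b) (k := k) (τ := 1/(n:ℝ)^4) (n := n) (u := u) i
  rw [if_pos hin, show (n:ℝ) * (1/(n:ℝ)^4) = 1/(n:ℝ)^3 by field_simp] at hst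
  have hUi' := hU' i hi
  set U' := Ud k n (stp ν α b k n (1/(n:ℝ)^4) u) i
  set U := Ud k n u with hU
  obtain ⟨i1, i2, i3, i4⟩ := hinv i hi
  obtain ⟨j1, j2, j3, j4⟩ := hinv (i+1) hin
  obtain ⟨g1, g2, g3, g4, g5⟩ := hH i hi
  obtain ⟨k1, k2, k3, k4, k5⟩ := hH (i+1) hin
  set X := (i:ℝ)/n with hX
  have hX0 : 0 ≤ X := xg_nonneg n i
  have hX1 : X ≤ 1 := xg_le_one hi
  set x := Real.sqrt X with hx
  have hx0 : 0 ≤ x := Real.sqrt_nonneg _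
  have hxX : x^2 = X := Real.sq_sqrt hX0
  have hx1 : x ≤ 1 := Real.sqrt_le_one.2 hX1
  set p := 2 * x * U i with hp
  have hp' : P < 2 * x * U' := by
    apply lt_of_pow_lt_pow_left₀ 2 (by positivity)
    calc P^2 < 4 * X * U'^2 := hc
      _ = _ := by rw [← hxX]; ring
  have hpP : p ≤ P := by
    apply le_of_sq_le_sq _ hP.le
    calc p^2 = 4 * X * (U i)^2 := by rw [hp, ← hxX]; ring
      _ ≤ _ := i4
  set δ := 2 * M / (n:ℝ)^3 with hδ
  have hδ0 : 0 ≤ δ := by positivity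
  have hGlt : Fd ν α b n U i < Fd ν α b n U (i+1) := by
    by_contra hcc
    push Not at hcc
    have : U' ≤ U i := by
      have : 1/(n:ℝ)^3 * (Fd ν α b n U (i+1) - Fd ν α b n U i) ≤ 0 :=
        mul_nonpos_of_nonneg_of_nonpos (by positivity) (by linarith)
      linarith
    have : 2 * x * U' ≤ 2 * x * U i := mul_le_mul_of_nonneg_left this (by positivity)
    linarith
  have hz : U' - U i ≤ M / (n:ℝ)^3 := by
    rw [hst]
    calc 1/(n:ℝ)^3 * (Fd ν α b n U (i+1) - Fd ν α b n U i) ≤ 1/(n:ℝ)^3 * M :=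
          mul_le_mul_of_nonneg_left (by linarith) (by positivity)
      _ = _ := by ring
  have hpl : P - δ ≤ p := by
    have a1 : 2 * x * (U' - U i) ≤ 2 * x * (M / (n:ℝ)^3) := mul_le_mul_of_nonneg_left hz (by positivity)
    have a2 : 2 * x * (M / (n:ℝ)^3) ≤ 2 * 1 * (M / (n:ℝ)^3) := by gcongr
    have a3 : 2 * 1 * (M / (n:ℝ)^3) = δ := by rw [hδ]; ring
    rw [hp]; linarith
  have hn3 : (n:ℝ) ≤ (n:ℝ)^3 := le_self_pow₀ hn1 (by norm_num)
  have hδP : δ ≤ P / 2 := by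
    rw [hδ, div_le_iff₀ (by positivity)]
    have : P / 2 * n ≤ P / 2 * (n:ℝ)^3 := mul_le_mul_of_nonneg_left hn3 (by positivity)
    linarith
  have hi20 : 20 ≤ i := by
    have b1 : P / 2 ≤ 2 * x * B := by
      have : 2 * x * U i ≤ 2 * x * B := mul_le_mul_of_nonneg_left g4 (by positivity)
      linarith
    have b2 : (P/2)^2 ≤ (2 * x * B)^2 := by gcongr
    have b3 : (2*x*B)^2 = 4 * B^2 * X := by rw [← hxX]; ring
    have b4 : P^2 * n ≤ 16 * B^2 * i := by
      have e : (X:ℝ) * n = i := by rw [hX]; field_simp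
      have := mul_le_mul_of_nonneg_right (b2.trans_eq b3) hn0.le
      rw [mul_assoc (4 * B^2), e] at this
      linarith
    have b5 : 16 * B^2 * 20 ≤ 16 * B^2 * i := by linarith
    have : (20:ℝ) ≤ i := le_of_mul_le_mul_left b5 (by positivity)
    exact_mod_cast this
  set σ := P / Real.sqrt (1+P^2) with hσ
  have hσ0 : 0 < σ := by positivity
  have hgr := grad_H hν hP hi20 hin (fun i hi => (hH i hi).2.2.1) (fun i hi => (hinv i hi).2.2.2) rfl hpl hδ0
  rw [← hσ] at hgr
  have hn2 : (n:ℝ) ≤ (n:ℝ)^2 := le_self_pow₀ hn1 (by norm_num)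
  have e1 : n * (6+ν) * δ ≤ 0.1 * σ / n := by
    have : n * (6+ν) * δ = 2 * M * (6+ν) / n / n := by rw [hδ]; field_simp
    rw [this]
    apply div_le_div_of_nonneg_right _ hn0.le
    rw [div_le_iff₀ hn0]
    linarith
  have hHdrop : Hd ν n U (i+1) - Hd ν n U i ≤ -(0.2 * σ / n) := by
    have : 0.3 * σ / n = 0.1 * σ / n + 0.2 * σ / n := by ring
    linarith
  obtain ⟨a, ha, hab⟩ := hdd _ ⟨g1, g2⟩ _ ⟨k1, k2⟩
  have hf : Hd ν n U (i+1) ^ α - Hd ν n U i ^ α ≤ -(a0 * (0.2 * σ / n)) := by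
    rw [hab]
    have q0 : 0 ≤ 0.2 * σ / n := by positivity
    have q1 := mul_le_mul_of_nonneg_left hHdrop (by linarith : 0 ≤ a)
    have q2 := mul_le_mul_of_nonneg_right ha q0
    linarith
  have hS1 : Sd n U (i+1) ≤ Real.sqrt (1+P^2) := by
    unfold Sd Sf; exact Real.sqrt_le_sqrt (by linarith)
  have hSi : 1 ≤ Sd n U i := Sf_ge_one (xg_nonneg _ _)
  have hp0 : 0 ≤ p := by linarith
  have hS2 : Real.sqrt (1+P^2) ≤ Sd n U i + δ := by
    have e : Sd n U i = Real.sqrt (1+p^2) := by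
      unfold Sd Sf; rw [hp, mul_pow, mul_pow, hxX]; congr 1; rw [hX]; ring
    have hr0 : p ≤ Real.sqrt (1+p^2) := Real.le_sqrt_of_sq_le (by linarith)
    have hr : Real.sqrt (1+p^2)^2 = 1 + p^2 := Real.sq_sqrt (by positivity)
    rw [e]
    set r := Real.sqrt (1+p^2)
    apply Real.sqrt_le_iff.2
    constructor
    · linarith
    · have : P^2 ≤ (p+δ)^2 := by
        apply pow_le_pow_left₀ hP.le; linarith
      have : p * δ ≤ r * δ := mul_le_mul_of_nonneg_right hr0 hδ0
      have e1 : (p+δ)^2 = p^2 + 2 * (p*δ) + δ^2 := by ring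
      have e2 : (r+δ)^2 = r^2 + 2 * (r*δ) + δ^2 := by ring
      linarith
  set f0 := Hd ν n U i ^ α + b with hf0
  set f1 := Hd ν n U (i+1) ^ α + b with hf1
  have hG0 : Fd ν α b n U i = f0 * Sd n U i := rfl
  have hG1 : Fd ν α b n U (i+1) = f1 * Sd n U (i+1) := rfl
  have hf0M : f0 ≤ M := (le_mul_of_one_le_right g5 hSi).trans i3
  have s1 : f1 * Sd n U (i+1) ≤ f1 * (Sd n U i + δ) := mul_le_mul_of_nonneg_left (hS1.trans hS2) k5
  have hdrop : f1 ≤ f0 - a0 * (0.2 * σ / n) := by linarith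
  have hf1M : f1 ≤ M := by
    have : 0 ≤ a0 * (0.2 * σ / n) := by positivity
    linarith
  have s2 : f1 * δ ≤ M * δ := mul_le_mul_of_nonneg_right hf1M hδ0
  have s3 : f1 * Sd n U i ≤ (f0 - a0 * (0.2 * σ / n)) * Sd n U i := mul_le_mul_of_nonneg_right hdrop (by linarith)
  have s4 : a0 * (0.2 * σ / n) * 1 ≤ a0 * (0.2 * σ / n) * Sd n U i := mul_le_mul_of_nonneg_left hSi (by positivity)
  have s5 : M * δ < a0 * (0.2 * σ / n) := by
    have u1 : M * δ = 2 * M^2 / (n:ℝ)^2 / n := by rw [hδ]; field_simp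
    have u2 : a0 * (0.2 * σ / n) = a0 * (0.2 * σ) / n := by ring
    rw [u1, u2]
    apply div_lt_div_of_pos_right _ hn0
    rw [div_lt_iff₀ (by positivity)]
    have := mul_le_mul_of_nonneg_left hn2 (by positivity : 0 ≤ a0 * (0.2 * σ))
    have : 0 < M^2 := by positivity
    linarith
  linarith

set_option maxHeartbeats 1000000 in
lemma inv_step {ν α b k m M P : ℝ} (hν : 2 ≤ ν) (hα : 0 < α) (hb : b ≤ 0) (hm : 0 < m)
    (hmM : m ≤ M) (hk : 0 < k) (hkP : k ≤ P) :
    ∃ l L C H1 H2 S : ℝ, 0 < l ∧ l ≤ L ∧ 0 < C ∧ 0 < H1 ∧ H1 ≤ H2 ∧ 1 ≤ S ∧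
      (∀ n U, Inv ν α b n m M P U → Adm ν n H1 H2 S U ∧ ∀ i ≤ n, 0 ≤ Hd ν n U i ^ α + b) ∧
      ∃ n0 : ℕ, ∀ n ≥ n0, 0 < n ∧ CFL ν L C n (1/(n:ℝ)^4) ∧
      (∀ U U', Inv ν α b n m M P U → Inv ν α b n m M P U' → ∀ i ≤ n, ∃ p q, LinCoef ν l L C n i p q ∧
        Fd ν α b n U' i - Fd ν α b n U i = p * (U' i - U i) - q * (U' (i-1) - U (i-1))) ∧
      (∀ u, Inv ν α b n m M P (Ud k n u) →
        Inv ν α b n m M P (Ud k n (stp ν α b k n (1/(n:ℝ)^4) u)) ∧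
        LinStep ν l L C n (1/(n:ℝ)^4) 0 (Fd ν α b n (Ud k n u))
          (Fd ν α b n (Ud k n (stp ν α b k n (1/(n:ℝ)^4) u)))) := by
  have hν0 : 0 < ν := by linarith
  have hM : 0 < M := by linarith
  have hP : 0 < P := by linarith
  obtain ⟨H1, H2, S, hH1, hH2, hS, hadm⟩ := inv_adm (P := P) hν0 hα hb hm hmM
  obtain ⟨B, hB, hBb⟩ := adm_bounds hν0 hH1 hH2 hS
  obtain ⟨a0, a1, ha0, ha01, hdd⟩ := pow_dd hα hH1 hH2
  obtain ⟨l, L, C, hl, hlL, hC, hlin⟩ := lin_F (b := b) (H1 := H1/2) (H2 := 2*H2) (S := 2*S) hν0 hα (by linarith) (by linarith) (by linarith)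
  have hL : 0 < L := by linarith
  set σ := P / Real.sqrt (1+P^2) with hσ
  have hσ0 : 0 < σ := by positivity
  refine ⟨l, L, C, H1, H2, S, hl, hlL, hC, hH1, hH2, hS, hadm, ?_⟩
  have ev := (ev_lin (by positivity : 0 < P^2) (320 * B^2)).and <| (ev_lin hP (4*M)).and <|
    (ev_lin hσ0 (20 * M * (6+ν))).and <| (ev_lin (mul_pos ha0 hσ0) (20 * M^2+1)).and <|
    (ev_lin hH1 (2 * M * (2*ν+8))).and <| (ev_lin one_pos (2*M)).and <|
    (ev_lin one_pos (2 * (L*(2*ν+8)+2*C))).and (eventually_ge_atTop 1)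
  obtain ⟨n0, hn0⟩ := eventually_atTop.1 ev
  refine ⟨n0, fun n hn => ?_⟩
  obtain ⟨c1, c2, c3, c4, c5, c6, c7, c8⟩ := hn0 n hn
  have hn1 : (1:ℝ) ≤ n := by exact_mod_cast c8
  have hnp : (0:ℝ) < n := by linarith
  have hn2 : (n:ℝ) ≤ (n:ℝ)^2 := le_self_pow₀ hn1 (by norm_num)
  have hn3 : (n:ℝ) ≤ (n:ℝ)^3 := le_self_pow₀ hn1 (by norm_num)
  have hadm' : ∀ U, Adm ν n H1 H2 S U → Adm ν n (H1/2) (2*H2) (2*S) U := by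
    intro U hU i hi
    obtain ⟨r1, r2, r3, r4⟩ := hU i hi
    exact ⟨r1, by linarith, by linarith, by linarith⟩
  have hcfl : CFL ν L C n (1/(n:ℝ)^4) := by
    refine ⟨by positivity, ?_⟩
    have : 2 * (1/(n:ℝ)^4) * n * (L*(2*ν+8*n)+2*C) = 2 * (L*(2*ν+8*n)+2*C) / (n:ℝ)^3 := by field_simp
    rw [this, div_le_one (by positivity)]
    have q1 : 2 * (L*(2*ν+8*n)+2*C) ≤ 2 * (L*(2*ν+8)+2*C) * n := by
      have : L * (2*ν) * 1 ≤ L * (2*ν) * n := mul_le_mul_of_nonneg_left hn1 (by positivity)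
      have : C * 1 ≤ C * n := mul_le_mul_of_nonneg_left hn1 (by positivity)
      linarith
    have q2 : 2 * (L*(2*ν+8)+2*C) * n ≤ (1 * n) * n := mul_le_mul_of_nonneg_right c7 hnp.le
    have q3 : (1 * (n:ℝ)) * n = (n:ℝ)^2 := by ring
    have q4 : (n:ℝ)^2 ≤ (n:ℝ)^3 := pow_le_pow_right₀ hn1 (by norm_num)
    linarith
  refine ⟨by omega, hcfl, ?_, ?_⟩
  · intro U U' hU hU' i hi
    exact hlin n (by omega) U U' (hadm' _ (hadm _ _ hU).1) (hadm' _ (hadm _ _ hU').1) (hadm _ _ hU).2 i hi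
  intro u hu
  obtain ⟨hA, hA0⟩ := hadm _ _ hu
  have hst := fun i => Ud_stp (ν := ν) (α := α) (b := b) (k := k) (τ := 1/(n:ℝ)^4) (n := n) (u := u) i
  have hd : ∀ i ≤ n, |Ud k n (stp ν α b k n (1/(n:ℝ)^4) u) i - Ud k n u i| ≤ M / (n:ℝ)^3 := by
    intro i hi
    rw [hst i]
    split_ifs with h
    · have a := hu i hi
      have c := hu (i+1) h
      rw [show (n:ℝ) * (1/(n:ℝ)^4) = 1/(n:ℝ)^3 by field_simp, abs_mul, abs_of_nonneg (by positivity : 0 ≤ 1/(n:ℝ)^3)]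
      calc _ ≤ 1/(n:ℝ)^3 * M := by
            apply mul_le_mul_of_nonneg_left _ (by positivity)
            rw [abs_le]; constructor <;> linarith
        _ = _ := by ring
    · rw [abs_zero]; positivity
  have hA' := adm_pert hν0 hH1 hH2 hS hA hd (by
      rw [div_mul_eq_mul_div, div_le_iff₀ (by positivity)]
      have q1 : M * (2*ν+8*n) ≤ M * (2*ν+8) * n := by
        have : M * (2*ν) * 1 ≤ M * (2*ν) * n := mul_le_mul_of_nonneg_left hn1 (by positivity)
        linarith
      have q2 := mul_le_mul_of_nonneg_right c5 hnp.le
      have q3 : H1 * n * n ≤ H1 * (n:ℝ)^3 := by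
        rw [mul_assoc, ← sq]
        exact mul_le_mul_of_nonneg_left (pow_le_pow_right₀ hn1 (by norm_num)) hH1.le
      linarith) (by
      rw [mul_div_assoc', div_le_one (by positivity)]; linarith)
  have hlinstep : LinStep ν l L C n (1/(n:ℝ)^4) 0 (Fd ν α b n (Ud k n u))
          (Fd ν α b n (Ud k n (stp ν α b k n (1/(n:ℝ)^4) u))) := by
    intro i hi
    obtain ⟨p, q, hpq, he⟩ := hlin n (by omega) _ _ (hadm' _ hA) hA' hA0 i hi
    refine ⟨p, q, hpq, ?_⟩
    have := lin_ident (p := p) (q := q) (D := fun i => Ud k n (stp ν α b k n (1/(n:ℝ)^4) u) i - Ud k n u i) hi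
      (fun h => by subst h; exact hpq.b_zero) hst
    rw [← this, ← he]
    simp
  refine ⟨fun i hi => ?_, hlinstep⟩
  have hmx := hlinstep.max hν0 hl hC.le hcfl (fun i hi => (hu i hi).2.2.1) i hi
  have hmn := hlinstep.min hν0 hl hC.le hcfl (fun i hi => (hu i hi).2.1) i hi
  refine ⟨by linarith [(hA' i hi).2.1], by linarith, by linarith, ?_⟩
  exact grad_step hν hm hmM hk hkP hB ha0
    (fun x hx y hy => by obtain ⟨a, h1, h2, h3⟩ := hdd x hx y hy; exact ⟨a, h1, h3⟩) hu
    (fun i hi => ⟨(hA i hi).2.1, (hA i hi).2.2.1, (hA i hi).1, (hBb n _ hA i hi).1, hA0 i hi⟩)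
    (fun i hi => (hA' i hi).1) c8 c1 c2 c3 c4 i hi

end RF


namespace RF

noncomputable def avg (f d : ℝ → ℝ) (r : ℝ) : ℝ := if r = 0 then d 0 else f r / r

lemma avg_cont {f d : ℝ → ℝ} (hf : ∀ r ∈ Icc (0:ℝ) 1, HasDerivWithinAt f (d r) (Icc 0 1) r) (h0 : f 0 = 0) :
    ContinuousOn (avg f d) (Icc 0 1) := by
  intro r hr
  by_cases h : r = 0
  · subst h
    have h1 := hasDerivWithinAt_iff_tendsto_slope.1 (hf 0 hr)
    rw [← continuousWithinAt_sdiff_self]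
    unfold ContinuousWithinAt
    have e0 : avg f d 0 = d 0 := if_pos rfl
    rw [e0]
    refine Tendsto.congr' ?_ h1
    filter_upwards [self_mem_nhdsWithin] with x hx
    have hx0 : x ≠ 0 := hx.2
    rw [slope_def_field, avg, if_neg hx0, h0, sub_zero, sub_zero]
  · have : ContinuousWithinAt (fun r => f r / r) (Icc 0 1) r :=
      (hf r hr).continuousWithinAt.div continuousWithinAt_id h
    refine this.congr_of_eventuallyEq ?_ (if_neg h)
    filter_upwards [mem_nhdsWithin_of_mem_nhds (isOpen_ne.mem_nhds h)] with x hx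
    exact if_neg hx

lemma avg_mvt {f d : ℝ → ℝ} (hf : ∀ r ∈ Icc (0:ℝ) 1, HasDerivWithinAt f (d r) (Icc 0 1) r)
    {s r : ℝ} (hs : 0 ≤ s) (hsr : s < r) (hr : r ≤ 1) : ∃ ξ ∈ Ioo s r, f r - f s = d ξ * (r - s) := by
  have := exists_hasDerivAt_eq_slope f d hsr
    (fun x hx => (hf x ⟨by linarith [hx.1], by linarith [hx.2]⟩).continuousWithinAt.mono
      (Icc_subset_Icc hs hr))
    (fun x hx => (hf x ⟨by linarith [hx.1], by linarith [hx.2]⟩).hasDerivAt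
      (Icc_mem_nhds (by linarith [hx.1]) (by linarith [hx.2])))
  obtain ⟨ξ, hξ, he⟩ := this
  refine ⟨ξ, hξ, ?_⟩
  rw [he]
  have : r - s ≠ 0 := by linarith
  field_simp

/-- continuity modulus on `[0,1]` -/
lemma unif_mod {g : ℝ → ℝ} (hg : ContinuousOn g (Icc 0 1)) {ε : ℝ} (hε : 0 < ε) :
    ∃ δ > 0, ∀ x ∈ Icc (0:ℝ) 1, ∀ y ∈ Icc (0:ℝ) 1, |x - y| ≤ δ → |g x - g y| ≤ ε := by
  have := isCompact_Icc.uniformContinuousOn_of_continuous hg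
  rw [Metric.uniformContinuousOn_iff] at this
  obtain ⟨δ, hδ, h⟩ := this ε hε
  refine ⟨δ/2, by linarith, fun x hx y hy hxy => ?_⟩
  have := h x hx y hy (by rw [Real.dist_eq]; linarith)
  rw [Real.dist_eq] at this
  exact this.le

set_option maxHeartbeats 1000000 in
lemma consist_H {f d : ℝ → ℝ} (hf : ∀ r ∈ Icc (0:ℝ) 1, HasDerivWithinAt f (d r) (Icc 0 1) r) (h0 : f 0 = 0)
    (hd : ContinuousOn d (Icc 0 1)) {ε : ℝ} (hε : 0 < ε) :
    ∃ n0 : ℕ, ∀ n ≥ n0, ∀ i ≤ n,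
      |2 * i * (avg f d (Real.sqrt ((i:ℝ)/n)) - avg f d (Real.sqrt (((i-1:ℕ):ℝ)/n)))
        - (d (Real.sqrt ((i:ℝ)/n)) - avg f d (Real.sqrt ((i:ℝ)/n)))| ≤ 3 * ε := by
  obtain ⟨δ, hδ, hmod⟩ := unif_mod hd hε
  obtain ⟨K, hK⟩ := isCompact_Icc.exists_bound_of_continuousOn hd
  have hK0 : 0 ≤ K := (norm_nonneg _).trans (hK 0 (by norm_num))
  have ev := (ev_lin (by positivity : 0 < δ^2) 1).and <|
    (ev_lin (by positivity : 0 < ε * δ^2) (4 * K)).and (eventually_ge_atTop 1)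
  obtain ⟨n0, hn0⟩ := eventually_atTop.1 ev
  refine ⟨n0, fun n hn i hi => ?_⟩
  obtain ⟨c1, c2, c3⟩ := hn0 n hn
  have hnp : (0:ℝ) < n := by exact_mod_cast c3
  rcases Nat.eq_zero_or_pos i with hi0 | hi0
  · subst hi0
    simp [avg]; positivity
  set r := Real.sqrt ((i:ℝ)/n) with hr
  set s := Real.sqrt (((i-1:ℕ):ℝ)/n) with hs
  have hr2 : r^2 = i/n := Real.sq_sqrt (xg_nonneg _ _)
  have hs2 : s^2 = (i-1:ℕ)/n := Real.sq_sqrt (xg_nonneg _ _)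
  have hs0 : 0 ≤ s := Real.sqrt_nonneg _
  have hir : (0:ℝ) < i := by exact_mod_cast hi0
  have hr0 : 0 < r := Real.sqrt_pos.2 (by positivity)
  have hr1 : r ≤ 1 := Real.sqrt_le_one.2 (xg_le_one hi)
  have hcast : ((i-1:ℕ):ℝ) = i - 1 := by rw [Nat.cast_sub hi0]; simp
  have hrs : r^2 - s^2 = 1/n := by rw [hr2, hs2, hcast]; ring
  have hsr : s < r := by
    apply lt_of_pow_lt_pow_left₀ 2 hr0.le
    have : 0 < 1/(n:ℝ) := by positivity
    linarith
  have hδn : 1/(n:ℝ) ≤ δ^2 := by rw [div_le_iff₀ hnp]; linarith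
  have hrsδ : r - s ≤ δ := by
    apply le_of_sq_le_sq _ hδ.le
    have : s * s ≤ r * s := mul_le_mul_of_nonneg_right hsr.le hs0
    have e : (r-s)^2 = r^2 - s^2 - 2 * (r*s - s*s) := by ring
    linarith
  have hrI : r ∈ Icc (0:ℝ) 1 := ⟨hr0.le, hr1⟩
  have hVr : avg f d r = f r / r := if_neg hr0.ne'
  obtain ⟨ξ', hξ', he'⟩ := avg_mvt hf le_rfl hr0 hr1
  have hV' : avg f d r = d ξ' := by
    rw [hVr, div_eq_iff hr0.ne']; rw [h0] at he'; linarith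
  have hξ'I : ξ' ∈ Icc (0:ℝ) 1 := ⟨hξ'.1.le, by linarith [hξ'.2]⟩
  rcases hs0.eq_or_lt with hs00 | hs00
  · -- s = 0
    have hi1 : (i:ℝ) = 1 := by
      have : (i:ℝ) * (1/n) = 1 * (1/n) := by
        rw [← hrs, ← hs00]; rw [← hs00] at hrs; rw [show (i:ℝ) = r^2 * n by rw [hr2]; field_simp]
        have : r^2 = 1/n := by linarith
        rw [this]; field_simp
      exact mul_right_cancel₀ (by positivity) this
    have hVs : avg f d s = d 0 := by rw [← hs00]; exact if_pos rfl
    rw [hVs, hi1, hV']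
    have a1 := hmod ξ' hξ'I 0 (by norm_num) (by rw [abs_of_nonneg (by linarith [hξ'.1])]; linarith [hξ'.2])
    have a2 := hmod r hrI ξ' hξ'I (by rw [abs_of_nonneg (by linarith [hξ'.2])]; linarith [hξ'.1])
    rw [abs_le] at *
    constructor <;> linarith
  · have hVs : avg f d s = f s / s := if_neg hs00.ne'
    obtain ⟨ξ, hξ, he⟩ := avg_mvt hf hs0 hsr hr1
    have hξI : ξ ∈ Icc (0:ℝ) 1 := ⟨by linarith [hξ.1], by linarith [hξ.2]⟩
    set V := avg f d r with hV
    have hfr : f r = V * r := by rw [hVr]; field_simp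
    have hfs : f s = V * r - d ξ * (r - s) := by linarith
    have hi_eq : (i:ℝ) = r^2 / (r^2 - s^2) := by rw [hrs, hr2]; field_simp
    have hrs0 : 0 < r^2 - s^2 := by rw [hrs]; positivity
    set ρ := 2 * r^2 / ((r+s)*s) with hρ
    have main : 2 * i * (V - avg f d s) = ρ * (d ξ - V) := by
      rw [hVs, hfs, hi_eq, hρ]
      have h1 : r^2 - s^2 = (r-s)*(r+s) := by ring
      have h2 : r - s ≠ 0 := by linarith
      have h3 : r + s ≠ 0 := by positivity
      rw [h1]
      field_simp
      ring
    rw [main]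
    have hi2 : (2:ℝ) ≤ i := by
      have : 0 < ((i-1:ℕ):ℝ)/n := by rw [← hs2]; positivity
      have h' : (0:ℝ) < ((i-1:ℕ):ℝ) := by
        by_contra hc; push Not at hc
        have : ((i-1:ℕ):ℝ)/n ≤ 0 := div_nonpos_of_nonpos_of_nonneg hc hnp.le
        linarith
      have : 0 < i - 1 := by exact_mod_cast h'
      exact_mod_cast (by omega : 2 ≤ i)
    have hρ1 : 0 ≤ ρ - 1 := by
      rw [hρ, sub_nonneg, le_div_iff₀ (by positivity)]
      have : s * s ≤ r * s := mul_le_mul_of_nonneg_right hsr.le hs0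
      have : r * s ≤ r * r := mul_le_mul_of_nonneg_left hsr.le hr0.le
      linarith
    have hρ2 : ρ - 1 ≤ 1 / (i - 1) := by
      have e : (1:ℝ) / (i - 1) = (r^2 - s^2) / s^2 := by
        rw [hrs, hs2, hcast]
        have : (i:ℝ) - 1 ≠ 0 := by linarith
        field_simp
      rw [e, hρ, sub_div, div_self (by positivity)]
      have : 2 * r^2 / ((r+s)*s) ≤ r^2 / s^2 := by
        rw [div_le_div_iff₀ (by positivity) (by positivity)]
        have : s * s ≤ r * s := mul_le_mul_of_nonneg_right hsr.le hs0
        have := mul_le_mul_of_nonneg_left this (by positivity : 0 ≤ r^2)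
        linarith
      linarith
    have hi1' : 1 / ((i:ℝ) - 1) ≤ 1 := by rw [div_le_one (by linarith)]; linarith
    have hi1'' : 1 / ((i:ℝ) - 1) ≤ 2 / i := by rw [div_le_div_iff₀ (by linarith) hir]; linarith
    have e : ρ * (d ξ - V) - (d r - V) = ρ * (d ξ - d r) + (ρ - 1) * (d r - V) := by ring
    rw [e]
    have a1 := hmod ξ hξI r hrI (by rw [abs_sub_comm, abs_of_nonneg (by linarith [hξ.2])]; linarith [hξ.1])
    have t1 : |ρ * (d ξ - d r)| ≤ 2 * ε := by
      rw [abs_mul, abs_of_nonneg (by linarith : 0 ≤ ρ)]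
      exact mul_le_mul (by linarith) a1 (abs_nonneg _) (by norm_num)
    have t2 : |(ρ - 1) * (d r - V)| ≤ ε := by
      rw [abs_mul, abs_of_nonneg hρ1, hV']
      by_cases hrδ : r ≤ δ
      · have a2 := hmod r hrI ξ' hξ'I (by rw [abs_of_nonneg (by linarith [hξ'.2])]; linarith [hξ'.1])
        calc (ρ - 1) * |d r - d ξ'| ≤ 1 * ε := mul_le_mul (by linarith) a2 (abs_nonneg _) (by norm_num)
          _ = ε := one_mul _
      · push Not at hrδ
        have b1 : |d r - d ξ'| ≤ 2 * K := by
          have h1 := hK r hrI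
          have h2 := hK ξ' hξ'I
          rw [Real.norm_eq_abs] at h1 h2
          exact (abs_sub _ _).trans (by linarith)
        have b2 : δ^2 * n ≤ i := by
          have : δ^2 ≤ r^2 := by gcongr
          rw [hr2, le_div_iff₀ hnp] at this
          exact this
        calc (ρ - 1) * |d r - d ξ'| ≤ (2 / i) * (2 * K) := mul_le_mul (by linarith) b1 (abs_nonneg _) (by positivity)
          _ = 4 * K / i := by ring
          _ ≤ ε := by
            rw [div_le_iff₀ hir]
            have := mul_le_mul_of_nonneg_left b2 hε.le
            linarith
    exact (abs_add_le _ _).trans (by linarith)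

noncomputable def Us (y' y'' : ℝ → ℝ) (X : ℝ) : ℝ := avg y' y'' (Real.sqrt X) / 2

noncomputable def usum (c : ℝ) (y' y'' : ℝ → ℝ) (n i : ℕ) : ℝ :=
  c + (1/n) * ∑ l ∈ Finset.range i, Us y' y'' ((l:ℝ)/n)

lemma Ud_usum {k c : ℝ} {y' y'' : ℝ → ℝ} (hk : y' 1 = k) {n : ℕ} (hn : 0 < n) {i : ℕ} (hi : i ≤ n) :
    Ud k n (usum c y' y'' n) i = Us y' y'' ((i:ℝ)/n) := by
  have hn0 : (n:ℝ) ≠ 0 := by positivity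
  unfold Ud
  split_ifs with h
  · unfold usum
    rw [Finset.sum_range_succ]
    field_simp
    ring
  · have : i = n := by omega
    subst this
    rw [div_self hn0]
    simp [Us, avg, hk]

lemma Us_cont {y' y'' : ℝ → ℝ} (hf : ∀ r ∈ Icc (0:ℝ) 1, HasDerivWithinAt y' (y'' r) (Icc 0 1) r) (h0 : y' 0 = 0) :
    ContinuousOn (Us y' y'') (Icc 0 1) := by
  unfold Us
  apply ContinuousOn.div_const
  exact (avg_cont hf h0).comp Real.continuous_sqrt.continuousOn
    (fun x hx => ⟨Real.sqrt_nonneg _, Real.sqrt_le_one.2 hx.2⟩)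

lemma rpow32 (p : ℝ) : (1 + p^2) ^ ((3:ℝ)/2) = Real.sqrt (1+p^2) ^ 3 := by
  have h : (0:ℝ) ≤ 1 + p^2 := by positivity
  generalize 1 + p^2 = z at *
  rw [Real.sqrt_eq_rpow, ← Real.rpow_natCast, ← Real.rpow_mul h]
  norm_num

lemma sig_deriv {y' y'' : ℝ → ℝ} (hf : ∀ r ∈ Icc (0:ℝ) 1, HasDerivWithinAt y' (y'' r) (Icc 0 1) r) :
    ∀ r ∈ Icc (0:ℝ) 1, HasDerivWithinAt (fun r => y' r / Real.sqrt (1 + y' r^2))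
      (y'' r / (1 + y' r^2)^((3:ℝ)/2)) (Icc 0 1) r := by
  intro r hr
  have h := hf r hr
  have hp : 0 < 1 + y' r^2 := by positivity
  have h1 : HasDerivWithinAt (fun r => Real.sqrt (1 + y' r^2)) (2 * y' r * y'' r / (2 * Real.sqrt (1 + y' r^2))) (Icc 0 1) r := by
    have := ((h.pow 2).const_add 1).sqrt hp.ne'
    refine this.congr_deriv ?_
    simp
  have hq := Real.sqrt_pos.2 hp
  have hqq := Real.sq_sqrt hp.le
  refine (h.div h1 hq.ne').congr_deriv ?_
  rw [rpow32]
  have e : y' r ^ 2 = Real.sqrt (1 + y' r^2) ^ 2 - 1 := by rw [hqq]; ring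
  set q := Real.sqrt (1 + y' r^2)
  set p := y' r
  field_simp
  rw [e]; ring

lemma Vf_Us {y' y'' : ℝ → ℝ} (h0 : y' 0 = 0) {X : ℝ} (hX : 0 ≤ X) :
    Sf X (Us y' y'' X) = Real.sqrt (1 + y' (Real.sqrt X)^2) ∧
    Vf X (Us y' y'' X) = avg (fun r => y' r / Real.sqrt (1 + y' r^2))
      (fun r => y'' r / (1 + y' r^2)^((3:ℝ)/2)) (Real.sqrt X) := by
  have hS : Sf X (Us y' y'' X) = Real.sqrt (1 + y' (Real.sqrt X)^2) := by
    unfold Sf Us avg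
    congr 2
    split_ifs with h
    · rw [h, h0]; have : X = 0 := (Real.sqrt_eq_zero hX).1 h
      rw [this]; ring
    · have e : X = Real.sqrt X ^ 2 := (Real.sq_sqrt hX).symm
      set r := Real.sqrt X
      rw [e]; field_simp; ring
  refine ⟨hS, ?_⟩
  rw [Vf, hS]
  unfold Us avg
  split_ifs with h
  · rw [h]; simp [h0]; ring
  · field_simp

lemma meanCurv_eq (N : ℕ) {y' y'' : ℝ → ℝ} (h0 : y' 0 = 0) (r : ℝ) :
    meanCurv N r (y' r) (y'' r) = y'' r / (1 + y' r^2)^((3:ℝ)/2) + ((N:ℝ) - 1) *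
      avg (fun r => y' r / Real.sqrt (1 + y' r^2)) (fun r => y'' r / (1 + y' r^2)^((3:ℝ)/2)) r := by
  unfold meanCurv avg
  split_ifs with h
  · rw [h]; simp [h0]; ring
  · congr 1
    have := Real.sqrt_pos.2 (by positivity : 0 < 1 + y' r^2)
    field_simp

lemma sum_consist {k : ℝ} {y y' y'' : ℝ → ℝ} (hy : IsC2Data k y y' y'') {ε : ℝ} (hε : 0 < ε) :
    ∃ n0 : ℕ, ∀ n ≥ n0, ∀ i ≤ n, |usum (y 0) y' y'' n i - y (Real.sqrt ((i:ℝ)/n))| ≤ ε := by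
  obtain ⟨h1, h2, h3, h4, h5⟩ := hy
  obtain ⟨δ, hδ, hmod⟩ := unif_mod (Us_cont h2 h4) hε
  obtain ⟨n0, hn0⟩ := eventually_atTop.1 ((ev_lin hδ 1).and (eventually_ge_atTop 1))
  refine ⟨n0, fun n hn i hi => ?_⟩
  obtain ⟨c1, c2⟩ := hn0 n hn
  have hnp : (0:ℝ) < n := by exact_mod_cast c2
  have hcont : ContinuousOn (fun X => y (Real.sqrt X)) (Icc 0 1) := by
    have : ContinuousOn y (Icc 0 1) := fun r hr => (h1 r hr).continuousWithinAt
    exact this.comp Real.continuous_sqrt.continuousOn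
      (fun x hx => ⟨Real.sqrt_nonneg _, Real.sqrt_le_one.2 hx.2⟩)
  have step : ∀ l, l < n → |y (Real.sqrt (((l+1:ℕ):ℝ)/n)) - y (Real.sqrt ((l:ℝ)/n)) - (1/n) * Us y' y'' ((l:ℝ)/n)| ≤ (1/n) * ε := by
    intro l hl
    have hlt : (l:ℝ)/n < ((l+1:ℕ):ℝ)/n := by push_cast; gcongr; linarith
    have hle : ((l+1:ℕ):ℝ)/n ≤ 1 := xg_le_one hl
    have hl0 : 0 ≤ (l:ℝ)/n := xg_nonneg _ _
    have hdiff : ((l+1:ℕ):ℝ)/n - (l:ℝ)/n = 1/n := by push_cast; ring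
    obtain ⟨ξ, hξ, he⟩ := exists_hasDerivAt_eq_slope (fun X => y (Real.sqrt X)) (Us y' y'') hlt
      (hcont.mono (Icc_subset_Icc hl0 hle)) (by
        intro x hx
        have hx0 : 0 < x := by linarith [hx.1]
        have hx1 : x < 1 := by linarith [hx.2]
        have hs0 := Real.sqrt_pos.2 hx0
        have hs1 : Real.sqrt x < 1 := by rw [Real.sqrt_lt' one_pos]; linarith
        have hd := (h1 _ ⟨hs0.le, hs1.le⟩).hasDerivAt (Icc_mem_nhds hs0 hs1)
        refine (hd.comp x (Real.hasDerivAt_sqrt hx0.ne')).congr_deriv ?_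
        rw [Us, avg, if_neg hs0.ne']; field_simp)
    rw [hdiff] at he
    have e : y (Real.sqrt (((l+1:ℕ):ℝ)/n)) - y (Real.sqrt ((l:ℝ)/n)) = (1/n) * Us y' y'' ξ := by
      rw [he]; field_simp
    rw [e, ← mul_sub, abs_mul, abs_of_nonneg (by positivity : (0:ℝ) ≤ 1/n)]
    apply mul_le_mul_of_nonneg_left _ (by positivity)
    apply hmod ξ ⟨by linarith [hξ.1], by linarith [hξ.2]⟩ _ ⟨hl0, by linarith⟩
    rw [abs_of_nonneg (by linarith [hξ.1])]
    have : 1/(n:ℝ) ≤ δ := by rw [div_le_iff₀ hnp]; exact c1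
    linarith [hξ.2]
  have ind : ∀ i ≤ n, |usum (y 0) y' y'' n i - y (Real.sqrt ((i:ℝ)/n))| ≤ ((i:ℝ)/n) * ε := by
    intro i
    induction i with
    | zero => intro _; simp [usum]
    | succ i ih =>
      intro hi
      have a := ih (by omega)
      have b := step i (by omega)
      have e : usum (y 0) y' y'' n (i+1) = usum (y 0) y' y'' n i + (1/n) * Us y' y'' ((i:ℝ)/n) := by
        unfold usum; rw [Finset.sum_range_succ]; ring
      rw [e]
      have e2 : (((i+1:ℕ):ℝ)/n) * ε = ((i:ℝ)/n) * ε + (1/n) * ε := by push_cast; ring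
      rw [e2]
      rw [abs_le] at *
      constructor <;> linarith
  refine (ind i hi).trans ?_
  have := mul_le_mul_of_nonneg_right (xg_le_one hi) hε.le
  linarith

end RF


namespace RF

lemma Hd_congr {ν α b : ℝ} {n : ℕ} {U U' : ℕ → ℝ} (h : ∀ i ≤ n, U i = U' i) {i : ℕ} (hi : i ≤ n) :
    Hd ν n U i = Hd ν n U' i ∧ Fd ν α b n U i = Fd ν α b n U' i := by
  have h1 := h i hi
  have h2 := h (i-1) (by omega)
  have e : Hd ν n U i = Hd ν n U' i := by unfold Hd Vd; rw [h1, h2]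
  refine ⟨e, ?_⟩
  unfold Fd Sd; rw [e, h1]

lemma Inv_congr {ν α b m M P : ℝ} {n : ℕ} {U U' : ℕ → ℝ} (h : ∀ i ≤ n, U i = U' i)
    (hI : Inv ν α b n m M P U') : Inv ν α b n m M P U := by
  intro i hi
  obtain ⟨e1, e2⟩ := Hd_congr (ν := ν) (α := α) (b := b) h hi
  rw [e1, e2, h i hi]; exact hI i hi

/-- mean curvature of the data -/
noncomputable def Hof (N : ℕ) (y' y'' : ℝ → ℝ) (r : ℝ) : ℝ := meanCurv N r (y' r) (y'' r)
noncomputable def Gof (N : ℕ) (α b : ℝ) (y' y'' : ℝ → ℝ) (r : ℝ) : ℝ :=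
  (Hof N y' y'' r ^ α + b) * Real.sqrt (1 + y' r ^ 2)

lemma sqrt_mem {n i : ℕ} (hi : i ≤ n) : Real.sqrt ((i:ℝ)/n) ∈ Icc (0:ℝ) 1 :=
  ⟨Real.sqrt_nonneg _, Real.sqrt_le_one.2 (xg_le_one hi)⟩

lemma Hof_cont (N : ℕ) {k : ℝ} {y y' y'' : ℝ → ℝ} (hy : IsC2Data k y y' y'') :
    ContinuousOn (Hof N y' y'') (Icc 0 1) := by
  obtain ⟨h1, h2, h3, h4, h5⟩ := hy
  have hy' : ContinuousOn y' (Icc 0 1) := fun r hr => (h2 r hr).continuousWithinAt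
  have hd : ContinuousOn (fun r => y'' r / (1 + y' r^2)^((3:ℝ)/2)) (Icc 0 1) := by
    apply h3.div
    · apply ContinuousOn.rpow_const
      · fun_prop
      · intro r hr; left; positivity
    · intro r hr; positivity
  have ha := avg_cont (sig_deriv h2) (by simp [h4])
  have : Hof N y' y'' = fun r => y'' r / (1 + y' r^2)^((3:ℝ)/2) + ((N:ℝ) - 1) *
      avg (fun r => y' r / Real.sqrt (1 + y' r^2)) (fun r => y'' r / (1 + y' r^2)^((3:ℝ)/2)) r := by
    funext r; exact meanCurv_eq N h4 r
  rw [this]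
  exact hd.add (continuousOn_const.mul ha)

lemma Gof_cont (N : ℕ) {α b k : ℝ} (hα : 0 < α) {y y' y'' : ℝ → ℝ} (hy : IsC2Data k y y' y'') :
    ContinuousOn (Gof N α b y' y'') (Icc 0 1) := by
  have hH := Hof_cont N hy
  obtain ⟨h1, h2, h3, h4, h5⟩ := hy
  have hy' : ContinuousOn y' (Icc 0 1) := fun r hr => (h2 r hr).continuousWithinAt
  unfold Gof
  apply ContinuousOn.mul
  · apply ContinuousOn.add _ continuousOn_const
    exact hH.rpow_const (fun r hr => Or.inr hα.le)
  · fun_prop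

lemma data_Hd (N : ℕ) {k : ℝ} {y y' y'' : ℝ → ℝ} (hy : IsC2Data k y y' y'') {ε : ℝ} (hε : 0 < ε) :
    ∃ n0 : ℕ, ∀ n ≥ n0, ∀ i ≤ n, |Hd N n (fun i => Us y' y'' ((i:ℝ)/n)) i - Hof N y' y'' (Real.sqrt ((i:ℝ)/n))| ≤ ε := by
  obtain ⟨h1, h2, h3, h4, h5⟩ := hy
  have hy' : ContinuousOn y' (Icc 0 1) := fun r hr => (h2 r hr).continuousWithinAt
  have hd : ContinuousOn (fun r => y'' r / (1 + y' r^2)^((3:ℝ)/2)) (Icc 0 1) := by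
    apply h3.div
    · apply ContinuousOn.rpow_const
      · fun_prop
      · intro r hr; left; positivity
    · intro r hr; positivity
  obtain ⟨n0, hn0⟩ := consist_H (sig_deriv h2) (by simp [h4]) hd (by positivity : 0 < ε/3)
  refine ⟨n0, fun n hn i hi => ?_⟩
  have := hn0 n hn i hi
  rw [Hof, meanCurv_eq N h4, Hd, Vd, Vd, (Vf_Us h4 (xg_nonneg n i)).2, (Vf_Us h4 (xg_nonneg n (i-1))).2]
  refine le_trans (le_of_eq ?_) (this.trans (by linarith))
  congr 1; ring

lemma data_Fd (N : ℕ) {α b k : ℝ} (hα : 0 < α) {y y' y'' : ℝ → ℝ} (hy : IsC2Data k y y' y'')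
    (hH : ∀ r ∈ Icc (0:ℝ) 1, 0 < Hof N y' y'' r) {ε : ℝ} (hε : 0 < ε) :
    ∃ n0 : ℕ, ∀ n ≥ n0, ∀ i ≤ n, 0 < Hd N n (fun i => Us y' y'' ((i:ℝ)/n)) i ∧
      |Fd N α b n (fun i => Us y' y'' ((i:ℝ)/n)) i - Gof N α b y' y'' (Real.sqrt ((i:ℝ)/n))| ≤ ε := by
  have hHc := Hof_cont N hy
  obtain ⟨r1, hr1, hmin⟩ := isCompact_Icc.exists_isMinOn (nonempty_Icc.2 zero_le_one) hHc
  obtain ⟨r2, hr2, hmax⟩ := isCompact_Icc.exists_isMaxOn (nonempty_Icc.2 zero_le_one) hHc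
  set A := Hof N y' y'' r1
  set B := Hof N y' y'' r2
  have hA : 0 < A := hH r1 hr1
  have hAB : A ≤ B := hmin hr2
  obtain ⟨a0, a1, ha0, ha01, hdd⟩ := pow_dd hα (by linarith : 0 < A/2) (by linarith : A/2 ≤ B + 1)
  have hy' : ContinuousOn y' (Icc 0 1) := fun r hr => (hy.2.1 r hr).continuousWithinAt
  have hsc : ContinuousOn (fun r => Real.sqrt (1 + y' r^2)) (Icc 0 1) := by fun_prop
  obtain ⟨S, hS⟩ := isCompact_Icc.exists_bound_of_continuousOn hsc
  have hS0 : 0 ≤ S := (norm_nonneg _).trans (hS 0 (by norm_num))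
  have hη : 0 < min (min (A/2) 1) (ε / ((a1+1) * (S+1))) := by
    have : 0 < (a1+1) * (S+1) := by nlinarith
    positivity
  obtain ⟨n0, hn0⟩ := data_Hd N hy hη
  refine ⟨n0, fun n hn i hi => ?_⟩
  have h := hn0 n hn i hi
  have hrI := sqrt_mem hi
  set r := Real.sqrt ((i:ℝ)/n)
  have m1 : A ≤ Hof N y' y'' r := hmin hrI
  have m2 : Hof N y' y'' r ≤ B := hmax hrI
  have e1 := h.trans ((min_le_left _ _).trans (min_le_left _ _))
  have e2 := h.trans ((min_le_left _ _).trans (min_le_right _ _))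
  have e3 := h.trans (min_le_right _ _)
  rw [abs_le] at e1 e2
  set Hh := Hd N n (fun i => Us y' y'' ((i:ℝ)/n)) i with hHh
  refine ⟨by linarith, ?_⟩
  obtain ⟨a, g1, g2, g3⟩ := hdd (Hof N y' y'' r) ⟨by linarith, by linarith⟩ Hh ⟨by linarith, by linarith⟩
  have hs : Sd n (fun i => Us y' y'' ((i:ℝ)/n)) i = Real.sqrt (1 + y' r^2) := (Vf_Us hy.2.2.2.1 (xg_nonneg n i)).1
  rw [Fd, Gof, hs, ← hHh, ← sub_mul, add_sub_add_right_eq_sub, g3, abs_mul, abs_mul, abs_of_nonneg (by linarith : 0 ≤ a)]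
  have hSr := hS r hrI
  rw [Real.norm_eq_abs] at hSr
  calc a * |Hh - Hof N y' y'' r| * |Real.sqrt (1 + y' r^2)| ≤ (a1+1) * (ε / ((a1+1) * (S+1))) * (S+1) := by
        apply mul_le_mul _ (by linarith) (abs_nonneg _)
        · have : 0 < a1 + 1 := by linarith
          positivity
        · exact mul_le_mul (by linarith) e3 (abs_nonneg _) (by linarith)
    _ = ε := by
        have : a1 + 1 ≠ 0 := by linarith
        have : S + 1 ≠ 0 := by linarith
        field_simp

lemma sample_inv (N : ℕ) {α b k m M P ε : ℝ} (hα : 0 < α) {y y' y'' : ℝ → ℝ} (hy : IsC2Data k y y' y'')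
    (hH : ∀ r ∈ Icc (0:ℝ) 1, 0 < Hof N y' y'' r) (hε : 0 < ε)
    (hG : ∀ r ∈ Icc (0:ℝ) 1, m + ε ≤ Gof N α b y' y'' r ∧ Gof N α b y' y'' r ≤ M - ε)
    (hP : ∀ r ∈ Icc (0:ℝ) 1, |y' r| ≤ P) :
    ∃ n0 : ℕ, ∀ n ≥ n0, Inv N α b n m M P (fun i => Us y' y'' ((i:ℝ)/n)) := by
  obtain ⟨n0, hn0⟩ := data_Fd N (b := b) hα hy hH hε
  refine ⟨n0, fun n hn i hi => ?_⟩
  obtain ⟨h1, h2⟩ := hn0 n hn i hi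
  have hrI := sqrt_mem hi
  rw [abs_le] at h2
  have h3 := hG _ hrI
  refine ⟨h1, by linarith, by linarith, ?_⟩
  have hs := (Vf_Us (y'' := y'') hy.2.2.2.1 (xg_nonneg n i)).1
  have := Sf_sq (X := (i:ℝ)/n) (U := Us y' y'' ((i:ℝ)/n)) (xg_nonneg n i)
  rw [hs, Real.sq_sqrt (by positivity)] at this
  have e : 4 * ((i:ℝ)/n) * (Us y' y'' ((i:ℝ)/n))^2 = |y' (Real.sqrt ((i:ℝ)/n))|^2 := by rw [sq_abs]; linarith
  simp only
  rw [e]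
  exact pow_le_pow_left₀ (abs_nonneg _) (hP _ hrI) 2

end RF

namespace RF

lemma two_iter {ν l L C : ℝ} {n : ℕ} {τ Q K κ' : ℝ} {Z : ℕ → ℕ → ℝ} {ψ : ℕ → ℕ → ℝ}
    (hν : 0 < ν) (hl : 0 < l) (hC : 0 ≤ C) (hQ : 0 ≤ Q) (hK : 0 ≤ K) (hκ : 0 ≤ κ')
    (hcfl : CFL ν L C n τ)
    (h : ∀ j, LinStep ν l L C n τ 0 (Z j) (Z (j+1)))
    (hdiag : ∀ i ≤ n, τ * κ' ≤ ψ i i)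
    (hmono : ∀ i j, j < i → i ≤ n → ψ i j ≤ ψ (i+1) j)
    (hψ : ∀ i j, j < i → i ≤ n → ∀ a b a' b', LinCoef ν l L C n i a b → LinCoef ν l L C n j a' b' →
      n * (a * (ψ (i+1) j - ψ i j) - b * (ψ i j - ψ (i-1) j)
        + a' * (ψ i (j+1) - ψ i j) - b' * (ψ i j - ψ i (j-1))) ≤ -κ')
    (hZ : ∀ i j, j ≤ i → i ≤ n → Z 0 i - Z 0 j ≤ Q + K * ψ i j) :
    ∀ s, ∀ i j, j ≤ i → i ≤ n → Z s i - Z s j ≤ Q + K * ψ i j := by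
  intro s
  induction s with
  | zero => exact hZ
  | succ s ih =>
    intro i j hji hi
    have h1 := LinStep.two hν hl hC hQ hK le_rfl hcfl (h s) hdiag hmono hψ ih i j hji hi
    have h2 : 0 ≤ K * (τ * κ') := mul_nonneg hK (mul_nonneg hcfl.1.le hκ)
    have e : K * (ψ i j - τ * κ') = K * ψ i j - K * (τ * κ') := by ring
    linarith

lemma tau_le {κ c : ℝ} (hc : 0 < c) (hκ : 0 ≤ κ) : ∃ n0 : ℕ, ∀ n : ℕ, n ≥ n0 → 1 / (n:ℝ)^4 * κ ≤ c := by
  obtain ⟨n0, h0⟩ := eventually_atTop.1 (ev_lin hc κ)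
  refine ⟨max n0 1, fun n hn => ?_⟩
  have hn1 : (1:ℝ) ≤ n := by exact_mod_cast (le_max_right _ _).trans hn
  have h1 := h0 n ((le_max_left _ _).trans hn)
  have h4 : (n:ℝ) ≤ (n:ℝ)^4 := by
    calc (n:ℝ) = (n:ℝ)^1 := (pow_one _).symm
      _ ≤ _ := pow_le_pow_right₀ hn1 (by norm_num)
  rw [div_mul_eq_mul_div, one_mul, div_le_iff₀ (by positivity)]
  exact h1.trans (mul_le_mul_of_nonneg_left h4 hc.le)

lemma space_eq {ν l L C : ℝ} (hν : 0 < ν) (hl : 0 < l) (hlL : l ≤ L) (hC : 0 < C)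
    {Z : ℕ → ℕ → ℕ → ℝ} {n1 : ℕ}
    (hcfl : ∀ n ≥ n1, CFL ν L C n (1/(n:ℝ)^4))
    (hst : ∀ n ≥ n1, ∀ j, LinStep ν l L C n (1/(n:ℝ)^4) 0 (Z n j) (Z n (j+1)))
    (h0 : ∀ ε > 0, ∃ K, 0 ≤ K ∧ ∃ n0 : ℕ, ∀ n ≥ n0, ∀ i ≤ n, ∀ j ≤ n,
      |Z n 0 i - Z n 0 j| ≤ ε + K * |(i:ℝ)/n - (j:ℝ)/n|) :
    ∀ ε > 0, ∃ δ > 0, ∃ n0 : ℕ, ∀ n ≥ n0, ∀ s, ∀ i ≤ n, ∀ j ≤ n,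
      |(i:ℝ)/n - (j:ℝ)/n| ≤ δ → |Z n s i - Z n s j| ≤ ε := by
  intro ε hε
  obtain ⟨A, γ, κ', hA, hγ, hκ, hpsi⟩ := psi_exists hν hl hlL hC
  obtain ⟨K, hK, n2, h0⟩ := h0 (ε/2) (by linarith)
  -- choose η
  have hlim : Tendsto (fun η : ℝ => 2 * K * (A * η ^ γ)) (𝓝[>] 0) (𝓝 0) := by
    have : Tendsto (fun η : ℝ => 2 * K * (A * η ^ γ)) (𝓝 0) (𝓝 (2 * K * (A * (0:ℝ) ^ γ))) :=
      ((Real.continuousAt_rpow_const 0 γ (Or.inr hγ.le)).tendsto.const_mul A).const_mul (2*K)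
    rw [Real.zero_rpow hγ.ne', mul_zero, mul_zero] at this
    exact this.mono_left nhdsWithin_le_nhds
  have hev : ∀ᶠ η in 𝓝[>] (0:ℝ), 2 * K * (A * η ^ γ) ≤ ε/2 ∧ η ∈ Ioc (0:ℝ) 1 :=
    (hlim.eventually (Iic_mem_nhds (by linarith))).and (Ioc_mem_nhdsGT one_pos)
  obtain ⟨η, hη, hη0, hη1⟩ := hev.exists
  obtain ⟨ψ, hψb, n3, hn3, hψ⟩ := hpsi η hη0 hη1
  obtain ⟨n4, h4⟩ := tau_le (half_pos hη0) hκ.le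
  refine ⟨η, hη0, max (max n1 n2) (max n3 n4), fun n hn s => ?_⟩
  have hn1 : n ≥ n1 := ((le_max_left _ _).trans (le_max_left _ _)).trans hn
  have hn2 : n ≥ n2 := ((le_max_right _ _).trans (le_max_left _ _)).trans hn
  have hn3' : n ≥ n3 := ((le_max_left _ _).trans (le_max_right _ _)).trans hn
  have hn4 : n ≥ n4 := ((le_max_right _ _).trans (le_max_right _ _)).trans hn
  have hn0 : (0:ℝ) < n := by exact_mod_cast lt_of_lt_of_le hn3 hn3'
  have hX : ∀ i ≤ n, (i:ℝ)/n ≤ 1 := fun i hi => xg_le_one hi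
  have hXX : ∀ i j : ℕ, j ≤ i → (j:ℝ)/n ≤ (i:ℝ)/n := fun i j h => by
    apply div_le_div_of_nonneg_right _ hn0.le; exact_mod_cast h
  have hdiag : ∀ i ≤ n, 1/(n:ℝ)^4 * κ' ≤ ψ ((i:ℝ)/n) ((i:ℝ)/n) := fun i hi => by
    have := (hψb _ _ (xg_nonneg n i) le_rfl (hX i hi)).1
    have := h4 n hn4
    linarith
  have key : ∀ Y : ℕ → ℕ → ℝ, (∀ j, LinStep ν l L C n (1/(n:ℝ)^4) 0 (Y j) (Y (j+1))) →
      (∀ i ≤ n, ∀ j ≤ n, |Y 0 i - Y 0 j| ≤ ε/2 + K * |(i:ℝ)/n - (j:ℝ)/n|) →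
      ∀ i j, j ≤ i → i ≤ n → (i:ℝ)/n - (j:ℝ)/n ≤ η → Y s i - Y s j ≤ ε := by
    intro Y hY hY0 i j hji hi hd
    have h := two_iter (ψ := fun i j => ψ ((i:ℝ)/n) ((j:ℝ)/n)) (Q := ε/2) (K := 2*K) hν hl hC.le
      (by linarith) (by linarith) hκ.le (hcfl n hn1) hY hdiag (hψ n hn3').1 (hψ n hn3').2 ?_ s i j hji hi
    · have h2 := (hψb _ _ (xg_nonneg n j) (hXX i j hji) (hX i hi)).2.2 hd
      have h3 := mul_le_mul_of_nonneg_left h2 (by linarith : 0 ≤ 2*K)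
      linarith
    · intro i j hji hi
      have h1 := hY0 i hi j (hji.trans hi)
      have h2 := (hψb _ _ (xg_nonneg n j) (hXX i j hji) (hX i hi)).1
      rw [abs_of_nonneg (sub_nonneg.2 (hXX i j hji))] at h1
      have h3 := mul_le_mul_of_nonneg_left (show (i:ℝ)/n - (j:ℝ)/n ≤ 2 * ψ ((i:ℝ)/n) ((j:ℝ)/n) by linarith) hK
      have h4 := le_abs_self (Y 0 i - Y 0 j)
      linarith
  have k1 := key (Z n) (hst n hn1) (h0 n hn2)
  have k2 := key (fun s i => - Z n s i) (fun j => (hst n hn1 j).neg) (fun i hi j hj => by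
    have := h0 n hn2 i hi j hj
    rwa [show - Z n 0 i - - Z n 0 j = -(Z n 0 i - Z n 0 j) by ring, abs_neg])
  intro i hi j hj hd
  rw [abs_le] at hd ⊢
  rcases le_total j i with h | h
  · have a1 := k1 i j h hi hd.2
    have a2 := k2 i j h hi hd.2
    constructor <;> linarith
  · have a1 := k1 j i h hj (by linarith)
    have a2 := k2 j i h hj (by linarith)
    constructor <;> linarith

lemma time_eq {ν l L C B : ℝ} (hν : 0 < ν) (hl : 0 < l) (hlL : l ≤ L) (hC : 0 < C)
    {Z : ℕ → ℕ → ℕ → ℝ} {n1 : ℕ}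
    (hcfl : ∀ n ≥ n1, 0 < n ∧ CFL ν L C n (1/(n:ℝ)^4))
    (hst : ∀ n ≥ n1, ∀ j, LinStep ν l L C n (1/(n:ℝ)^4) 0 (Z n j) (Z n (j+1)))
    (hB : 0 ≤ B) (hbd : ∀ n ≥ n1, ∀ j, ∀ i ≤ n, |Z n j i| ≤ B)
    (hse : ∀ ε > 0, ∃ δ > 0, ∃ n0 : ℕ, ∀ n ≥ n0, ∀ s, ∀ i ≤ n, ∀ j ≤ n,
      |(i:ℝ)/n - (j:ℝ)/n| ≤ δ → |Z n s i - Z n s j| ≤ ε) :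
    ∀ ε > 0, ∃ K, 0 ≤ K ∧ ∃ n0 : ℕ, ∀ n ≥ n0, ∀ s q, ∀ i ≤ n,
      |Z n (s+q) i - Z n s i| ≤ ε + K * (q * (1/(n:ℝ)^4)) := by
  intro ε hε
  obtain ⟨δ, hδ, n0, h0⟩ := hse ε hε
  have hK : 0 ≤ 2 * B / δ^2 := by positivity
  set K := 2 * B / δ^2 with hKd
  have hL : 0 < L := hl.trans_le hlL
  refine ⟨K * (6 * ν * L + 6 * C + 8 * L), by positivity, max n0 n1, fun n hn s q p hp => ?_⟩
  obtain ⟨hn0, hc⟩ := hcfl n ((le_max_right _ _).trans hn)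
  have h0 := h0 n ((le_max_left _ _).trans hn)
  have hst := hst n ((le_max_right _ _).trans hn)
  have hbd := hbd n ((le_max_right _ _).trans hn)
  have key : ∀ Y : ℕ → ℕ → ℝ, (∀ j, LinStep ν l L C n (1/(n:ℝ)^4) 0 (Y j) (Y (j+1))) →
      (∀ i ≤ n, |Y s i| ≤ B) → (∀ i ≤ n, |(i:ℝ)/n - (p:ℝ)/n| ≤ δ → |Y s i - Y s p| ≤ ε) →
      Y (s+q) p ≤ Y s p + ε + K * (6 * ν * L + 6 * C + 8 * L) * (q * (1/(n:ℝ)^4)) := by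
    intro Y hY hb hd
    have h : ∀ q : ℕ, ∀ i ≤ n, Y (s+q) i ≤ (Y s p + ε + K * (6 * ν * L + 6 * C + 8 * L) * (q * (1/(n:ℝ)^4)))
        + K * ((i:ℝ)/n - (p:ℝ)/n)^2 := by
      intro q
      induction q with
      | zero =>
        intro i hi
        simp only [add_zero, Nat.cast_zero, zero_mul, mul_zero]
        by_cases hc : |(i:ℝ)/n - (p:ℝ)/n| ≤ δ
        · have h1 := (abs_le.1 (hd i hi hc)).2
          have h2 : 0 ≤ K * ((i:ℝ)/n - (p:ℝ)/n)^2 := by positivity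
          linarith
        · push Not at hc
          have h1 := (abs_le.1 (hb i hi)).2
          have h2 := (abs_le.1 (hb p hp)).1
          have h3 : δ^2 ≤ ((i:ℝ)/n - (p:ℝ)/n)^2 := by
            rw [← sq_abs ((i:ℝ)/n - (p:ℝ)/n)]
            exact pow_le_pow_left₀ hδ.le hc.le 2
          have h4 := mul_le_mul_of_nonneg_left h3 hK
          have h5 : K * δ^2 = 2 * B := by rw [hKd]; field_simp
          linarith
      | succ q ih =>
        intro i hi
        have := LinStep.quad hn0 hν hl hlL hC.le hK hp hc (hY (s+q)) ih i hi
        rw [← add_assoc]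
        refine this.trans (le_of_eq ?_)
        push_cast; ring
    have := h q p hp
    simpa using this
  have k1 := key (Z n) hst (hbd s) (fun i hi => h0 s i hi p hp)
  have k2 := key (fun s i => - Z n s i) (fun j => (hst j).neg) (fun i hi => by rw [abs_neg]; exact hbd s i hi)
    (fun i hi h => by
      have := h0 s i hi p hp h
      rwa [show - Z n s i - - Z n s p = -(Z n s i - Z n s p) by ring, abs_neg])
  rw [abs_le]; constructor <;> linarith

end RF

namespace RF

lemma near0 {ν α b H1 H2 S B M : ℝ} (hν : 0 < ν) (hα : 0 < α) (hH1 : 0 < H1) (hH : H1 ≤ H2) (hS : 1 ≤ S)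
    (hM : 0 ≤ M) :
    ∃ K, 0 < K ∧ ∀ (n : ℕ) (U : ℕ → ℝ), Adm ν n H1 H2 S U → (∀ i ≤ n, U i ≤ B) →
      (∀ i ≤ n, |Fd ν α b n U i| ≤ M) →
      ∀ p ≤ n, ∀ ρ, 0 ≤ ρ → (∀ i ≤ p, |Fd ν α b n U i - Fd ν α b n U 0| ≤ ρ) →
        |U p - U 0| ≤ K * (ρ + (p:ℝ)/n) := by
  obtain ⟨a0, a1, ha0, ha01, hdd⟩ := pow_dd hα hH1 hH
  have hH2 : 0 < H2 := hH1.trans_le hH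
  refine ⟨S / (ν * a0) * (1 + 4 * M * B^2) + 2 * H2 * B^2 / ν, by positivity, ?_⟩
  intro n U hA hB hF p hp ρ hρ hFd
  have hX : 0 ≤ (p:ℝ)/n := xg_nonneg n p
  set X := (p:ℝ)/n with hXd
  have hS0 : Sd n U 0 = 1 := by unfold Sd Sf; simp
  have hSi : ∀ i ≤ p, 1 ≤ Sd n U i ∧ Sd n U i - 1 ≤ 4 * X * B^2 := by
    intro i hi
    have h1 : 1 ≤ Sd n U i := Sf_ge_one (xg_nonneg n i)
    refine ⟨h1, ?_⟩
    have h2 : Sd n U i ^ 2 = 1 + 4 * ((i:ℝ)/n) * U i ^ 2 := Sf_sq (xg_nonneg n i)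
    have h3 : (i:ℝ)/n ≤ X := div_le_div_of_nonneg_right (by exact_mod_cast hi) (by positivity)
    have h4 : U i ^ 2 ≤ B^2 := pow_le_pow_left₀ (hA i (hi.trans hp)).1.le (hB i (hi.trans hp)) 2
    have h5 : ((i:ℝ)/n) * U i ^ 2 ≤ X * B^2 := mul_le_mul h3 h4 (sq_nonneg _) hX
    nlinarith
  have hHi : ∀ i ≤ p, |Hd ν n U i - Hd ν n U 0| ≤ (ρ + 4 * M * B^2 * X) / a0 := by
    intro i hi
    obtain ⟨s1, s2⟩ := hSi i hi
    have sp : 0 < Sd n U i := by linarith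
    have e1 : Hd ν n U i ^ α + b = Fd ν α b n U i / Sd n U i := by unfold Fd; field_simp
    have e0 : Hd ν n U 0 ^ α + b = Fd ν α b n U 0 := by unfold Fd; rw [hS0, mul_one]
    have hAi := hA i (hi.trans hp)
    have hA0 := hA 0 (Nat.zero_le _)
    obtain ⟨a, ha, -, hae⟩ := hdd (Hd ν n U 0) ⟨hA0.2.1, hA0.2.2.1⟩ (Hd ν n U i) ⟨hAi.2.1, hAi.2.2.1⟩
    have h1 : |a * (Hd ν n U i - Hd ν n U 0)| ≤ ρ + 4 * M * B^2 * X := by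
      have e : a * (Hd ν n U i - Hd ν n U 0) = (Fd ν α b n U i - Fd ν α b n U 0)
          - Fd ν α b n U i * ((Sd n U i - 1) / Sd n U i) := by
        rw [← hae]
        have : Hd ν n U i ^ α - Hd ν n U 0 ^ α = Fd ν α b n U i / Sd n U i - Fd ν α b n U 0 := by linarith
        rw [this]; field_simp; ring
      rw [e]
      have h2 : |Fd ν α b n U i * ((Sd n U i - 1) / Sd n U i)| ≤ M * (4 * X * B^2) := by
        rw [abs_mul, abs_of_nonneg (div_nonneg (by linarith) sp.le : 0 ≤ (Sd n U i - 1) / Sd n U i)]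
        apply mul_le_mul (hF i (hi.trans hp)) _ (div_nonneg (by linarith) sp.le) hM
        exact (div_le_self (by linarith) s1).trans s2
      have := abs_sub (Fd ν α b n U i - Fd ν α b n U 0) (Fd ν α b n U i * ((Sd n U i - 1) / Sd n U i))
      have := hFd i hi
      linarith
    rw [abs_mul, abs_of_nonneg (ha0.le.trans ha)] at h1
    rw [le_div_iff₀ ha0, mul_comm]
    exact (mul_le_mul_of_nonneg_right ha (abs_nonneg _)).trans h1
  set ε2 := (ρ + 4 * M * B^2 * X) / a0 with hε2
  have hV := Vd_bounds (A := Hd ν n U 0 - ε2) (B := Hd ν n U 0 + ε2) hν (n := n) (m := p) (U := U)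
    (fun i hi => by have := abs_le.1 (hHi i hi); constructor <;> linarith)
  have hVp := hV p le_rfl
  have hV0 := hV 0 (Nat.zero_le _)
  have hVd : |Vd n U p - Vd n U 0| ≤ 2 * ε2 / ν := by
    have : (Hd ν n U 0 + ε2)/ν - (Hd ν n U 0 - ε2)/ν = 2 * ε2 / ν := by ring
    rw [abs_le]; constructor <;> linarith
  have hV0' : Vd n U 0 ≤ H2 / ν := (Vd_bounds (A := H1) (B := H2) hν (n := n) (m := n) (U := U)
    (fun i hi => ⟨(hA i hi).2.1, (hA i hi).2.2.1⟩) 0 (Nat.zero_le _)).2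
  have hV0p : 0 < Vd n U 0 := Vd_pos (hA 0 (Nat.zero_le _)).1
  obtain ⟨s1, s2⟩ := hSi p le_rfl
  have hSS := (hA p hp).2.2.2
  have e : U p - U 0 = ((Vd n U p - Vd n U 0) * Sd n U p + Vd n U 0 * (Sd n U p - 1)) / 2 := by
    rw [U_eq (U := U) (n := n) (i := p), U_eq (U := U) (n := n) (i := 0), hS0]; ring
  have h1 : |(Vd n U p - Vd n U 0) * Sd n U p| ≤ 2 * ε2 / ν * S := by
    rw [abs_mul, abs_of_nonneg (by linarith : 0 ≤ Sd n U p)]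
    exact mul_le_mul hVd hSS (by linarith) ((abs_nonneg _).trans hVd)
  have h2 : |Vd n U 0 * (Sd n U p - 1)| ≤ H2 / ν * (4 * X * B^2) := by
    rw [abs_of_nonneg (mul_nonneg hV0p.le (by linarith))]
    exact mul_le_mul hV0' s2 (by linarith) (by positivity)
  have h3 : |U p - U 0| ≤ (2 * ε2 / ν * S + H2 / ν * (4 * X * B^2)) / 2 := by
    rw [e, abs_div, abs_two]
    have := abs_add_le ((Vd n U p - Vd n U 0) * Sd n U p) (Vd n U 0 * (Sd n U p - 1))
    linarith
  refine h3.trans ?_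
  have e3 : (2 * ε2 / ν * S + H2 / ν * (4 * X * B^2)) / 2 =
      S / (ν * a0) * (ρ + 4 * M * B^2 * X) + 2 * H2 * B^2 / ν * X := by
    rw [hε2]; field_simp; ring
  rw [e3]
  have h5 : ρ + 4 * M * B^2 * X ≤ (1 + 4 * M * B^2) * (ρ + X) := by
    have : 0 ≤ 4 * M * B^2 * ρ := by positivity
    linarith
  have h6 := mul_le_mul_of_nonneg_left h5 (by positivity : 0 ≤ S / (ν * a0))
  have h7 := mul_le_mul_of_nonneg_left (by linarith : X ≤ ρ + X) (by positivity : 0 ≤ 2 * H2 * B^2 / ν)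
  linarith

/-- telescoping away from the origin -/
lemma away0 {B δ0 δ : ℝ} {n : ℕ} {U : ℕ → ℝ} (hB : 0 < B) (hn : 0 < n) (hδ0 : 0 < δ0)
    (hU : ∀ i ≤ n, (i:ℝ) * |U i - U (i-1)| ≤ B) {i j : ℕ} (hji : j ≤ i) (hi : i ≤ n)
    (hj : δ0 ≤ (j:ℝ)/n) (hd : (i:ℝ)/n - (j:ℝ)/n ≤ δ) : |U i - U j| ≤ B / δ0 * δ := by
  have hn0 : (0:ℝ) < n := by exact_mod_cast hn
  have hj' : δ0 * n ≤ j := by rwa [le_div_iff₀ hn0] at hj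
  have key : ∀ s, j + s ≤ n → |U (j+s) - U j| ≤ B / (δ0 * n) * s := by
    intro s
    induction s with
    | zero => intro _; simp
    | succ s ih =>
      intro hs
      have h1 := ih (by omega)
      have h2 := hU (j+(s+1)) hs
      have e : j + (s+1) - 1 = j + s := by omega
      rw [e] at h2
      have h3 : δ0 * n ≤ ((j+(s+1):ℕ):ℝ) := by push_cast; linarith [(Nat.cast_nonneg s : (0:ℝ) ≤ s)]
      have h4 : |U (j+(s+1)) - U (j+s)| ≤ B / (δ0 * n) := by
        rw [le_div_iff₀ (by positivity), mul_comm]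
        exact (mul_le_mul_of_nonneg_right h3 (abs_nonneg _)).trans h2
      have h5 := abs_add_le (U (j+(s+1)) - U (j+s)) (U (j+s) - U j)
      rw [sub_add_sub_cancel] at h5
      push_cast
      linarith
  obtain ⟨s, rfl⟩ := Nat.exists_eq_add_of_le hji
  refine (key s hi).trans ?_
  have h1 : (s:ℝ) ≤ δ * n := by
    rw [← sub_div, div_le_iff₀ hn0] at hd
    push_cast at hd; linarith
  calc B / (δ0 * n) * s ≤ B / (δ0 * n) * (δ * n) := mul_le_mul_of_nonneg_left h1 (by positivity)
    _ = B / δ0 * δ := by field_simp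

/-- spatial equicontinuity of `U` from that of `G` -/
lemma U_se {ν α b H1 H2 S M : ℝ} (hν : 0 < ν) (hα : 0 < α) (hH1 : 0 < H1) (hH : H1 ≤ H2) (hS : 1 ≤ S)
    (hM : 0 ≤ M) {U : ℕ → ℕ → ℕ → ℝ} {n1 : ℕ} (hn1 : ∀ n ≥ n1, 0 < n)
    (hA : ∀ n ≥ n1, ∀ s, Adm ν n H1 H2 S (U n s))
    (hF : ∀ n ≥ n1, ∀ s, ∀ i ≤ n, |Fd ν α b n (U n s) i| ≤ M)
    (hse : ∀ ε > 0, ∃ δ > 0, ∃ n0 : ℕ, ∀ n ≥ n0, ∀ s, ∀ i ≤ n, ∀ j ≤ n,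
      |(i:ℝ)/n - (j:ℝ)/n| ≤ δ → |Fd ν α b n (U n s) i - Fd ν α b n (U n s) j| ≤ ε) :
    ∀ ε > 0, ∃ δ > 0, ∃ n0 : ℕ, ∀ n ≥ n0, ∀ s, ∀ i ≤ n, ∀ j ≤ n,
      |(i:ℝ)/n - (j:ℝ)/n| ≤ δ → |U n s i - U n s j| ≤ ε := by
  intro ε hε
  obtain ⟨B, hB, hBd⟩ := adm_bounds hν hH1 hH hS
  obtain ⟨K, hK, hnear⟩ := near0 (b := b) (B := B) hν hα hH1 hH hS hM
  obtain ⟨δ1, hδ1, n2, h2⟩ := hse (ε/(4*K)) (by positivity)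
  set δ0 := min δ1 (ε/(4*K)) with hδ0d
  have hδ0 : 0 < δ0 := lt_min hδ1 (by positivity)
  have hn : ∀ n ≥ max n1 n2, ∀ s, ∀ i ≤ n, (i:ℝ)/n ≤ δ0 → |U n s i - U n s 0| ≤ ε/2 := by
    intro n hn s p hp hpd
    have hn1' : n ≥ n1 := (le_max_left _ _).trans hn
    have h := hnear n (U n s) (hA n hn1' s) (fun i hi => (hBd n _ (hA n hn1' s) i hi).1) (hF n hn1' s) p hp
      (ε/(4*K)) (by positivity) (fun i hi => by
        apply h2 n ((le_max_right _ _).trans hn) s i (hi.trans hp) 0 (Nat.zero_le _)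
        rw [Nat.cast_zero, zero_div, sub_zero, abs_of_nonneg (xg_nonneg n i)]
        exact (div_le_div_of_nonneg_right (by exact_mod_cast hi) (by positivity)).trans
          (hpd.trans (min_le_left _ _)))
    have h3 : (p:ℝ)/n ≤ ε/(4*K) := hpd.trans (min_le_right _ _)
    have h4 := mul_le_mul_of_nonneg_left (add_le_add_right h3 (ε/(4*K))) hK.le
    have e : K * (ε/(4*K) + ε/(4*K)) = ε/2 := by field_simp; ring
    linarith
  refine ⟨min (δ0/2) (ε*δ0/(2*B)), by positivity, max n1 n2, fun n hnn s => ?_⟩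
  have hn1' : n ≥ n1 := (le_max_left _ _).trans hnn
  have main : ∀ i j, j ≤ i → i ≤ n → (i:ℝ)/n - (j:ℝ)/n ≤ min (δ0/2) (ε*δ0/(2*B)) →
      |U n s i - U n s j| ≤ ε := by
    intro i j hji hi hd
    have hd1 := hd.trans (min_le_left _ _)
    have hd2 := hd.trans (min_le_right _ _)
    by_cases hc : (i:ℝ)/n ≤ δ0
    · have hc' : (j:ℝ)/n ≤ δ0 := (div_le_div_of_nonneg_right (by exact_mod_cast hji) (by positivity)).trans hc
      have a1 := abs_le.1 (hn n hnn s i hi hc)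
      have a2 := abs_le.1 (hn n hnn s j (hji.trans hi) hc')
      rw [abs_le]; constructor <;> linarith
    · push Not at hc
      have h := away0 (δ0 := δ0/2) hB (hn1 n hn1') (by linarith)
        (fun i hi => (hBd n _ (hA n hn1' s) i hi).2.1) hji hi (by linarith) hd2
      refine h.trans (le_of_eq ?_)
      field_simp
  intro i hi j hj hd
  rcases le_total j i with h | h
  · exact main i j h hi ((le_abs_self _).trans hd)
  · rw [abs_sub_comm] at hd ⊢
    exact main j i h hj ((le_abs_self _).trans hd)

end RF

namespace RF

/-- joint space-time equicontinuity -/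
def EC (Q : ℕ → ℕ → ℕ → ℝ) : Prop :=
  ∀ ε > 0, ∃ δ > 0, ∃ n0 : ℕ, ∀ n ≥ n0, ∀ s s' : ℕ, ∀ i ≤ n, ∀ i' ≤ n,
    |(i:ℝ)/n - (i':ℝ)/n| ≤ δ → |(s:ℝ) * (1/(n:ℝ)^4) - (s':ℝ) * (1/(n:ℝ)^4)| ≤ δ →
    |Q n s i - Q n s' i'| ≤ ε

lemma EC_of {Q : ℕ → ℕ → ℕ → ℝ}
    (hse : ∀ ε > 0, ∃ δ > 0, ∃ n0 : ℕ, ∀ n ≥ n0, ∀ s, ∀ i ≤ n, ∀ j ≤ n,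
      |(i:ℝ)/n - (j:ℝ)/n| ≤ δ → |Q n s i - Q n s j| ≤ ε)
    (hte : ∀ ε > 0, ∃ K, 0 ≤ K ∧ ∃ n0 : ℕ, ∀ n ≥ n0, ∀ s q : ℕ, ∀ i ≤ n,
      |Q n (s+q) i - Q n s i| ≤ ε + K * (q * (1/(n:ℝ)^4))) : EC Q := by
  intro ε hε
  obtain ⟨δ1, hδ1, n1, h1⟩ := hse (ε/3) (by linarith)
  obtain ⟨K, hK, n2, h2⟩ := hte (ε/3) (by linarith)
  refine ⟨min δ1 (ε/(3*(K+1))), by positivity, max n1 n2, fun n hn s s' i hi i' hi' hd ht => ?_⟩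
  have h1 := h1 n ((le_max_left _ _).trans hn)
  have h2 := h2 n ((le_max_right _ _).trans hn)
  have ht' : ∀ s q : ℕ, |((s+q:ℕ):ℝ) * (1/(n:ℝ)^4) - (s:ℝ) * (1/(n:ℝ)^4)| ≤ min δ1 (ε/(3*(K+1))) →
      ∀ i ≤ n, |Q n (s+q) i - Q n s i| ≤ 2*ε/3 := by
    intro s q ht i hi
    have e : ((s+q:ℕ):ℝ) * (1/(n:ℝ)^4) - (s:ℝ) * (1/(n:ℝ)^4) = q * (1/(n:ℝ)^4) := by push_cast; ring
    rw [e] at ht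
    have h3 : q * (1/(n:ℝ)^4) ≤ ε/(3*(K+1)) := (le_abs_self _).trans (ht.trans (min_le_right _ _))
    have h4 : (K+1) * (q * (1/(n:ℝ)^4)) ≤ ε/3 := by
      have := mul_le_mul_of_nonneg_left h3 (by linarith : 0 ≤ K+1)
      have e : (K+1) * (ε/(3*(K+1))) = ε/3 := by field_simp
      linarith
    have h5 : 0 ≤ q * (1/(n:ℝ)^4) := by positivity
    have := h2 s q i hi
    linarith
  have hx : |Q n s i - Q n s i'| ≤ ε/3 := h1 s i hi i' hi' (hd.trans (min_le_left _ _))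
  have htt : |Q n s i' - Q n s' i'| ≤ 2*ε/3 := by
    rcases le_total s' s with h | h
    · obtain ⟨q, rfl⟩ := Nat.exists_eq_add_of_le h
      exact ht' s' q ht i' hi'
    · obtain ⟨q, rfl⟩ := Nat.exists_eq_add_of_le h
      rw [abs_sub_comm] at ht ⊢
      exact ht' s q ht i' hi'
  have := abs_sub_le (Q n s i) (Q n s i') (Q n s' i')
  linarith

/-- telescoping sum for a slope estimate -/
lemma slope_block {n : ℕ} {u U : ℕ → ℝ} {c ε : ℝ} (p : ℕ) (hn : 0 < n) :
    ∀ d : ℕ, (∀ m, p ≤ m → m < p + d → U m = n * (u (m+1) - u m)) →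
      (∀ m, p ≤ m → m < p + d → |U m - c| ≤ ε) →
      |n * (u (p+d) - u p) - d * c| ≤ d * ε := by
  intro d
  induction d with
  | zero => intro _ _; simp
  | succ d ih =>
    intro h1 h2
    have a := ih (fun m h h' => h1 m h (by omega)) (fun m h h' => h2 m h (by omega))
    have b1 := h1 (p+d) (by omega) (by omega)
    have b2 := h2 (p+d) (by omega) (by omega)
    rw [b1] at b2
    have e : n * (u (p+(d+1)) - u p) - ((d+1:ℕ):ℝ) * c = (n * (u (p+d) - u p) - d * c)
        + (n * (u (p+d+1) - u (p+d)) - c) := by push_cast; rw [← add_assoc]; ring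
    rw [e]
    push_cast
    have := abs_add_le (n * (u (p+d) - u p) - d * c) (n * (u (p+d+1) - u (p+d)) - c)
    linarith

lemma U_te {k M : ℝ} (hM : 0 ≤ M) {u : ℕ → ℕ → ℕ → ℝ} {n1 : ℕ}
    (hu : ∀ n ≥ n1, ∀ s q : ℕ, ∀ i ≤ n, |u n (s+q) i - u n s i| ≤ M * (q * (1/(n:ℝ)^4)))
    (hse : ∀ ε > 0, ∃ δ > 0, ∃ n0 : ℕ, ∀ n ≥ n0, ∀ s, ∀ i ≤ n, ∀ j ≤ n,
      |(i:ℝ)/n - (j:ℝ)/n| ≤ δ → |Ud k n (u n s) i - Ud k n (u n s) j| ≤ ε) :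
    ∀ ε > 0, ∃ K, 0 ≤ K ∧ ∃ n0 : ℕ, ∀ n ≥ n0, ∀ s q : ℕ, ∀ i ≤ n,
      |Ud k n (u n (s+q)) i - Ud k n (u n s) i| ≤ ε + K * (q * (1/(n:ℝ)^4)) := by
  intro ε hε
  obtain ⟨δ', hδ', n2, h2⟩ := hse (ε/2) (by linarith)
  set δ := min δ' (1/2) with hδd
  have hδ : 0 < δ := by positivity
  have hδ1 : δ ≤ 1/2 := min_le_right _ _
  obtain ⟨n3, h3⟩ := eventually_atTop.1 (ev_lin hδ 2)
  refine ⟨4 * M / δ, by positivity, max (max n1 n2) (max n3 1), fun n hn s q i hi => ?_⟩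
  have hu := hu n (((le_max_left _ _).trans (le_max_left _ _)).trans hn)
  have h2 := h2 n (((le_max_right _ _).trans (le_max_left _ _)).trans hn)
  have h3 := h3 n (((le_max_left _ _).trans (le_max_right _ _)).trans hn)
  have hnp : 0 < n := ((le_max_right _ _).trans (le_max_right _ _)).trans hn
  have hn0 : (0:ℝ) < n := by exact_mod_cast hnp
  set d := ⌊δ * n⌋₊ with hd
  have hd1 : (d:ℝ) ≤ δ * n := Nat.floor_le (by positivity)
  have hd2 : δ * n / 2 ≤ d := by
    have := Nat.lt_floor_add_one (δ * n)
    rw [← hd] at this; linarith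
  have hdpos : (0:ℝ) < d := by nlinarith
  have hd3 : 2 * d ≤ n := by
    have : 2 * (d:ℝ) ≤ n := by nlinarith
    exact_mod_cast this
  obtain ⟨p, hp1, hp2, hp3⟩ : ∃ p, p + d ≤ n ∧ p ≤ i ∧ i ≤ p + d := by
    by_cases h : i + d ≤ n
    · exact ⟨i, h, le_rfl, by omega⟩
    · exact ⟨i - d, by omega, by omega, by omega⟩
  have hs : ∀ s, |n * (u n s (p+d) - u n s p) - d * Ud k n (u n s) i| ≤ d * (ε/2) := by
    intro s
    apply slope_block (U := Ud k n (u n s)) p hnp d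
    · intro m hm hm'
      unfold Ud; rw [if_pos (by omega)]
    · intro m hm hm'
      apply h2 s m (by omega) i hi
      have e1 : |(m:ℝ) - i| ≤ d := by
        have a1 : (m:ℝ) ≤ i + d := by exact_mod_cast (by omega : m ≤ i + d)
        have a2 : (i:ℝ) ≤ m + d := by exact_mod_cast (by omega : i ≤ m + d)
        rw [abs_le]; constructor <;> linarith
      rw [← sub_div, abs_div, abs_of_pos hn0, div_le_iff₀ hn0]
      have : δ * n ≤ δ' * n := mul_le_mul_of_nonneg_right (min_le_left _ _) hn0.le
      linarith
  have a1 := abs_le.1 (hs s)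
  have a2 := abs_le.1 (hs (s+q))
  have a3 := abs_le.1 (hu s q (p+d) hp1)
  have a4 := abs_le.1 (hu s q p (by omega))
  set t := (q:ℝ) * (1/(n:ℝ)^4) with ht
  have ht0 : 0 ≤ t := by positivity
  set D := Ud k n (u n (s+q)) i - Ud k n (u n s) i with hD
  have b1 : |(d:ℝ) * D| ≤ d * ε + 2 * n * (M * t) := by
    have c3 := mul_le_mul_of_nonneg_left a3.2 hn0.le
    have c4 := mul_le_mul_of_nonneg_left a4.2 hn0.le
    have c5 := mul_le_mul_of_nonneg_left a3.1 hn0.le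
    have c6 := mul_le_mul_of_nonneg_left a4.1 hn0.le
    rw [hD, abs_le]
    constructor <;> linarith
  rw [abs_mul, abs_of_pos hdpos] at b1
  have b2 : 2 * n * (M * t) ≤ d * (4 * M / δ * t) := by
    have : δ * n / 2 * (4 * M / δ * t) ≤ d * (4 * M / δ * t) := mul_le_mul_of_nonneg_right hd2 (by positivity)
    have e : δ * n / 2 * (4 * M / δ * t) = 2 * n * (M * t) := by field_simp; ring
    linarith
  have b3 : (d:ℝ) * |D| ≤ d * (ε + 4 * M / δ * t) := by linarith
  exact le_of_mul_le_mul_left b3 hdpos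

lemma u_se {k B : ℝ} (hB : 0 ≤ B) {n : ℕ} (hn : 0 < n) {u : ℕ → ℝ}
    (hU : ∀ i ≤ n, |Ud k n u i| ≤ B) : ∀ i ≤ n, ∀ j ≤ n, |u i - u j| ≤ B * |(i:ℝ)/n - (j:ℝ)/n| := by
  have hn0 : (0:ℝ) < n := by exact_mod_cast hn
  have key : ∀ p d : ℕ, p + d ≤ n → |u (p+d) - u p| ≤ B * |((p+d:ℕ):ℝ)/n - (p:ℝ)/n| := by
    intro p d hpd
    have h := slope_block (u := u) (U := Ud k n u) (c := 0) (ε := B) p hn d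
      (fun m _ hm => by unfold Ud; rw [if_pos (by omega)])
      (fun m _ hm => by rw [sub_zero]; exact hU m (by omega))
    rw [mul_zero, sub_zero, abs_mul, abs_of_pos hn0] at h
    have e : ((p+d:ℕ):ℝ)/n - (p:ℝ)/n = d / n := by push_cast; ring
    rw [e, abs_of_nonneg (by positivity : (0:ℝ) ≤ d / n), ← mul_div_assoc, le_div_iff₀ hn0]
    linarith
  intro i hi j hj
  rcases le_total j i with h | h
  · obtain ⟨d, rfl⟩ := Nat.exists_eq_add_of_le h
    exact key j d hi
  · obtain ⟨d, rfl⟩ := Nat.exists_eq_add_of_le h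
    rw [abs_sub_comm, abs_sub_comm (((i:ℕ):ℝ)/n)]
    exact key i d hj

end RF

namespace RF

/-- the filter of grid points converging to `(X, t)` -/
noncomputable def Lf (X t : ℝ) : Filter (ℕ × ℕ × ℕ) :=
  comap (fun z : ℕ × ℕ × ℕ => (z.1, (z.2.1:ℝ) * (1/(z.1:ℝ)^4), (z.2.2:ℝ)/z.1))
    ((hyperfilter ℕ : Filter ℕ) ×ˢ (𝓝 t ×ˢ 𝓝 X)) ⊓ 𝓟 {z | z.2.2 ≤ z.1}

/-- `q` is the limit of the grid functions `Q` -/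
def Lim (Q : ℕ → ℕ → ℕ → ℝ) (q : ℝ → ℝ → ℝ) : Prop :=
  ∀ X ∈ Icc (0:ℝ) 1, ∀ t ∈ Ici (0:ℝ), Tendsto (fun z : ℕ × ℕ × ℕ => Q z.1 z.2.1 z.2.2) (Lf X t) (𝓝 (q X t))

lemma hyper_ge (n0 : ℕ) : ∀ᶠ n in (hyperfilter ℕ : Filter ℕ), n0 ≤ n :=
  (eventually_ge_atTop n0).filter_mono Nat.hyperfilter_le_atTop

lemma tendsto_Lf {ι : Type*} {l : Filter ι} {f : ι → ℕ × ℕ × ℕ} {X t : ℝ}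
    (h1 : Tendsto (fun x => (f x).1) l (hyperfilter ℕ : Filter ℕ))
    (h2 : Tendsto (fun x => ((f x).2.1:ℝ) * (1/((f x).1:ℝ)^4)) l (𝓝 t))
    (h3 : Tendsto (fun x => ((f x).2.2:ℝ)/((f x).1:ℝ)) l (𝓝 X))
    (h4 : ∀ᶠ x in l, (f x).2.2 ≤ (f x).1) : Tendsto f l (Lf X t) := by
  unfold Lf
  refine tendsto_inf.2 ⟨tendsto_comap_iff.2 (h1.prodMk (h2.prodMk h3)), tendsto_principal.2 h4⟩

lemma Lf_n (X t : ℝ) : Tendsto (fun z : ℕ × ℕ × ℕ => z.1) (Lf X t) (hyperfilter ℕ : Filter ℕ) := by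
  unfold Lf
  have h : Tendsto (fun z : ℕ × ℕ × ℕ => (z.1, (z.2.1:ℝ) * (1/(z.1:ℝ)^4), (z.2.2:ℝ)/z.1)) _
    ((hyperfilter ℕ : Filter ℕ) ×ˢ (𝓝 t ×ˢ 𝓝 X)) := tendsto_comap
  exact (tendsto_fst.comp h).mono_left inf_le_left

lemma Lf_t (X t : ℝ) : Tendsto (fun z : ℕ × ℕ × ℕ => (z.2.1:ℝ) * (1/(z.1:ℝ)^4)) (Lf X t) (𝓝 t) := by
  unfold Lf
  exact (tendsto_fst.comp (tendsto_snd.comp tendsto_comap)).mono_left inf_le_left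

lemma Lf_X (X t : ℝ) : Tendsto (fun z : ℕ × ℕ × ℕ => (z.2.2:ℝ)/z.1) (Lf X t) (𝓝 X) := by
  unfold Lf
  exact (tendsto_snd.comp (tendsto_snd.comp tendsto_comap)).mono_left inf_le_left

lemma Lf_le (X t : ℝ) : ∀ᶠ z in Lf X t, z.2.2 ≤ z.1 := by
  unfold Lf
  exact mem_inf_of_right (mem_principal_self _)

lemma Lf_ev (X t : ℝ) (n0 : ℕ) : ∀ᶠ z in Lf X t, n0 ≤ z.1 ∧ z.2.2 ≤ z.1 :=
  ((Lf_n X t).eventually (hyper_ge n0)).and (Lf_le X t)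

lemma hyper_tendsto_cast : Tendsto (fun n : ℕ => (n:ℝ)) (hyperfilter ℕ : Filter ℕ) atTop :=
  tendsto_natCast_atTop_atTop.mono_left Nat.hyperfilter_le_atTop

lemma floor_X {X : ℝ} (hX : 0 ≤ X) :
    Tendsto (fun n : ℕ => ((⌊X * n⌋₊:ℕ):ℝ)/n) (hyperfilter ℕ : Filter ℕ) (𝓝 X) :=
  (tendsto_nat_floor_mul_div_atTop hX).comp hyper_tendsto_cast

lemma floor_t {t : ℝ} (ht : 0 ≤ t) :
    Tendsto (fun n : ℕ => ((⌊t * (n:ℝ)^4⌋₊:ℕ):ℝ) * (1/(n:ℝ)^4)) (hyperfilter ℕ : Filter ℕ) (𝓝 t) := by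
  have h : Tendsto (fun n : ℕ => (n:ℝ)^4) (hyperfilter ℕ : Filter ℕ) atTop :=
    (tendsto_pow_atTop (by norm_num)).comp hyper_tendsto_cast
  have := (tendsto_nat_floor_mul_div_atTop ht).comp h
  refine this.congr (fun n => ?_)
  simp only [Function.comp]
  ring

lemma floor_le {X : ℝ} (hX1 : X ≤ 1) (n : ℕ) : ⌊X * n⌋₊ ≤ n := by
  apply Nat.floor_le_of_le
  have : (0:ℝ) ≤ n := Nat.cast_nonneg n
  nlinarith

lemma tendsto_floor {X t : ℝ} (hX : X ∈ Icc (0:ℝ) 1) (ht : t ∈ Ici (0:ℝ)) :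
    Tendsto (fun n : ℕ => (n, ⌊t * (n:ℝ)^4⌋₊, ⌊X * n⌋₊)) (hyperfilter ℕ : Filter ℕ) (Lf X t) :=
  tendsto_Lf tendsto_id (floor_t ht) (floor_X hX.1) (Eventually.of_forall (floor_le hX.2))

lemma Lf_neBot {X t : ℝ} (hX : X ∈ Icc (0:ℝ) 1) (ht : t ∈ Ici (0:ℝ)) : NeBot (Lf X t) :=
  (tendsto_floor hX ht).neBot

/-- existence of the limit -/
lemma exists_lim {Q : ℕ → ℕ → ℕ → ℝ} (hQ : EC Q) {n1 : ℕ} {B : ℝ → ℝ}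
    (hB : ∀ T, ∀ n ≥ n1, ∀ s : ℕ, (s:ℝ) * (1/(n:ℝ)^4) ≤ T → ∀ i ≤ n, |Q n s i| ≤ B T) :
    ∃ q, Lim Q q := by
  have key : ∀ X t, ∃ y, X ∈ Icc (0:ℝ) 1 → t ∈ Ici (0:ℝ) →
      Tendsto (fun z : ℕ × ℕ × ℕ => Q z.1 z.2.1 z.2.2) (Lf X t) (𝓝 y) := by
    intro X t
    by_cases hXt : X ∈ Icc (0:ℝ) 1 ∧ t ∈ Ici (0:ℝ)
    swap
    · exact ⟨0, fun h1 h2 => absurd ⟨h1, h2⟩ hXt⟩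
    obtain ⟨hX, ht⟩ := hXt
    set f : ℕ → ℝ := fun n => Q n ⌊t * (n:ℝ)^4⌋₊ ⌊X * n⌋₊ with hf
    have hb : ∀ᶠ n in (hyperfilter ℕ : Filter ℕ), f n ∈ Icc (-(B (t+1))) (B (t+1)) := by
      have h1 := (floor_t ht).eventually (Iic_mem_nhds (by linarith : t < t + 1))
      filter_upwards [h1, hyper_ge n1] with n h1 h2
      exact abs_le.1 (hB (t+1) n h2 _ h1 _ (floor_le hX.2 n))
    obtain ⟨y, -, hy⟩ := (isCompact_Icc (a := -(B (t+1))) (b := B (t+1))).ultrafilter_le_nhds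
      ((hyperfilter ℕ).map f) (le_principal_iff.2 hb)
    have hy' : Tendsto f (hyperfilter ℕ : Filter ℕ) (𝓝 y) := hy
    refine ⟨y, fun _ _ => ?_⟩
    rw [Metric.tendsto_nhds]
    intro ε hε
    obtain ⟨δ, hδ, n0, h0⟩ := hQ (ε/2) (by linarith)
    have e1 := (Lf_n X t).eventually ((Metric.tendsto_nhds.1 hy' (ε/2) (by linarith)))
    have e2 := (Lf_t X t).eventually (Metric.closedBall_mem_nhds t (half_pos hδ))
    have e3 := (Lf_X X t).eventually (Metric.closedBall_mem_nhds X (half_pos hδ))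
    have e4 := (Lf_n X t).eventually ((floor_t ht).eventually (Metric.closedBall_mem_nhds t (half_pos hδ)))
    have e5 := (Lf_n X t).eventually ((floor_X hX.1).eventually (Metric.closedBall_mem_nhds X (half_pos hδ)))
    filter_upwards [e1, e2, e3, e4, e5, Lf_ev X t n0] with z h1 h2 h3 h4 h5 h6
    simp only [Metric.mem_closedBall, Real.dist_eq] at h1 h2 h3 h4 h5 ⊢
    have := h0 z.1 h6.1 z.2.1 ⌊t * (z.1:ℝ)^4⌋₊ z.2.2 h6.2 ⌊X * z.1⌋₊ (floor_le hX.2 _)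
      (by rw [abs_le] at *; constructor <;> linarith) (by rw [abs_le] at *; constructor <;> linarith)
    have h7 := abs_sub_le (Q z.1 z.2.1 z.2.2) (f z.1) y
    linarith
  choose q hq using key
  exact ⟨q, fun X hX t ht => hq X t hX ht⟩

lemma Lim.cont {Q : ℕ → ℕ → ℕ → ℝ} {q : ℝ → ℝ → ℝ} (h : Lim Q q) :
    ContinuousOn (fun p : ℝ × ℝ => q p.1 p.2) (Icc 0 1 ×ˢ Ici 0) := by
  rintro ⟨X, t⟩ ⟨hX, ht⟩
  simp only at hX ht
  rw [ContinuousWithinAt, Metric.tendsto_nhds]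
  intro ε hε
  have h1 := (h X hX t ht).eventually (Metric.closedBall_mem_nhds _ (half_pos hε))
  unfold Lf at h1
  rw [eventually_inf_principal, eventually_comap] at h1
  obtain ⟨P1, hP1, P2, hP2, hh⟩ := eventually_prod_iff.1 h1
  obtain ⟨P3, hP3, P4, hP4, hh2⟩ := eventually_prod_iff.1 hP2
  have e1 : ∀ᶠ p : ℝ × ℝ in 𝓝 (X, t), (∀ᶠ x in 𝓝 p.1, P4 x) ∧ (∀ᶠ x in 𝓝 p.2, P3 x) :=
    ((eventually_eventually_nhds.2 hP4).prod_inl_nhds t).and ((eventually_eventually_nhds.2 hP3).prod_inr_nhds X)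
  filter_upwards [e1.filter_mono nhdsWithin_le_nhds, self_mem_nhdsWithin] with p hp hpm
  have hne := Lf_neBot hpm.1 hpm.2
  have hlim := h p.1 hpm.1 p.2 hpm.2
  have hev : ∀ᶠ z in Lf p.1 p.2, Q z.1 z.2.1 z.2.2 ∈ Metric.closedBall (q X t) (ε/2) := by
    filter_upwards [(Lf_n p.1 p.2).eventually hP1, (Lf_t p.1 p.2).eventually hp.2,
      (Lf_X p.1 p.2).eventually hp.1, Lf_le p.1 p.2] with z z1 z2 z3 z4
    exact hh z1 (hh2 z2 z3) z rfl z4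
  have := Metric.isClosed_closedBall.mem_of_tendsto hlim hev
  rw [Metric.mem_closedBall] at this
  exact lt_of_le_of_lt this (by linarith)

lemma deriv_of_blocks {a : ℝ → ℝ} {x0 d : ℝ} {I : Set ℝ}
    (h : ∀ ε > 0, ∃ δ > 0, ∀ y ∈ I, |y - x0| ≤ δ → |a y - a x0 - (y - x0) * d| ≤ ε * |y - x0|) :
    HasDerivWithinAt a d I x0 := by
  rw [hasDerivWithinAt_iff_isLittleO, Asymptotics.isLittleO_iff]
  intro ε hε
  obtain ⟨δ, hδ, h⟩ := h ε hε
  filter_upwards [self_mem_nhdsWithin, mem_nhdsWithin_of_mem_nhds (Metric.closedBall_mem_nhds x0 hδ)] with y hy hy2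
  exact h y hy hy2

lemma Lim.deriv_X {u D : ℕ → ℕ → ℕ → ℝ} {a : ℝ → ℝ → ℝ} (hu : Lim u a) {σ n1 : ℕ} (hσ : σ ≤ 1)
    (hrel : ∀ n ≥ n1, ∀ s i, i < n → (n:ℝ) * (u n s (i+1) - u n s i) = D n s (i+σ))
    {X t d : ℝ} (hX : X ∈ Icc (0:ℝ) 1) (ht : t ∈ Ici (0:ℝ))
    (hD : Tendsto (fun z : ℕ × ℕ × ℕ => D z.1 z.2.1 z.2.2) (Lf X t) (𝓝 d)) :
    HasDerivWithinAt (fun x => a x t) d (Icc 0 1) X := by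
  apply deriv_of_blocks
  intro ε hε
  have h1 := hD.eventually (Metric.closedBall_mem_nhds _ hε)
  unfold Lf at h1
  rw [eventually_inf_principal, eventually_comap] at h1
  obtain ⟨P1, hP1, P2, hP2, hh⟩ := eventually_prod_iff.1 h1
  obtain ⟨P3, hP3, P4, hP4, hh2⟩ := eventually_prod_iff.1 hP2
  obtain ⟨δ, hδ, hb⟩ := Metric.nhds_basis_closedBall.eventually_iff.1 hP4
  refine ⟨δ/2, half_pos hδ, fun y hy hyd => ?_⟩
  set s : ℕ → ℕ := fun n => ⌊t * (n:ℝ)^4⌋₊ with hs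
  have c1 : Tendsto (fun n : ℕ => u n (s n) ⌊y * n⌋₊ - u n (s n) ⌊X * n⌋₊ -
      (((⌊y * n⌋₊:ℕ):ℝ)/n - ((⌊X * n⌋₊:ℕ):ℝ)/n) * d) (hyperfilter ℕ : Filter ℕ)
      (𝓝 (a y t - a X t - (y - X) * d)) :=
    (((hu y hy t ht).comp (tendsto_floor hy ht)).sub ((hu X hX t ht).comp (tendsto_floor hX ht))).sub
      (((floor_X hy.1).sub (floor_X hX.1)).mul_const d)
  have c2 : Tendsto (fun n : ℕ => ε * |((⌊y * n⌋₊:ℕ):ℝ)/n - ((⌊X * n⌋₊:ℕ):ℝ)/n|) (hyperfilter ℕ : Filter ℕ)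
      (𝓝 (ε * |y - X|)) := ((floor_X hy.1).sub (floor_X hX.1)).abs.const_mul ε
  refine le_of_tendsto_of_tendsto c1.abs c2 ?_
  have f1 := (floor_X hy.1).eventually (Metric.closedBall_mem_nhds y (by positivity : 0 < δ/4))
  have f2 := (floor_X hX.1).eventually (Metric.closedBall_mem_nhds X (by positivity : 0 < δ/4))
  have f3 : ∀ᶠ n : ℕ in (hyperfilter ℕ : Filter ℕ), (4/δ) ≤ (n:ℝ) := hyper_tendsto_cast.eventually_ge_atTop _
  filter_upwards [f1, f2, f3, hyper_ge (max n1 1), hP1, (floor_t ht).eventually hP3] with n g1 g2 g3 g4 g5 g6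
  rw [Real.dist_eq] at g1 g2
  have hnp : 0 < n := (le_max_right n1 1).trans g4
  have hn0 : (0:ℝ) < n := by exact_mod_cast hnp
  have g3' : 1/(n:ℝ) ≤ δ/4 := by
    rw [div_le_iff₀ hδ] at g3
    rw [div_le_iff₀ hn0]; linarith
  have key : ∀ p q : ℕ, p + q ≤ n → |(p:ℝ)/n - X| ≤ 3*δ/4 → |((p+q:ℕ):ℝ)/n - X| ≤ 3*δ/4 →
      |u n (s n) (p+q) - u n (s n) p - (((p+q:ℕ):ℝ)/n - (p:ℝ)/n) * d| ≤ ε * |((p+q:ℕ):ℝ)/n - (p:ℝ)/n| := by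
    intro p q hpq hp1 hp2
    have hbk := slope_block (u := u n (s n)) (U := fun m => n * (u n (s n) (m+1) - u n (s n) m)) (c := d) (ε := ε)
      p hnp q (fun m _ _ => rfl) (fun m hm hm' => by
        rw [hrel n ((le_max_left n1 1).trans g4) (s n) m (by omega)]
        have hP4m : P4 (((m+σ:ℕ):ℝ)/n) := by
          apply hb
          rw [Metric.mem_closedBall, Real.dist_eq]
          have b1 : (p:ℝ)/n ≤ ((m+σ:ℕ):ℝ)/n := div_le_div_of_nonneg_right (by exact_mod_cast (by omega)) hn0.le
          have b2 : ((m+σ:ℕ):ℝ)/n ≤ ((p+q+1:ℕ):ℝ)/n := div_le_div_of_nonneg_right (by exact_mod_cast (by omega)) hn0.le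
          have b3 : ((p+q+1:ℕ):ℝ)/n = ((p+q:ℕ):ℝ)/n + 1/n := by push_cast; ring
          rw [abs_le] at *; constructor <;> linarith
        have := hh g5 (hh2 g6 hP4m) (n, s n, m+σ) rfl (by show m+σ ≤ n; omega)
        rwa [Real.dist_eq] at this)
    have e : ((p+q:ℕ):ℝ)/n - (p:ℝ)/n = q / n := by push_cast; ring
    rw [e, abs_of_nonneg (by positivity : (0:ℝ) ≤ q/n)]
    have e2 : u n (s n) (p+q) - u n (s n) p - (q:ℝ)/n * d = (n * (u n (s n) (p+q) - u n (s n) p) - q * d) / n := by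
      field_simp
    rw [e2, abs_div, abs_of_pos hn0, div_le_iff₀ hn0]
    have e3 : ε * ((q:ℝ)/n) * n = q * ε := by field_simp
    rw [e3]; exact hbk
  have k1 : |((⌊X * n⌋₊:ℕ):ℝ)/n - X| ≤ 3*δ/4 := g2.trans (by linarith)
  have k2 : |((⌊y * n⌋₊:ℕ):ℝ)/n - X| ≤ 3*δ/4 := by
    rw [abs_le] at *; constructor <;> linarith
  rcases le_total ⌊X * (n:ℝ)⌋₊ ⌊y * (n:ℝ)⌋₊ with h | h
  · obtain ⟨q, hq⟩ := Nat.exists_eq_add_of_le h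
    have := key ⌊X * (n:ℝ)⌋₊ q (by rw [← hq]; exact floor_le hy.2 n) k1 (by rw [← hq]; exact k2)
    rw [← hq] at this; exact this
  · obtain ⟨q, hq⟩ := Nat.exists_eq_add_of_le h
    have := key ⌊y * (n:ℝ)⌋₊ q (by rw [← hq]; exact floor_le hX.2 n) k2 (by rw [← hq]; exact k1)
    rw [← hq, ← abs_neg, abs_sub_comm (((⌊X * n⌋₊:ℕ):ℝ)/n)] at this
    refine le_of_eq_of_le (congrArg _ ?_) this
    ring

lemma Lim.deriv_t {u D : ℕ → ℕ → ℕ → ℝ} {a : ℝ → ℝ → ℝ} (hu : Lim u a) {n1 : ℕ}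
    (hrel : ∀ n ≥ n1, ∀ s i, i ≤ n → ((n^4:ℕ):ℝ) * (u n (s+1) i - u n s i) = D n s i)
    {X t d : ℝ} (hX : X ∈ Icc (0:ℝ) 1) (ht : t ∈ Ici (0:ℝ))
    (hD : Tendsto (fun z : ℕ × ℕ × ℕ => D z.1 z.2.1 z.2.2) (Lf X t) (𝓝 d)) :
    HasDerivWithinAt (fun s => a X s) d (Ici 0) t := by
  apply deriv_of_blocks
  intro ε hε
  have h1 := hD.eventually (Metric.closedBall_mem_nhds _ hε)
  unfold Lf at h1
  rw [eventually_inf_principal, eventually_comap] at h1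
  obtain ⟨P1, hP1, P2, hP2, hh⟩ := eventually_prod_iff.1 h1
  obtain ⟨P3, hP3, P4, hP4, hh2⟩ := eventually_prod_iff.1 hP2
  obtain ⟨δ, hδ, hb⟩ := Metric.nhds_basis_closedBall.eventually_iff.1 hP3
  refine ⟨δ/2, half_pos hδ, fun y hy hyd => ?_⟩
  set i : ℕ → ℕ := fun n => ⌊X * n⌋₊ with hi
  set f : ℝ → ℕ → ℕ := fun t n => ⌊t * (n:ℝ)^4⌋₊ with hf
  have ft : ∀ t : ℝ, 0 ≤ t → Tendsto (fun n => (f t n:ℝ) * (1/(n:ℝ)^4)) (hyperfilter ℕ : Filter ℕ) (𝓝 t) :=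
    fun t ht => floor_t ht
  have c1 : Tendsto (fun n : ℕ => u n (f y n) (i n) - u n (f t n) (i n) -
      ((f y n:ℝ) * (1/(n:ℝ)^4) - (f t n:ℝ) * (1/(n:ℝ)^4)) * d) (hyperfilter ℕ : Filter ℕ)
      (𝓝 (a X y - a X t - (y - t) * d)) :=
    (((hu X hX y hy).comp (tendsto_floor hX hy)).sub ((hu X hX t ht).comp (tendsto_floor hX ht))).sub
      (((ft y hy).sub (ft t ht)).mul_const d)
  have c2 : Tendsto (fun n : ℕ => ε * |(f y n:ℝ) * (1/(n:ℝ)^4) - (f t n:ℝ) * (1/(n:ℝ)^4)|) (hyperfilter ℕ : Filter ℕ)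
      (𝓝 (ε * |y - t|)) := ((ft y hy).sub (ft t ht)).abs.const_mul ε
  refine le_of_tendsto_of_tendsto c1.abs c2 ?_
  have f1 := (ft y hy).eventually (Metric.closedBall_mem_nhds y (by positivity : 0 < δ/4))
  have f2 := (ft t ht).eventually (Metric.closedBall_mem_nhds t (by positivity : 0 < δ/4))
  filter_upwards [f1, f2, hyper_ge (max n1 1), hP1, (floor_X hX.1).eventually hP4] with n g1 g2 g4 g5 g6
  rw [Real.dist_eq] at g1 g2
  have hnp : 0 < n := (le_max_right n1 1).trans g4
  have hn0 : (0:ℝ) < (n:ℝ)^4 := by positivity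
  have hτ : (0:ℝ) < 1/(n:ℝ)^4 := by positivity
  have key : ∀ p q : ℕ, |(p:ℝ)*(1/(n:ℝ)^4) - t| ≤ 3*δ/4 → |((p+q:ℕ):ℝ)*(1/(n:ℝ)^4) - t| ≤ 3*δ/4 →
      |u n (p+q) (i n) - u n p (i n) - (((p+q:ℕ):ℝ)*(1/(n:ℝ)^4) - (p:ℝ)*(1/(n:ℝ)^4)) * d|
        ≤ ε * |((p+q:ℕ):ℝ)*(1/(n:ℝ)^4) - (p:ℝ)*(1/(n:ℝ)^4)| := by
    intro p q hp1 hp2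
    have hbk := slope_block (n := n^4) (u := fun s => u n s (i n))
      (U := fun m => ((n^4:ℕ):ℝ) * (u n (m+1) (i n) - u n m (i n))) (c := d) (ε := ε)
      p (by positivity) q (fun m _ _ => rfl) (fun m hm hm' => by
        rw [hrel n ((le_max_left n1 1).trans g4) m (i n) (floor_le hX.2 n)]
        have hP3m : P3 ((m:ℝ)*(1/(n:ℝ)^4)) := by
          apply hb
          rw [Metric.mem_closedBall, Real.dist_eq]
          have b1 : (p:ℝ)*(1/(n:ℝ)^4) ≤ (m:ℝ)*(1/(n:ℝ)^4) :=
            mul_le_mul_of_nonneg_right (by exact_mod_cast hm) hτ.le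
          have b2 : (m:ℝ)*(1/(n:ℝ)^4) ≤ ((p+q:ℕ):ℝ)*(1/(n:ℝ)^4) :=
            mul_le_mul_of_nonneg_right (by exact_mod_cast hm'.le) hτ.le
          rw [abs_le] at *; constructor <;> linarith
        have := hh g5 (hh2 hP3m g6) (n, m, i n) rfl (floor_le hX.2 n)
        rwa [Real.dist_eq] at this)
    rw [Nat.cast_pow] at hbk
    have e : ((p+q:ℕ):ℝ)*(1/(n:ℝ)^4) - (p:ℝ)*(1/(n:ℝ)^4) = q / (n:ℝ)^4 := by push_cast; ring
    rw [e, abs_of_nonneg (by positivity : (0:ℝ) ≤ q/(n:ℝ)^4)]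
    have e2 : u n (p+q) (i n) - u n p (i n) - (q:ℝ)/(n:ℝ)^4 * d
        = ((n:ℝ)^4 * (u n (p+q) (i n) - u n p (i n)) - q * d) / (n:ℝ)^4 := by
      field_simp
    rw [e2, abs_div, abs_of_pos hn0, div_le_iff₀ hn0]
    have e3 : ε * ((q:ℝ)/(n:ℝ)^4) * (n:ℝ)^4 = q * ε := by field_simp
    rw [e3]; exact hbk
  have k1 : |(f t n:ℝ)*(1/(n:ℝ)^4) - t| ≤ 3*δ/4 := g2.trans (by linarith)
  have k2 : |(f y n:ℝ)*(1/(n:ℝ)^4) - t| ≤ 3*δ/4 := by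
    rw [abs_le] at *; constructor <;> linarith
  rcases le_total (f t n) (f y n) with h | h
  · obtain ⟨q, hq⟩ := Nat.exists_eq_add_of_le h
    have := key (f t n) q k1 (by rw [← hq]; exact k2)
    rw [← hq] at this; exact this
  · obtain ⟨q, hq⟩ := Nat.exists_eq_add_of_le h
    have := key (f y n) q k2 (by rw [← hq]; exact k1)
    rw [← hq, ← abs_neg, abs_sub_comm ((f t n:ℝ)*(1/(n:ℝ)^4))] at this
    refine le_of_eq_of_le (congrArg _ ?_) this
    ring

end RF

namespace RF

/-- the explicit scheme -/
noncomputable def sch (ν α b k : ℝ) (n : ℕ) (u0 : ℕ → ℝ) : ℕ → ℕ → ℝ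
  | 0 => u0
  | s + 1 => stp ν α b k n (1/(n:ℝ)^4) (sch ν α b k n u0 s)

/-- facts about the scheme used below -/
structure Sch (ν α b k m M P l L C H1 H2 S : ℝ) (n1 : ℕ) (u : ℕ → ℕ → ℕ → ℝ) : Prop where
  hν : 2 ≤ ν
  hα : 0 < α
  hm : 0 < m
  hmM : m ≤ M
  hl : 0 < l
  hlL : l ≤ L
  hC : 0 < C
  hH1 : 0 < H1
  hH : H1 ≤ H2
  hS : 1 ≤ S
  pos : ∀ n ≥ n1, 0 < n
  cfl : ∀ n ≥ n1, CFL ν L C n (1/(n:ℝ)^4)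
  stepu : ∀ n s, u n (s+1) = stp ν α b k n (1/(n:ℝ)^4) (u n s)
  inv : ∀ n ≥ n1, ∀ s, Inv ν α b n m M P (Ud k n (u n s))
  adm : ∀ n ≥ n1, ∀ s, Adm ν n H1 H2 S (Ud k n (u n s))
  lin : ∀ n ≥ n1, ∀ s, LinStep ν l L C n (1/(n:ℝ)^4) 0 (Fd ν α b n (Ud k n (u n s)))
          (Fd ν α b n (Ud k n (u n (s+1))))
  dec : ∀ n ≥ n1, ∀ U U', Inv ν α b n m M P U → Inv ν α b n m M P U' → ∀ i ≤ n, ∃ p q,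
    LinCoef ν l L C n i p q ∧
        Fd ν α b n U' i - Fd ν α b n U i = p * (U' i - U i) - q * (U' (i-1) - U (i-1))

lemma sch_exists {ν α b k m M P : ℝ} (hν : 2 ≤ ν) (hα : 0 < α) (hb : b ≤ 0) (hm : 0 < m)
    (hmM : m ≤ M) (hk : 0 < k) (hkP : k ≤ P) {u0 : ℕ → ℕ → ℝ} {n0 : ℕ}
    (h0 : ∀ n ≥ n0, Inv ν α b n m M P (Ud k n (u0 n))) :
    ∃ l L C H1 H2 S n1, n0 ≤ n1 ∧ Sch ν α b k m M P l L C H1 H2 S n1 (fun n => sch ν α b k n (u0 n)) := by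
  obtain ⟨l, L, C, H1, H2, S, hl, hlL, hC, hH1, hH, hS, hadm, n1, h1⟩ := inv_step hν hα hb hm hmM hk hkP
  have hinv : ∀ n ≥ max n0 n1, ∀ s, Inv ν α b n m M P (Ud k n (sch ν α b k n (u0 n) s)) := by
    intro n hn s
    induction s with
    | zero => exact h0 n ((le_max_left _ _).trans hn)
    | succ s ih => exact ((h1 n ((le_max_right _ _).trans hn)).2.2.2 _ ih).1
  refine ⟨l, L, C, H1, H2, S, max n0 n1, le_max_left _ _, ⟨hν, hα, hm, hmM, hl, hlL, hC, hH1, hH, hS, ?_, ?_, ?_,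
    hinv, fun n hn s => (hadm n _ (hinv n hn s)).1, ?_, ?_⟩⟩
  · exact fun n hn => (h1 n ((le_max_right _ _).trans hn)).1
  · exact fun n hn => (h1 n ((le_max_right _ _).trans hn)).2.1
  · exact fun n s => rfl
  · exact fun n hn s => ((h1 n ((le_max_right _ _).trans hn)).2.2.2 _ (hinv n hn s)).2
  · exact fun n hn => (h1 n ((le_max_right _ _).trans hn)).2.2.1

variable {ν α b k m M P l L C H1 H2 S : ℝ} {n1 : ℕ} {u : ℕ → ℕ → ℕ → ℝ}

lemma Sch.G_bd (h : Sch ν α b k m M P l L C H1 H2 S n1 u) :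
    ∀ n ≥ n1, ∀ s, ∀ i ≤ n, |Fd ν α b n (Ud k n (u n s)) i| ≤ M := by
  intro n hn s i hi
  have := h.inv n hn s i hi
  have := h.hm
  rw [abs_le]; constructor <;> linarith

lemma Sch.M_nonneg (h : Sch ν α b k m M P l L C H1 H2 S n1 u) : 0 ≤ M := h.hm.le.trans h.hmM

lemma Sch.ν_pos (h : Sch ν α b k m M P l L C H1 H2 S n1 u) : 0 < ν := by linarith [h.hν]

lemma Sch.u_te (h : Sch ν α b k m M P l L C H1 H2 S n1 u) :
    ∀ n ≥ n1, ∀ s q : ℕ, ∀ i ≤ n, |u n (s+q) i - u n s i| ≤ M * (q * (1/(n:ℝ)^4)) := by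
  intro n hn s q i hi
  induction q with
  | zero => simp
  | succ q ih =>
    have e : u n (s+(q+1)) i - u n (s+q) i = 1/(n:ℝ)^4 * Fd ν α b n (Ud k n (u n (s+q))) i := by
      rw [← add_assoc, h.stepu]; unfold stp; ring
    have h1 : |u n (s+(q+1)) i - u n (s+q) i| ≤ 1/(n:ℝ)^4 * M := by
      rw [e, abs_mul, abs_of_nonneg (by positivity : 0 ≤ 1/(n:ℝ)^4)]
      exact mul_le_mul_of_nonneg_left (h.G_bd n hn _ i hi) (by positivity)
    have := abs_sub_le (u n (s+(q+1)) i) (u n (s+q) i) (u n s i)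
    push_cast
    linarith

lemma Sch.EC_G (h : Sch ν α b k m M P l L C H1 H2 S n1 u)
    (h0 : ∀ ε > 0, ∃ K, 0 ≤ K ∧ ∃ n0 : ℕ, ∀ n ≥ n0, ∀ i ≤ n, ∀ j ≤ n,
      |Fd ν α b n (Ud k n (u n 0)) i - Fd ν α b n (Ud k n (u n 0)) j| ≤ ε + K * |(i:ℝ)/n - (j:ℝ)/n|) :
    EC (fun n s i => Fd ν α b n (Ud k n (u n s)) i) ∧ EC (fun n s i => Ud k n (u n s) i) := by
  have se := space_eq (Z := fun n s i => Fd ν α b n (Ud k n (u n s)) i) h.ν_pos h.hl h.hlL h.hC h.cfl h.lin h0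
  have te := time_eq (Z := fun n s i => Fd ν α b n (Ud k n (u n s)) i) h.ν_pos h.hl h.hlL h.hC
    (fun n hn => ⟨h.pos n hn, h.cfl n hn⟩) h.lin h.M_nonneg h.G_bd se
  have use := U_se (U := fun n s => Ud k n (u n s)) (b := b) h.ν_pos h.hα h.hH1 h.hH h.hS h.M_nonneg h.pos h.adm h.G_bd se
  exact ⟨EC_of se te, EC_of use (U_te h.M_nonneg h.u_te use)⟩

lemma Sch.U_bd (h : Sch ν α b k m M P l L C H1 H2 S n1 u) :
    ∃ B, 0 < B ∧ ∀ n ≥ n1, ∀ s, ∀ i ≤ n, |Ud k n (u n s) i| ≤ B := by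
  obtain ⟨B, hB, hb⟩ := adm_bounds h.ν_pos h.hH1 h.hH h.hS
  refine ⟨B, hB, fun n hn s i hi => ?_⟩
  rw [abs_of_pos (h.adm n hn s i hi).1]
  exact (hb n _ (h.adm n hn s) i hi).1

lemma Sch.lims (h : Sch ν α b k m M P l L C H1 H2 S n1 u)
    (h0 : ∀ ε > 0, ∃ K, 0 ≤ K ∧ ∃ n0 : ℕ, ∀ n ≥ n0, ∀ i ≤ n, ∀ j ≤ n,
      |Fd ν α b n (Ud k n (u n 0)) i - Fd ν α b n (Ud k n (u n 0)) j| ≤ ε + K * |(i:ℝ)/n - (j:ℝ)/n|)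
    {A : ℝ} (hA : ∀ n ≥ n1, |u n 0 0| ≤ A) :
    ∃ a w g, Lim u a ∧ Lim (fun n s i => Ud k n (u n s) i) w ∧
      Lim (fun n s i => Fd ν α b n (Ud k n (u n s)) i) g := by
  obtain ⟨e1, e2⟩ := h.EC_G h0
  obtain ⟨B, hB, hb⟩ := h.U_bd
  obtain ⟨g, hg⟩ := exists_lim e1 (B := fun _ => M) (n1 := n1) (fun T n hn s _ i hi => h.G_bd n hn s i hi)
  obtain ⟨w, hw⟩ := exists_lim e2 (B := fun _ => B) (n1 := n1) (fun T n hn s _ i hi => hb n hn s i hi)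
  have e3 : EC u := by
    apply EC_of
    · intro ε hε
      refine ⟨ε / B, by positivity, n1, fun n hn s i hi j hj hd => ?_⟩
      refine (u_se hB.le (h.pos n hn) (hb n hn s) i hi j hj).trans ?_
      have := mul_le_mul_of_nonneg_left hd hB.le
      rwa [mul_div_cancel₀ _ hB.ne'] at this
    · intro ε hε
      refine ⟨M, h.M_nonneg, n1, fun n hn s q i hi => ?_⟩
      have := h.u_te n hn s q i hi
      linarith
  obtain ⟨a, ha⟩ := exists_lim e3 (B := fun T => A + B + M * T) (n1 := n1) (fun T n hn s hs i hi => by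
    have h1 := u_se hB.le (h.pos n hn) (hb n hn 0) i hi 0 (Nat.zero_le _)
    have h2 := h.u_te n hn 0 s i hi
    have h3 := hA n hn
    have h4 : |(i:ℝ)/n - ((0:ℕ):ℝ)/n| ≤ 1 := by
      rw [Nat.cast_zero, zero_div, sub_zero, abs_of_nonneg (xg_nonneg n i)]; exact xg_le_one hi
    have h5 := mul_le_mul_of_nonneg_left h4 hB.le
    have h6 := mul_le_mul_of_nonneg_left hs h.M_nonneg
    rw [zero_add] at h2
    rw [abs_le] at *
    constructor <;> linarith)
  exact ⟨a, w, g, ha, hw, hg⟩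

lemma Sf_contAt (X U : ℝ) : ContinuousAt (fun p : ℝ × ℝ => Sf p.1 p.2) (X, U) := by
  unfold Sf
  fun_prop

/-- limits of all discrete quantities -/
lemma Sch.lim_facts (h : Sch ν α b k m M P l L C H1 H2 S n1 u) {w g : ℝ → ℝ → ℝ}
    (hw : Lim (fun n s i => Ud k n (u n s) i) w)
    (hg : Lim (fun n s i => Fd ν α b n (Ud k n (u n s)) i) g) :
    ∃ H : ℝ → ℝ → ℝ, Lim (fun n s i => Hd ν n (Ud k n (u n s)) i) H ∧
      Lim (fun n s i => Vd n (Ud k n (u n s)) i) (fun X t => Vf X (w X t)) ∧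
      ∀ X ∈ Icc (0:ℝ) 1, ∀ t ∈ Ici (0:ℝ), 0 < H X t ∧ g X t = (H X t ^ α + b) * Sf X (w X t) := by
  have hS : Lim (fun n s i => Sd n (Ud k n (u n s)) i) (fun X t => Sf X (w X t)) := by
    intro X hX t ht
    exact (Sf_contAt X (w X t)).tendsto.comp ((Lf_X X t).prodMk_nhds (hw X hX t ht))
  have hV : Lim (fun n s i => Vd n (Ud k n (u n s)) i) (fun X t => Vf X (w X t)) := by
    intro X hX t ht
    exact ((hw X hX t ht).const_mul 2).div (hS X hX t ht) (Sf_pos hX.1).ne'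
  have hHl : Lim (fun n s i => Hd ν n (Ud k n (u n s)) i) (fun X t => (g X t / Sf X (w X t) - b)^(1/α)) := by
    intro X hX t ht
    have h1 : Tendsto (fun z : ℕ × ℕ × ℕ => (Fd ν α b z.1 (Ud k z.1 (u z.1 z.2.1)) z.2.2 /
        Sd z.1 (Ud k z.1 (u z.1 z.2.1)) z.2.2 - b)^(1/α)) (Lf X t)
        (𝓝 ((g X t / Sf X (w X t) - b)^(1/α))) :=
      (((hg X hX t ht).div (hS X hX t ht) (Sf_pos hX.1).ne').sub_const b).rpow_const
        (Or.inr (one_div_pos.2 h.hα).le)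
    refine h1.congr' ?_
    filter_upwards [Lf_ev X t n1] with z hz
    have hH := (h.inv z.1 hz.1 z.2.1 z.2.2 hz.2).1
    have hs : 0 < Sd z.1 (Ud k z.1 (u z.1 z.2.1)) z.2.2 := Sf_pos (xg_nonneg _ _)
    have e : Fd ν α b z.1 (Ud k z.1 (u z.1 z.2.1)) z.2.2 / Sd z.1 (Ud k z.1 (u z.1 z.2.1)) z.2.2 - b
        = Hd ν z.1 (Ud k z.1 (u z.1 z.2.1)) z.2.2 ^ α := by unfold Fd; field_simp; ring
    rw [e, ← Real.rpow_mul hH.le, mul_one_div_cancel h.hα.ne', Real.rpow_one]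
  refine ⟨_, hHl, hV, fun X hX t ht => ?_⟩
  have hne := Lf_neBot hX ht
  have hHp : H1 ≤ (g X t / Sf X (w X t) - b)^(1/α) := by
    refine ge_of_tendsto (hHl X hX t ht) ?_
    filter_upwards [Lf_ev X t n1] with z hz
    exact (h.adm z.1 hz.1 z.2.1 z.2.2 hz.2).2.1
  have hHp' := h.hH1.trans_le hHp
  refine ⟨hHp', ?_⟩
  have h2 := ((hHl X hX t ht).rpow_const (p := α) (Or.inr h.hα.le)).add_const b |>.mul (hS X hX t ht)
  exact tendsto_nhds_unique (hg X hX t ht) h2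

end RF

namespace RF

lemma f_deriv {x S : ℝ} (hS : 0 < S) (hx : 1 - x^2 = (1/S)^2) :
    HasDerivAt (fun x : ℝ => x / Real.sqrt (1 - x^2)) (S^3) x := by
  have hp : (0:ℝ) < 1 - x^2 := by rw [hx]; positivity
  have hs : Real.sqrt (1 - x^2) = 1/S := by rw [hx]; exact Real.sqrt_sq (by positivity)
  have h1 : HasDerivAt (fun x : ℝ => 1 - x^2) (-(2*x)) x := by
    have := (hasDerivAt_pow 2 x).const_sub 1
    simpa using this
  have h2 := (hasDerivAt_id x).div (h1.sqrt hp.ne') (by rw [hs]; positivity)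
  refine h2.congr_deriv ?_
  rw [hs]
  simp only [id]
  have hx2 : x^2 = 1 - (1/S)^2 := by linarith
  field_simp
  field_simp at hx2
  linear_combination hx2

variable {N : ℕ} {α b k m M P l L C H1 H2 S : ℝ} {n1 : ℕ} {u : ℕ → ℕ → ℕ → ℝ}

lemma sq_mem {r : ℝ} (hr : r ∈ Icc (0:ℝ) 1) : r^2 ∈ Icc (0:ℝ) 1 :=
  ⟨sq_nonneg r, pow_le_one₀ hr.1 hr.2⟩

lemma lift_cont {q : ℝ → ℝ → ℝ} (h : ContinuousOn (fun p : ℝ × ℝ => q p.1 p.2) (Icc 0 1 ×ˢ Ici 0)) :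
    ContinuousOn (fun p : ℝ × ℝ => q (p.1^2) p.2) (Icc 0 1 ×ˢ Ici 0) := by
  have h1 : ContinuousOn (fun p : ℝ × ℝ => (p.1^2, p.2)) (Icc 0 1 ×ˢ Ici 0) := by fun_prop
  exact h.comp h1 (fun p hp => ⟨sq_mem hp.1, hp.2⟩)

/-- derivative of `σ = r V(r²)` -/
lemma sigma_deriv {V : ℝ → ℝ} {H ν r : ℝ} (hr : r ∈ Icc (0:ℝ) 1)
    (hV0 : ContinuousOn V (Icc 0 1)) (h0 : r = 0 → H = ν * V 0)
    (hV : 0 < r → HasDerivWithinAt V ((H - ν * V (r^2)) / (2 * r^2)) (Icc 0 1) (r^2)) :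
    HasDerivWithinAt (fun s => s * V (s^2)) (H - (ν - 1) * V (r^2)) (Icc 0 1) r := by
  rcases hr.1.eq_or_lt with h | h
  · subst h
    rw [h0 rfl]
    have e : ν * V 0 - (ν - 1) * V (0^2) = V 0 := by
      rw [zero_pow two_ne_zero]; ring
    rw [e, hasDerivWithinAt_iff_tendsto_slope]
    have hc : Tendsto (fun s : ℝ => V (s^2)) (𝓝[Icc 0 1] 0) (𝓝 (V 0)) := by
      have h1 : ContinuousOn (fun s : ℝ => V (s^2)) (Icc 0 1) :=
        hV0.comp (by fun_prop) (fun s hs => sq_mem hs)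
      have := h1 0 ⟨le_rfl, zero_le_one⟩
      unfold ContinuousWithinAt at this
      simpa using this
    refine (hc.mono_left (nhdsWithin_mono _ sdiff_subset)).congr' ?_
    filter_upwards [self_mem_nhdsWithin] with s hs
    have hs0 : s ≠ 0 := hs.2
    rw [slope_def_field]
    field_simp
    ring
  · have h1 := (hV h).comp r (h := fun s => s^2) (s := Icc 0 1)
      ((hasDerivAt_pow 2 r).hasDerivWithinAt) (fun s hs => sq_mem hs)
    have h2 := (hasDerivWithinAt_id r (Icc 0 1)).mul h1
    refine h2.congr_deriv ?_
    simp only [id, Function.comp]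
    push_cast
    field_simp
    ring

set_option maxHeartbeats 1000000 in
lemma flow_of_lims (h : Sch N α b k m M P l L C H1 H2 S n1 u)
    {y y' y'' : ℝ → ℝ} (hy : IsC2Data k y y' y'')
    (hu0 : ∀ n, u n 0 = usum (y 0) y' y'' n)
    {a w g : ℝ → ℝ → ℝ} (ha : Lim u a)
    (hw : Lim (fun n s i => Ud k n (u n s) i) w)
    (hg : Lim (fun n s i => Fd N α b n (Ud k n (u n s)) i) g) :
    ∃ ur urr ut : ℝ → ℝ → ℝ, IsFlowSol N α b k y y' y'' (Ici 0) (fun r t => a (r^2) t) ur urr ut ∧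
      ∀ t ∈ Ici (0:ℝ), ∀ r ∈ Icc (0:ℝ) 1, 0 < meanCurv N r (ur r t) (urr r t) := by
  obtain ⟨H, hH, hV, hHg⟩ := h.lim_facts hw hg
  have z1 : (0:ℝ) ∈ Icc (0:ℝ) 1 := ⟨le_rfl, zero_le_one⟩
  -- derivatives
  have da : ∀ t ∈ Ici (0:ℝ), ∀ X ∈ Icc (0:ℝ) 1, HasDerivWithinAt (fun x => a x t) (w X t) (Icc 0 1) X := by
    intro t ht X hX
    refine ha.deriv_X (D := fun n s i => Ud k n (u n s) i) (σ := 0) (n1 := n1) (by norm_num) (fun n hn s i hi => ?_) hX ht (hw X hX t ht)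
    simp only [add_zero]
    unfold Ud; rw [if_pos hi]
  have dt : ∀ X ∈ Icc (0:ℝ) 1, ∀ t ∈ Ici (0:ℝ), HasDerivWithinAt (fun s => a X s) (g X t) (Ici 0) t := by
    intro X hX t ht
    refine ha.deriv_t (D := fun n s i => Fd N α b n (Ud k n (u n s)) i) (n1 := n1) (fun n hn s i hi => ?_) hX ht (hg X hX t ht)
    have hn0 : (n:ℝ) ≠ 0 := by exact_mod_cast (h.pos n hn).ne'
    rw [h.stepu]; unfold stp; push_cast; field_simp; ring
  have dV : ∀ t ∈ Ici (0:ℝ), ∀ X ∈ Icc (0:ℝ) 1, 0 < X → HasDerivWithinAt (fun x => Vf x (w x t))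
      ((H X t - N * Vf X (w X t)) / (2 * X)) (Icc 0 1) X := by
    intro t ht X hX hX0
    refine hV.deriv_X (σ := 1) (n1 := n1) (D := fun n s i => (Hd N n (Ud k n (u n s)) i
      - N * Vd n (Ud k n (u n s)) i) / (2 * ((i:ℝ)/n))) le_rfl (fun n hn s i hi => ?_) hX ht ?_
    · have hn0 : (n:ℝ) ≠ 0 := by exact_mod_cast (h.pos n hn).ne'
      simp only [Hd, Nat.add_sub_cancel]
      have : ((i+1:ℕ):ℝ) ≠ 0 := by positivity
      field_simp
      ring
    · exact ((hH X hX t ht).sub ((hV X hX t ht).const_mul _)).div ((Lf_X X t).const_mul 2) (by positivity)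
  have H0 : ∀ t ∈ Ici (0:ℝ), H 0 t = N * Vf 0 (w 0 t) := by
    intro t ht
    have c1 := (hH 0 z1 t ht).comp (tendsto_floor z1 ht)
    have c2 := ((hV 0 z1 t ht).comp (tendsto_floor z1 ht)).const_mul (N:ℝ)
    refine tendsto_nhds_unique c1 (c2.congr (fun n => ?_))
    simp [Function.comp, Hd]
  have w1 : ∀ t ∈ Ici (0:ℝ), w 1 t = k/2 := by
    intro t ht
    have o1 : (1:ℝ) ∈ Icc (0:ℝ) 1 := ⟨zero_le_one, le_rfl⟩
    have c1 := (hw 1 o1 t ht).comp (tendsto_floor o1 ht)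
    refine tendsto_nhds_unique c1 (tendsto_const_nhds.congr (fun n => ?_))
    simp [Function.comp, Ud]
  have cw := hw.cont
  have cH := hH.cont
  have cV := hV.cont
  have hSf : ∀ r t, Sf (r^2) (w (r^2) t) = Real.sqrt (1 + (2 * r * w (r^2) t)^2) := by
    intro r t; unfold Sf; congr 1; ring
  have hSp : ∀ r t, 0 < Sf (r^2) (w (r^2) t) := fun r t => Sf_pos (sq_nonneg r)
  -- initial values
  have t0 : (0:ℝ) ∈ Ici (0:ℝ) := Set.mem_Ici.2 le_rfl
  have a0 : ∀ r ∈ Icc (0:ℝ) 1, a (r^2) 0 = y r := by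
    intro r hr
    have hX := sq_mem hr
    have c1 := (ha _ hX 0 t0).comp (tendsto_floor hX t0)
    have hc : ContinuousOn (fun X : ℝ => y (Real.sqrt X)) (Icc 0 1) := by
      have : ContinuousOn y (Icc 0 1) := fun r hr => (hy.1 r hr).continuousWithinAt
      exact this.comp Real.continuous_sqrt.continuousOn
        (fun X hX => ⟨Real.sqrt_nonneg _, Real.sqrt_le_iff.2 ⟨zero_le_one, by simpa using hX.2⟩⟩)
    have c2 : Tendsto (fun n : ℕ => y (Real.sqrt (((⌊r^2 * n⌋₊:ℕ):ℝ)/n))) (hyperfilter ℕ : Filter ℕ)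
        (𝓝 (y r)) := by
      have := (hc (r^2) hX).tendsto.comp (tendsto_nhdsWithin_iff.2 ⟨floor_X hX.1,
        Eventually.of_forall (fun n => ⟨xg_nonneg _ _, xg_le_one (floor_le hX.2 n)⟩)⟩)
      simp only [Real.sqrt_sq hr.1] at this
      exact this
    have c3 : Tendsto (fun n : ℕ => u n 0 ⌊r^2 * n⌋₊ - y (Real.sqrt (((⌊r^2 * n⌋₊:ℕ):ℝ)/n)))
        (hyperfilter ℕ : Filter ℕ) (𝓝 0) := by
      rw [Metric.tendsto_nhds]
      intro ε hε
      obtain ⟨n0, hn0⟩ := sum_consist hy (half_pos hε)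
      filter_upwards [hyper_ge n0] with n hn
      rw [Real.dist_eq, sub_zero, hu0]
      have := hn0 n hn _ (floor_le hX.2 n)
      linarith
    have c4 := c3.add c2
    rw [zero_add] at c4
    refine tendsto_nhds_unique c1 (c4.congr (fun n => ?_))
    simp [Function.comp]
  have w0 : ∀ r ∈ Icc (0:ℝ) 1, 2 * r * w (r^2) 0 = y' r := by
    intro r hr
    have hX := sq_mem hr
    have c1 := (hw _ hX 0 t0).comp (tendsto_floor hX t0)
    have c2 : Tendsto (fun n : ℕ => Us y' y'' (((⌊r^2 * n⌋₊:ℕ):ℝ)/n)) (hyperfilter ℕ : Filter ℕ)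
        (𝓝 (Us y' y'' (r^2))) :=
      (Us_cont hy.2.1 hy.2.2.2.1 (r^2) hX).tendsto.comp (tendsto_nhdsWithin_iff.2 ⟨floor_X hX.1,
        Eventually.of_forall (fun n => ⟨xg_nonneg _ _, xg_le_one (floor_le hX.2 n)⟩)⟩)
    have e : w (r^2) 0 = Us y' y'' (r^2) := by
      refine tendsto_nhds_unique c1 (c2.congr' ?_)
      filter_upwards [hyper_ge 1] with n hn
      simp only [Function.comp, zero_mul, Nat.floor_zero]
      rw [hu0, Ud_usum hy.2.2.2.2 hn (floor_le hX.2 n)]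
    rw [e]; unfold Us avg
    rw [Real.sqrt_sq hr.1]
    split_ifs with h0
    · rw [h0, hy.2.2.2.1]; ring
    · field_simp
  -- second derivative
  have dur : ∀ t ∈ Ici (0:ℝ), ∀ r ∈ Icc (0:ℝ) 1, HasDerivWithinAt (fun s => 2 * s * w (s^2) t)
      ((H (r^2) t - ((N:ℝ) - 1) * Vf (r^2) (w (r^2) t)) * Sf (r^2) (w (r^2) t) ^ 3) (Icc 0 1) r := by
    intro t ht r hr
    have hsig := sigma_deriv (V := fun X => Vf X (w X t)) (H := H (r^2) t) (ν := N) hr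
      (cV.comp (f := fun X : ℝ => (X, t)) (by fun_prop) (fun X hX => ⟨hX, ht⟩))
      (fun h0 => by subst h0; simpa using H0 t ht)
      (fun hr0 => dV t ht _ (sq_mem hr) (by positivity))
    have hone : ∀ s, 1 - (s * Vf (s^2) (w (s^2) t))^2 = (1 / Sf (s^2) (w (s^2) t))^2 := by
      intro s
      have := hSp s t
      have h2 : Sf (s^2) (w (s^2) t)^2 = 1 + 4 * s^2 * w (s^2) t^2 := Sf_sq (sq_nonneg s)
      unfold Vf
      field_simp
      rw [h2]; ring
    have hf := (f_deriv (hSp r t) (hone r)).comp_hasDerivWithinAt r hsig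
    have e : (fun s => 2 * s * w (s^2) t) = (fun x : ℝ => x / Real.sqrt (1 - x^2)) ∘ (fun s => s * Vf (s^2) (w (s^2) t)) := by
      funext s
      simp only [Function.comp]
      have := hSp s t
      rw [hone, Real.sqrt_sq (by positivity)]
      unfold Vf; field_simp
    rw [e]
    exact hf.congr_deriv (by ring)
  have hmc : ∀ t ∈ Ici (0:ℝ), ∀ r ∈ Icc (0:ℝ) 1, meanCurv N r (2 * r * w (r^2) t)
      ((H (r^2) t - ((N:ℝ) - 1) * Vf (r^2) (w (r^2) t)) * Sf (r^2) (w (r^2) t) ^ 3) = H (r^2) t := by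
    intro t ht r hr
    have hp := hSp r t
    unfold meanCurv
    split_ifs with h0
    · subst h0
      have e1 : Sf (0^2) (w (0^2) t) = 1 := by unfold Sf; simp
      have e2 := H0 t ht
      rw [e1]
      simp only [zero_pow two_ne_zero, ne_eq, OfNat.ofNat_ne_zero, not_false_eq_true] at e2 ⊢
      rw [e2]; ring
    · rw [rpow32, ← hSf]
      unfold Vf
      field_simp
      ring
  refine ⟨fun r t => 2 * r * w (r^2) t, fun r t => (H (r^2) t - ((N:ℝ) - 1) * Vf (r^2) (w (r^2) t)) *
    Sf (r^2) (w (r^2) t) ^ 3, fun r t => g (r^2) t, ⟨?_, ?_, ?_, ?_, ?_, dur, ?_, ?_, ?_, ?_⟩, ?_⟩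
  · exact lift_cont ha.cont
  · exact (by fun_prop : ContinuousOn (fun p : ℝ × ℝ => 2 * p.1) (Icc 0 1 ×ˢ Ici 0)).mul (lift_cont cw)
  · have cS : ContinuousOn (fun p : ℝ × ℝ => Sf (p.1^2) (w (p.1^2) p.2)) (Icc 0 1 ×ˢ Ici 0) := by
      have h1 : Continuous (fun p : ℝ × ℝ => Sf p.1 p.2) := continuous_iff_continuousAt.2 (fun p => Sf_contAt p.1 p.2)
      exact h1.comp_continuousOn ((by fun_prop : ContinuousOn (fun p : ℝ × ℝ => p.1^2) (Icc 0 1 ×ˢ Ici 0)).prodMk (lift_cont cw))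
    exact ((lift_cont cH).sub ((lift_cont (q := fun X t => Vf X (w X t)) cV).const_mul _)).mul (cS.pow 3)
  · exact lift_cont hg.cont
  · intro t ht r hr
    have := (da t ht _ (sq_mem hr)).comp r (h := fun s => s^2) (s := Icc 0 1)
      ((hasDerivAt_pow 2 r).hasDerivWithinAt) (fun s hs => sq_mem hs)
    exact this.congr_deriv (by push_cast; ring)
  · exact fun r hr t ht => dt _ (sq_mem hr) t ht
  · intro r hr
    refine ⟨a0 r hr, w0 r hr, ?_⟩
    have d1 := (dur 0 t0 r hr).congr (fun s hs => (w0 s hs).symm) (w0 r hr).symm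
    exact (uniqueDiffOn_Icc zero_lt_one r hr).eq_deriv _ d1 (hy.2.1 r hr)
  · intro t ht
    refine ⟨by simp, ?_⟩
    simp only [one_pow]
    rw [w1 t ht]; ring
  · intro t ht r hr
    have hr' : r ∈ Icc (0:ℝ) 1 := ⟨hr.1.le, hr.2⟩
    simp only
    rw [hmc t ht r hr', ← hSf]
    obtain ⟨hp, he⟩ := hHg _ (sq_mem hr') t ht
    rw [he]; unfold oddPow; rw [if_pos hp.le]
  · intro t ht r hr
    simp only
    rw [hmc t ht r hr]
    exact (hHg _ (sq_mem hr) t ht).1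

end RF

namespace RF

set_option maxHeartbeats 1000000 in
/-- the translating profile is admissible initial data with constant speed -/
lemma profile_data {N : ℕ} {α b k ct R : ℝ} {y y' y'' : ℝ → ℝ} (hα : 0 < α) (hb : b ≤ 0) (hct : 0 < ct)
    (h : IsProfileSolOn N α b ct (Ico 0 R) y y' y'') (hR : 1 < R) (hk : y' 1 = k) :
    IsC2Data k y y' y'' ∧ y 0 = 0 ∧ (∀ r ∈ Icc (0:ℝ) 1, 0 < Hof N y' y'' r) ∧
      ∀ r ∈ Icc (0:ℝ) 1, Gof N α b y' y'' r = ct := by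
  obtain ⟨h0, h0', hd, hd', hode⟩ := h
  have hsub : Icc (0:ℝ) 1 ⊆ Ico 0 R := fun r hr => ⟨hr.1, hr.2.trans_lt hR⟩
  have z1 : (0:ℝ) ∈ Icc (0:ℝ) 1 := ⟨le_rfl, zero_le_one⟩
  have d1 : ∀ r ∈ Icc (0:ℝ) 1, HasDerivWithinAt y (y' r) (Icc 0 1) r :=
    fun r hr => (hd r (hsub hr)).mono hsub
  have d2 : ∀ r ∈ Icc (0:ℝ) 1, HasDerivWithinAt y' (y'' r) (Icc 0 1) r :=
    fun r hr => (hd' r (hsub hr)).mono hsub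
  have cp : ContinuousOn y' (Icc 0 1) := fun r hr => (d2 r hr).continuousWithinAt
  have ca : ContinuousOn (avg y' y'') (Icc 0 1) := avg_cont d2 h0'
  have hSp : ∀ r, 0 < Real.sqrt (1 + y' r ^ 2) := fun r => Real.sqrt_pos.2 (by positivity)
  have hX : ∀ r, 0 < ct / Real.sqrt (1 + y' r ^ 2) - b := by
    intro r
    have := div_pos hct (hSp r)
    linarith
  have cS : ContinuousOn (fun r => Real.sqrt (1 + y' r ^ 2)) (Icc 0 1) :=
    (continuousOn_const.add (cp.pow 2)).sqrt
  have cX : ContinuousOn (fun r => (ct / Real.sqrt (1 + y' r ^ 2) - b) ^ (1/α)) (Icc 0 1) := by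
    refine ContinuousOn.rpow_const ((continuousOn_const.div cS (fun r _ => (hSp r).ne')).sub continuousOn_const) ?_
    exact fun r _ => Or.inl (hX r).ne'
  set E : ℝ → ℝ := fun r => (1 + y' r ^ 2) * ((ct / Real.sqrt (1 + y' r ^ 2) - b) ^ (1/α) * Real.sqrt (1 + y' r ^ 2)
    - ((N:ℝ) - 1) * avg y' y'' r) with hE
  have cE : ContinuousOn E (Icc 0 1) :=
    (continuousOn_const.add (cp.pow 2)).mul ((cX.mul cS).sub (continuousOn_const.mul ca))
  have eqE : ∀ r ∈ Icc (0:ℝ) 1, r ≠ 0 → y'' r = E r := by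
    intro r hr hr0
    have := hode r (hsub hr) hr0
    unfold oddPow at this
    rw [if_pos (hX r).le] at this
    rw [hE]; simp only
    rw [← this]; unfold avg; rw [if_neg hr0]
    have : (1 + y' r ^ 2) ≠ 0 := by positivity
    field_simp
    ring
  have e0 : y'' 0 = E 0 := by
    have hio : Ioo (0:ℝ) 1 ⊆ Icc 0 1 := Ioo_subset_Icc_self
    have t1 : HasDerivWithinAt y' (E 0) (Ici 0) 0 := by
      refine hasDerivWithinAt_Ici_of_tendsto_deriv (s := Ioo 0 1)
        (fun r hr => ((d2 r (hio hr)).mono hio).differentiableWithinAt) ((cp 0 z1).mono hio)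
        (Ioo_mem_nhdsGT zero_lt_one) ?_
      have : Tendsto E (𝓝[>] 0) (𝓝 (E 0)) := by
        have h1 := (cE 0 z1).mono hio
        have h2 : 𝓝[Ioo 0 1] (0:ℝ) = 𝓝[>] 0 := nhdsWithin_Ioo_eq_nhdsGT zero_lt_one
        unfold ContinuousWithinAt at h1
        rwa [h2] at h1
      refine this.congr' ?_
      filter_upwards [Ioo_mem_nhdsGT (zero_lt_one' ℝ)] with r hr
      rw [← eqE r (hio hr) hr.1.ne']
      exact (((d2 r (hio hr)).hasDerivAt (Icc_mem_nhds hr.1 hr.2)).deriv).symm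
    exact (uniqueDiffOn_Icc zero_lt_one 0 z1).eq_deriv _ (d2 0 z1) (t1.mono (fun r hr => hr.1))
  have eqE' : ∀ r ∈ Icc (0:ℝ) 1, y'' r = E r := by
    intro r hr
    by_cases h : r = 0
    · rw [h]; exact e0
    · exact eqE r hr h
  have hHof : ∀ r ∈ Icc (0:ℝ) 1, Hof N y' y'' r = (ct / Real.sqrt (1 + y' r ^ 2) - b) ^ (1/α) := by
    intro r hr
    unfold Hof meanCurv
    have e := eqE' r hr
    rw [hE] at e
    simp only at e
    split_ifs with hr0
    · subst hr0
      rw [h0'] at e ⊢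
      simp [avg] at e ⊢
      linarith
    · rw [rpow32]
      unfold avg at e; rw [if_neg hr0] at e
      have hs := hSp r
      have hs2 : Real.sqrt (1 + y' r ^ 2) ^ 2 = 1 + y' r ^ 2 := Real.sq_sqrt (by positivity)
      rw [e]
      rw [← hs2]
      rw [Real.sqrt_sq hs.le]
      field_simp
      ring
  refine ⟨⟨d1, d2, cE.congr eqE', h0', hk⟩, h0, fun r hr => ?_, fun r hr => ?_⟩
  · rw [hHof r hr]; exact Real.rpow_pos_of_pos (hX r) _
  · unfold Gof
    rw [hHof r hr, ← Real.rpow_mul (hX r).le, one_div_mul_cancel hα.ne', Real.rpow_one]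
    have := hSp r
    field_simp
    ring

end RF

namespace RF

lemma second_test {f f' f'' : ℝ → ℝ} (h1 : ∀ r ∈ Icc (0:ℝ) 1, HasDerivWithinAt f (f' r) (Icc 0 1) r)
    {r0 : ℝ} (hr0 : r0 ∈ Icc (0:ℝ) 1) (h2 : HasDerivWithinAt f' (f'' r0) (Icc 0 1) r0)
    (h0 : f' r0 = 0) (hmax : ∀ r ∈ Icc (0:ℝ) 1, f r ≤ f r0) : f'' r0 ≤ 0 := by
  by_contra hc
  push Not at hc
  rw [hasDerivWithinAt_iff_tendsto_slope] at h2
  have h3 := h2.eventually (lt_mem_nhds hc)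
  rw [eventually_nhdsWithin_iff, Metric.eventually_nhds_iff] at h3
  obtain ⟨δ, hδ, h4⟩ := h3
  have key : ∀ x ∈ Icc (0:ℝ) 1, x ≠ r0 → |x - r0| < δ → 0 < f' x / (x - r0) := by
    intro x hx hne hd
    have := h4 (y := x) (by rw [Real.dist_eq]; exact hd) ⟨hx, hne⟩
    rw [slope_def_field, h0, sub_zero] at this
    exact this
  rcases hr0.2.eq_or_lt with he | hlt
  · subst he
    set r1 : ℝ := max 0 (1 - δ/2) with hr1
    have a1 : 0 ≤ r1 := le_max_left _ _
    have a2 : r1 < 1 := max_lt one_pos (by linarith)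
    have a3 : 1 - δ/2 ≤ r1 := le_max_right _ _
    obtain ⟨ξ, hξ, e⟩ := avg_mvt h1 a1 a2 le_rfl
    have := key ξ ⟨a1.trans hξ.1.le, hξ.2.le⟩ hξ.2.ne (by rw [abs_lt]; constructor <;> linarith [hξ.1, hξ.2])
    have hneg : f' ξ < 0 := by
      by_contra hh
      push Not at hh
      exact absurd this (not_lt.2 (div_nonpos_of_nonneg_of_nonpos hh (by linarith [hξ.2])))
    have := hmax r1 ⟨a1, a2.le⟩
    have := mul_neg_of_neg_of_pos hneg (sub_pos.2 a2)
    linarith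
  · set r1 : ℝ := min 1 (r0 + δ/2) with hr1
    have a1 : r1 ≤ 1 := min_le_left _ _
    have a2 : r0 < r1 := lt_min hlt (by linarith)
    have a3 : r1 ≤ r0 + δ/2 := min_le_right _ _
    obtain ⟨ξ, hξ, e⟩ := avg_mvt h1 hr0.1 a2 a1
    have h5 := key ξ ⟨hr0.1.trans hξ.1.le, hξ.2.le.trans a1⟩ hξ.1.ne' (by rw [abs_lt]; constructor <;> linarith [hξ.1, hξ.2])
    have h6 : 0 < f' ξ := by
      have := mul_pos h5 (sub_pos.2 hξ.1)
      rwa [div_mul_cancel₀ _ (sub_pos.2 hξ.1).ne'] at this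
    have := hmax r1 ⟨hr0.1.trans a2.le, a1⟩
    have := mul_pos h6 (sub_pos.2 a2)
    linarith

lemma time_test {f : ℝ → ℝ} {t0 d : ℝ} (ht : 0 < t0) (h : HasDerivWithinAt f d (Ici 0) t0)
    (hmax : ∀ s ∈ Icc 0 t0, f s ≤ f t0) : 0 ≤ d := by
  have h1 := (h.hasDerivAt (Ici_mem_nhds ht)).hasDerivWithinAt (s := Iio t0)
  rw [hasDerivWithinAt_iff_tendsto_slope' (by simp)] at h1
  refine ge_of_tendsto h1 ?_
  filter_upwards [Ioo_mem_nhdsLT ht] with s hs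
  rw [slope_def_field]
  have := hmax s ⟨hs.1.le, hs.2.le⟩
  exact div_nonneg_of_nonpos (by linarith) (by linarith [hs.2])

lemma first_test {f : ℝ → ℝ} {r0 d : ℝ} (hr0 : r0 ∈ Ioo (0:ℝ) 1) (h : HasDerivWithinAt f d (Icc 0 1) r0)
    (hmax : ∀ r ∈ Icc (0:ℝ) 1, f r ≤ f r0) : d = 0 := by
  have hn := Icc_mem_nhds hr0.1 hr0.2
  refine IsLocalMax.hasDerivAt_eq_zero ?_ (h.hasDerivAt hn)
  filter_upwards [hn] with r hr using hmax r hr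

variable {N : ℕ} {α b k : ℝ} {y y' y'' : ℝ → ℝ}

/-- the equation also holds at the origin -/
lemma flow_eq (hα : 0 < α) {u ur urr ut : ℝ → ℝ → ℝ} (h : IsFlowSol N α b k y y' y'' (Ici 0) u ur urr ut)
    (hp : ∀ t ∈ Ici (0:ℝ), ∀ r ∈ Icc (0:ℝ) 1, 0 < meanCurv N r (ur r t) (urr r t)) {t : ℝ} (ht : t ∈ Ici (0:ℝ)) :
    ∀ r ∈ Icc (0:ℝ) 1, ut r t = (meanCurv N r (ur r t) (urr r t) ^ α + b) * Real.sqrt (1 + ur r t ^ 2) := by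
  obtain ⟨c1, c2, c3, c4, d1, d2, d3, i0, bd, pde⟩ := h
  have sl : ContinuousOn (fun r : ℝ => (r, t)) (Icc 0 1) := by fun_prop
  have hC : IsC2Data k (fun r => u r t) (fun r => ur r t) (fun r => urr r t) :=
    ⟨d1 t ht, d2 t ht, c3.comp sl (fun r hr => ⟨hr, ht⟩), (bd t ht).1, (bd t ht).2⟩
  have hG := Gof_cont N (b := b) hα hC
  have hu : ContinuousOn (fun r => ut r t) (Icc 0 1) := c4.comp sl (fun r hr => ⟨hr, ht⟩)
  have hpos : ∀ r ∈ Ioc (0:ℝ) 1, ut r t = Gof N α b (fun r => ur r t) (fun r => urr r t) r := by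
    intro r hr
    rw [pde t ht r hr]
    unfold oddPow Gof Hof
    rw [if_pos (hp t ht r ⟨hr.1.le, hr.2⟩).le]
  have z1 : (0:ℝ) ∈ Icc (0:ℝ) 1 := ⟨le_rfl, zero_le_one⟩
  intro r hr
  rcases hr.1.eq_or_lt with h0 | h0
  · subst h0
    have hsub : Ioo (0:ℝ) 1 ⊆ Icc 0 1 := Ioo_subset_Icc_self
    have t1 := ((hu 0 z1).mono hsub).tendsto
    have t2 := ((hG 0 z1).mono hsub).tendsto
    have hne : NeBot (𝓝[Ioo 0 1] (0:ℝ)) := by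
      rw [nhdsWithin_Ioo_eq_nhdsGT zero_lt_one]; infer_instance
    refine tendsto_nhds_unique t1 (t2.congr' ?_)
    filter_upwards [self_mem_nhdsWithin] with r hr
    exact (hpos r ⟨hr.1, hr.2.le⟩).symm
  · exact hpos r ⟨h0, hr.2⟩

lemma meanCurv_mono {r p q q' : ℝ} (h : q ≤ q') : meanCurv N r p q ≤ meanCurv N r p q' := by
  unfold meanCurv
  split_ifs
  · exact mul_le_mul_of_nonneg_left h (Nat.cast_nonneg N)
  · have : q / (1 + p ^ 2) ^ ((3 : ℝ) / 2) ≤ q' / (1 + p ^ 2) ^ ((3 : ℝ) / 2) :=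
      div_le_div_of_nonneg_right h (Real.rpow_nonneg (by positivity) _)
    linarith

set_option maxHeartbeats 1000000 in
lemma flow_le (hα : 0 < α) {u ur urr ut v vr vrr vt : ℝ → ℝ → ℝ}
    (hu : IsFlowSol N α b k y y' y'' (Ici 0) u ur urr ut)
    (hup : ∀ t ∈ Ici (0:ℝ), ∀ r ∈ Icc (0:ℝ) 1, 0 < meanCurv N r (ur r t) (urr r t))
    (hv : IsFlowSol N α b k y y' y'' (Ici 0) v vr vrr vt)
    (hvp : ∀ t ∈ Ici (0:ℝ), ∀ r ∈ Icc (0:ℝ) 1, 0 < meanCurv N r (vr r t) (vrr r t)) :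
    ∀ t ∈ Ici (0:ℝ), ∀ r ∈ Icc (0:ℝ) 1, v r t ≤ u r t := by
  intro T hT r hr
  have hequ := fun t ht => flow_eq hα hu hup (t := t) ht
  have heqv := fun t ht => flow_eq hα hv hvp (t := t) ht
  obtain ⟨c1, -, -, -, d1, d2, d3, i0, bd, -⟩ := hu
  obtain ⟨C1, -, -, -, D1, D2, D3, I0, BD, -⟩ := hv
  have T0 : (0:ℝ) ≤ T := hT
  have main : ∀ ε > 0, v r T - u r T - ε * T ≤ 0 := by
    intro ε hε
    have hK : IsCompact (Icc (0:ℝ) 1 ×ˢ Icc (0:ℝ) T) := isCompact_Icc.prod isCompact_Icc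
    have hs : Icc (0:ℝ) 1 ×ˢ Icc (0:ℝ) T ⊆ Icc (0:ℝ) 1 ×ˢ Ici (0:ℝ) := prod_mono le_rfl (fun t ht => ht.1)
    have hc : ContinuousOn (fun p : ℝ × ℝ => v p.1 p.2 - u p.1 p.2 - ε * p.2) (Icc (0:ℝ) 1 ×ˢ Icc (0:ℝ) T) :=
      ((C1.mono hs).sub (c1.mono hs)).sub (by fun_prop)
    obtain ⟨⟨r0, t0⟩, ⟨hr0, ht0⟩, hmax⟩ := hK.exists_isMaxOn ⟨(r, T), hr, T0, le_rfl⟩ hc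
    have hmx : ∀ s ∈ Icc (0:ℝ) 1, ∀ t ∈ Icc (0:ℝ) T, v s t - u s t - ε * t ≤ v r0 t0 - u r0 t0 - ε * t0 :=
      fun s hs t ht => hmax (a := (s, t)) ⟨hs, ht⟩
    simp only at hr0 ht0
    rcases ht0.1.eq_or_lt with h0 | h0
    · have := hmx r hr T ⟨T0, le_rfl⟩
      rw [← h0, (i0 r0 hr0).1, (I0 r0 hr0).1] at this
      linarith
    · exfalso
      have ht : t0 ∈ Ici (0:ℝ) := h0.le
      have tt : 0 ≤ vt r0 t0 - ut r0 t0 - ε := by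
        have hd := ((D3 r0 hr0 t0 ht).sub (d3 r0 hr0 t0 ht)).sub
          (((hasDerivAt_id t0).const_mul ε).hasDerivWithinAt (s := Ici 0))
        rw [mul_one] at hd
        exact time_test h0 hd (fun s hs => hmx r0 hr0 s ⟨hs.1, hs.2.trans ht0.2⟩)
      have df : ∀ s ∈ Icc (0:ℝ) 1, HasDerivWithinAt (fun s => v s t0 - u s t0) (vr s t0 - ur s t0) (Icc 0 1) s :=
        fun s hs => (D1 t0 ht s hs).sub (d1 t0 ht s hs)
      have hsm : ∀ s ∈ Icc (0:ℝ) 1, v s t0 - u s t0 ≤ v r0 t0 - u r0 t0 := by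
        intro s hs
        have := hmx s hs t0 ht0
        linarith
      have e1 : vr r0 t0 - ur r0 t0 = 0 := by
        rcases hr0.1.eq_or_lt with h | h
        · rw [← h, (bd t0 ht).1, (BD t0 ht).1, sub_zero]
        · rcases hr0.2.eq_or_lt with h' | h'
          · rw [h', (bd t0 ht).2, (BD t0 ht).2, sub_self]
          · exact first_test ⟨h, h'⟩ (df r0 hr0) hsm
      have e2 : vrr r0 t0 - urr r0 t0 ≤ 0 :=
        second_test (f'' := fun r => vrr r t0 - urr r t0) df hr0 ((D2 t0 ht r0 hr0).sub (d2 t0 ht r0 hr0)) e1 hsm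
      have e3 : meanCurv N r0 (vr r0 t0) (vrr r0 t0) ≤ meanCurv N r0 (ur r0 t0) (urr r0 t0) := by
        rw [sub_eq_zero.1 e1]; exact meanCurv_mono (by linarith)
      have e4 : vt r0 t0 ≤ ut r0 t0 := by
        rw [hequ t0 ht r0 hr0, heqv t0 ht r0 hr0, sub_eq_zero.1 e1]
        rw [sub_eq_zero.1 e1] at e3
        refine mul_le_mul_of_nonneg_right ?_ (Real.sqrt_nonneg _)
        have := Real.rpow_le_rpow (z := α) (by have := (hvp t0 ht r0 hr0).le; rwa [sub_eq_zero.1 e1] at this) e3 hα.le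
        linarith
      linarith
  by_contra hc
  push Not at hc
  have hd : 0 < v r T - u r T := by linarith
  have := main ((v r T - u r T) / (2 * (T + 1))) (by positivity)
  have h2 : (v r T - u r T) / (2 * (T + 1)) * T ≤ (v r T - u r T) / 2 := by
    rw [div_mul_eq_mul_div, div_le_div_iff₀ (by positivity) (by positivity)]
    nlinarith
  linarith

end RF

namespace RF

lemma sup_conv {W : ℝ → ℝ → ℝ} {A κ : ℝ} (hκ : 0 < κ)
    (h : ∀ X ∈ Icc (0:ℝ) 1, ∀ t t' : ℝ, 0 ≤ t → t ≤ t' → |W X t' - W 0 t| ≤ A * Real.exp (-κ * t)) :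
    ∃ M : ℝ, Tendsto (fun t : ℝ => ⨆ r : Icc (0:ℝ) 1, |W (r.1^2) t|) atTop (𝓝 M) := by
  have z1 : (0:ℝ) ∈ Icc (0:ℝ) 1 := ⟨le_rfl, zero_le_one⟩
  have hE : Tendsto (fun t : ℝ => A * Real.exp (-κ * t)) atTop (𝓝 0) := by
    have : Tendsto (fun t : ℝ => -κ * t) atTop atBot := tendsto_id.const_mul_atTop_of_neg (by linarith)
    simpa using (Real.tendsto_exp_atBot.comp this).const_mul A
  have hc : CauchySeq (fun t : ℝ => W 0 t) := by
    rw [Metric.cauchySeq_iff']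
    intro ε hε
    obtain ⟨T, h1, h2⟩ := ((hE.eventually (gt_mem_nhds hε)).and (eventually_ge_atTop 0)).exists
    refine ⟨T, fun t ht => ?_⟩
    rw [Real.dist_eq]
    exact (h 0 z1 T t h2 ht).trans_lt h1
  obtain ⟨w, hw⟩ := cauchySeq_tendsto_of_complete hc
  refine ⟨|w|, ?_⟩
  have h0 : ∀ t, 0 ≤ t → |w - W 0 t| ≤ A * Real.exp (-κ * t) := by
    intro t ht
    refine le_of_tendsto ((hw.sub_const (W 0 t)).abs) ?_
    filter_upwards [eventually_ge_atTop t] with t' ht' using h 0 z1 t t' ht ht'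
  have hX : ∀ t, 0 ≤ t → ∀ X ∈ Icc (0:ℝ) 1, |(|W X t| - |w|)| ≤ 2 * (A * Real.exp (-κ * t)) := by
    intro t ht X hX
    refine (abs_abs_sub_abs_le_abs_sub _ _).trans ?_
    have e1 := h0 t ht
    have e2 := h X hX t t ht le_rfl
    rw [abs_le] at *
    constructor <;> linarith
  have hne : Nonempty (Icc (0:ℝ) 1) := ⟨⟨0, z1⟩⟩
  rw [tendsto_iff_dist_tendsto_zero]
  have hE2 : Tendsto (fun t : ℝ => 2 * (A * Real.exp (-κ * t))) atTop (𝓝 0) := by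
    have := hE.const_mul 2
    rwa [mul_zero] at this
  refine squeeze_zero' (Eventually.of_forall fun t => dist_nonneg) ?_ hE2
  filter_upwards [eventually_ge_atTop 0] with t ht
  rw [Real.dist_eq]
  have hb : ∀ r : Icc (0:ℝ) 1, |W (r.1^2) t| ≤ |w| + 2 * (A * Real.exp (-κ * t)) := by
    intro r
    have := hX t ht _ (sq_mem r.2)
    rw [abs_le] at this
    linarith
  have u1 := ciSup_le hb
  have u2 := le_ciSup (f := fun r : Icc (0:ℝ) 1 => |W (r.1^2) t|) ⟨_, forall_mem_range.2 hb⟩ ⟨0, z1⟩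
  have u3 := hX t ht _ (sq_mem z1)
  simp only at u2
  rw [abs_le] at u3 ⊢
  constructor <;> linarith

lemma decay_one {ν l L C : ℝ} {n : ℕ} {τ e K0 κ' A : ℝ} {Z : ℕ → ℕ → ℝ} {ψ : ℕ → ℕ → ℝ}
    (hν : 0 < ν) (hl : 0 < l) (hC : 0 ≤ C) (hK : 0 ≤ K0) (hκ : 0 < κ') (hA : 0 < A) (he : 0 ≤ e)
    (hcfl : CFL ν L C n τ)
    (h : ∀ j, LinStep ν l L C n τ e (Z j) (Z (j+1)))
    (hdiag : ∀ i ≤ n, τ * κ' ≤ ψ i i)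
    (hmono : ∀ i j, j < i → i ≤ n → ψ i j ≤ ψ (i+1) j)
    (hψ : ∀ i j, j < i → i ≤ n → ∀ a b a' b', LinCoef ν l L C n i a b → LinCoef ν l L C n j a' b' →
      n * (a * (ψ (i+1) j - ψ i j) - b * (ψ i j - ψ (i-1) j)
        + a' * (ψ i (j+1) - ψ i j) - b' * (ψ i j - ψ i (j-1))) ≤ -κ')
    (hbd : ∀ i j, j ≤ i → i ≤ n → 1/2 ≤ ψ i j ∧ ψ i j ≤ A)
    (hZ : ∀ i j, j ≤ i → i ≤ n → Z 0 i - Z 0 j ≤ K0 * ψ i j) :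
    ∀ s : ℕ, ∀ i j, j ≤ i → i ≤ n →
      Z s i - Z s j ≤ (K0 * Real.exp (-(κ'/A) * (s * τ)) + 4 * e / (κ'/A)) * ψ i j := by
  intro s
  have hτ := hcfl.1
  set κ := κ'/A with hκd
  have hκp : 0 < κ := by positivity
  induction s with
  | zero =>
    intro i j hji hi
    have h1 := hZ i j hji hi
    have h2 := (hbd i j hji hi).1
    have h3 : 0 ≤ 4 * e / κ * ψ i j := by positivity
    simp only [CharP.cast_eq_zero, zero_mul, mul_zero, Real.exp_zero, mul_one]
    rw [add_mul]
    linarith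
  | succ s ih =>
    intro i j hji hi
    set Ks := K0 * Real.exp (-κ * (s * τ)) + 4 * e / κ with hKs
    have hKs0 : 0 ≤ Ks := by positivity
    have h1 := LinStep.two hν hl hC le_rfl hKs0 he hcfl (h s) hdiag hmono hψ
      (fun i j a b => by rw [zero_add]; exact ih i j a b) i j hji hi
    obtain ⟨b1, b2⟩ := hbd i j hji hi
    have hp : 0 ≤ ψ i j := by linarith
    have c1 : Ks * (τ * κ * ψ i j) ≤ Ks * (τ * κ') := by
      refine mul_le_mul_of_nonneg_left ?_ hKs0
      have : κ' = κ * A := by rw [hκd]; field_simp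
      rw [this, mul_assoc]
      exact mul_le_mul_of_nonneg_left (mul_le_mul_of_nonneg_left b2 hκp.le) hτ.le
    have c2 : 2 * τ * e * 1 ≤ 2 * τ * e * (2 * ψ i j) :=
      mul_le_mul_of_nonneg_left (by linarith) (by positivity)
    have c3 : (1 - κ * τ) * (K0 * Real.exp (-κ * (s * τ))) ≤ K0 * Real.exp (-κ * ((s+1:ℕ) * τ)) := by
      have e1 : Real.exp (-κ * ((s+1:ℕ) * τ)) = Real.exp (-(κ*τ)) * Real.exp (-κ * (s * τ)) := by
        rw [← Real.exp_add]; congr 1; push_cast; ring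
      rw [e1]
      have := Real.add_one_le_exp (-(κ*τ))
      have h5 : 0 ≤ K0 * Real.exp (-κ * (s * τ)) := by positivity
      have := mul_le_mul_of_nonneg_right this h5
      linarith
    have c4 : (1 - κ * τ) * Ks + 4 * τ * e ≤ K0 * Real.exp (-κ * ((s+1:ℕ) * τ)) + 4 * e / κ := by
      have : (1 - κ * τ) * Ks + 4 * τ * e = (1 - κ * τ) * (K0 * Real.exp (-κ * (s * τ))) + 4 * e / κ := by
        rw [hKs]; field_simp; ring
      linarith
    have c5 := mul_le_mul_of_nonneg_right c4 hp
    have e5 : ((1 - κ * τ) * Ks + 4 * τ * e) * ψ i j = Ks * ψ i j - Ks * (τ * κ * ψ i j) + 2 * τ * e * (2 * ψ i j) := by ring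
    have e6 : Ks * (ψ i j - τ * κ') = Ks * ψ i j - Ks * (τ * κ') := by ring
    linarith

/-- uniform oscillation decay -/
lemma osc_decay {ν l L C : ℝ} (hν : 0 < ν) (hl : 0 < l) (hlL : l ≤ L) (hC : 0 < C) :
    ∃ A κ : ℝ, 0 < A ∧ 0 < κ ∧ ∃ n0 : ℕ, ∀ n ≥ n0, CFL ν L C n (1/(n:ℝ)^4) → ∀ (e B : ℝ) (Z : ℕ → ℕ → ℝ),
      0 ≤ e → 0 ≤ B → (∀ j, LinStep ν l L C n (1/(n:ℝ)^4) e (Z j) (Z (j+1))) → (∀ i ≤ n, |Z 0 i| ≤ B) →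
      ∀ s : ℕ, ∀ i ≤ n, ∀ j ≤ n,
        |Z s i - Z s j| ≤ A * (4 * B * Real.exp (-κ * (s * (1/(n:ℝ)^4))) + 4 * e / κ) := by
  obtain ⟨A, γ, κ', hA, -, hκ, hpsi⟩ := psi_exists hν hl hlL hC
  obtain ⟨ψ, hψ, n1, hn1, hψ2⟩ := hpsi 1 one_pos le_rfl
  obtain ⟨n2, hn2⟩ := tau_le (c := 1/2) (κ := κ') (by norm_num) hκ.le
  refine ⟨A, κ'/A, hA, by positivity, max n1 n2, fun n hn hcfl e B Z he hB hZ hZ0 s => ?_⟩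
  have hn' := (le_max_left _ _).trans hn
  have hnpos : 0 < n := by omega
  have hbd : ∀ i j : ℕ, j ≤ i → i ≤ n → 1/2 ≤ ψ ((i:ℝ)/n) ((j:ℝ)/n) ∧ ψ ((i:ℝ)/n) ((j:ℝ)/n) ≤ A := by
    intro i j hji hi
    have hle : (j:ℝ)/n ≤ (i:ℝ)/n := by gcongr
    obtain ⟨a, b, -⟩ := hψ ((i:ℝ)/n) ((j:ℝ)/n) (xg_nonneg _ _) hle (xg_le_one hi)
    rw [div_one] at b
    exact ⟨by linarith, b⟩
  have key : ∀ Z : ℕ → ℕ → ℝ, (∀ j, LinStep ν l L C n (1/(n:ℝ)^4) e (Z j) (Z (j+1))) → (∀ i ≤ n, |Z 0 i| ≤ B) →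
      ∀ i j, j ≤ i → i ≤ n →
        Z s i - Z s j ≤ A * (4 * B * Real.exp (-(κ'/A) * (s * (1/(n:ℝ)^4))) + 4 * e / (κ'/A)) := by
    intro Z hZ hZ0 i j hji hi
    have h1 := decay_one (K0 := 4 * B) (κ' := κ') (A := A) (ψ := fun i j => ψ ((i:ℝ)/n) ((j:ℝ)/n)) hν hl hC.le (by positivity) hκ hA he hcfl hZ
      (fun i hi => (hn2 n ((le_max_right _ _).trans hn)).trans (hbd i i le_rfl hi).1)
      (hψ2 n hn').1 (hψ2 n hn').2 hbd ?_ s i j hji hi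
    · refine h1.trans ?_
      rw [mul_comm A]
      exact mul_le_mul_of_nonneg_left (hbd i j hji hi).2 (by positivity)
    · intro i j hji hi
      have a1 := abs_le.1 (hZ0 i hi)
      have a2 := abs_le.1 (hZ0 j (hji.trans hi))
      have a3 := mul_le_mul_of_nonneg_left (hbd i j hji hi).1 (by positivity : 0 ≤ 4 * B)
      linarith
  have k1 := key Z hZ hZ0
  have k2 := key (fun s i => - Z s i) (fun j => (hZ j).neg) (fun i hi => by rw [abs_neg]; exact hZ0 i hi)
  intro i hi j hj
  rw [abs_le]
  rcases le_total j i with h | h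
  · have := k1 i j h hi
    have := k2 i j h hi
    constructor <;> linarith
  · have := k1 j i h hj
    have := k2 j i h hj
    constructor <;> linarith

lemma drift {ν l L C : ℝ} {n : ℕ} {τ e Q1 Q2 : ℝ} {Z : ℕ → ℕ → ℝ}
    (hν : 0 < ν) (hl : 0 < l) (hC : 0 ≤ C) (hcfl : CFL ν L C n τ)
    (h : ∀ j, LinStep ν l L C n τ e (Z j) (Z (j+1))) {s : ℕ} (hs : ∀ i ≤ n, Q1 ≤ Z s i ∧ Z s i ≤ Q2) :
    ∀ q : ℕ, ∀ i ≤ n, Q1 - q * τ * e ≤ Z (s+q) i ∧ Z (s+q) i ≤ Q2 + q * τ * e := by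
  intro q
  induction q with
  | zero => intro i hi; simpa using hs i hi
  | succ q ih =>
    intro i hi
    have h1 := LinStep.max hν hl hC hcfl (h (s+q)) (fun i hi => (ih i hi).2) i hi
    have h2 := LinStep.min hν hl hC hcfl (h (s+q)) (fun i hi => (ih i hi).1) i hi
    rw [← add_assoc]
    push_cast
    constructor <;> linarith

end RF

namespace RF

variable {N : ℕ} {ν α b k m M P l L C H1 H2 S : ℝ} {n1 : ℕ} {u : ℕ → ℕ → ℕ → ℝ}

lemma Sch.diff_step (h : Sch ν α b k m M P l L C H1 H2 S n1 u) {n : ℕ} (hn : n1 ≤ n) {φ : ℕ → ℝ} {ct e : ℝ}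
    (hφ : Inv ν α b n m M P (Ud k n φ)) (he : ∀ i ≤ n, |Fd ν α b n (Ud k n φ) i - ct| ≤ e) (s : ℕ) :
    LinStep ν l L C n (1/(n:ℝ)^4) e (fun i => u n s i - φ i - ct * (s * (1/(n:ℝ)^4)))
      (fun i => u n (s+1) i - φ i - ct * ((s+1:ℕ) * (1/(n:ℝ)^4))) := by
  intro i hi
  obtain ⟨p, q, hpq, hd⟩ := h.dec n hn _ _ hφ (h.inv n hn s) i hi
  refine ⟨p, q, hpq, ?_⟩
  have hτ := (h.cfl n hn).1
  set τ : ℝ := 1/(n:ℝ)^4 with hτd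
  have hl := lin_ident (n := n) (i := i) (τ := 1) (p := p) (q := q)
    (Y := fun i => u n s i - φ i - ct * (s * τ)) (D := fun i => Ud k n (u n s) i - Ud k n φ i) hi
    (fun h0 => by subst h0; exact hpq.b_zero) (fun i => by
      unfold Ud
      split_ifs
      · ring
      · ring)
  have hs : u n (s+1) i = u n s i + τ * Fd ν α b n (Ud k n (u n s)) i := by
    rw [h.stepu]; rfl
  have e1 : Fd ν α b n (Ud k n (u n s)) i = Fd ν α b n (Ud k n φ) i +
      (n * (p * (if i < n then u n s (i+1) - φ (i+1) - ct * (s * τ) - (u n s i - φ i - ct * (s * τ)) else 0)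
        - q * (u n s i - φ i - ct * (s * τ) - (u n s (i-1) - φ (i-1) - ct * (s * τ))))) := by
    have : Fd ν α b n (Ud k n (u n s)) i = Fd ν α b n (Ud k n φ) i + (Fd ν α b n (Ud k n (u n s)) i - Fd ν α b n (Ud k n φ) i) := by ring
    rw [this, hd, hl]; ring
  simp only
  have e2 : u n (s+1) i - φ i - ct * ((s+1:ℕ) * τ) - (u n s i - φ i - ct * (s * τ) +
      τ * n * (p * (if i < n then u n s (i+1) - φ (i+1) - ct * (s * τ) - (u n s i - φ i - ct * (s * τ)) else 0)
        - q * (u n s i - φ i - ct * (s * τ) - (u n s (i-1) - φ (i-1) - ct * (s * τ)))))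
      = τ * (Fd ν α b n (Ud k n φ) i - ct) := by
    rw [hs, e1]; push_cast; ring
  rw [e2, abs_mul, abs_of_pos hτ]
  exact mul_le_mul_of_nonneg_left (he i hi) hτ.le

set_option maxHeartbeats 1000000 in
lemma Sch.conv (h : Sch ν α b k m M P l L C H1 H2 S n1 u) {φ : ℕ → ℕ → ℝ} {ct B : ℝ} {n4 : ℕ} (hB : 0 ≤ B)
    (hφ : ∀ n ≥ n1, Inv ν α b n m M P (Ud k n (φ n)))
    (he : ∀ ε > 0, ∃ n0 : ℕ, ∀ n ≥ n0, ∀ i ≤ n, |Fd ν α b n (Ud k n (φ n)) i - ct| ≤ ε)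
    (hb : ∀ n ≥ n4, ∀ i ≤ n, |u n 0 i - φ n i| ≤ B)
    {a : ℝ → ℝ → ℝ} (ha : Lim u a) {f : ℝ → ℝ} (hf : Lim (fun n _ i => φ n i) (fun X _ => f X)) :
    ∃ A κ : ℝ, 0 < κ ∧ ∀ X ∈ Icc (0:ℝ) 1, ∀ t t' : ℝ, 0 ≤ t → t ≤ t' →
      |(a X t' - f X - ct * t') - (a 0 t - f 0 - ct * t)| ≤ A * Real.exp (-κ * t) := by
  obtain ⟨A, κ, hA, hκ, n2, hdec⟩ := osc_decay h.ν_pos h.hl h.hlL h.hC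
  refine ⟨A * (4 * B), κ, hκ, fun X hX t t' ht htt' => ?_⟩
  have z1 : (0:ℝ) ∈ Icc (0:ℝ) 1 := ⟨le_rfl, zero_le_one⟩
  have ht' : t' ∈ Ici (0:ℝ) := ht.trans htt'
  set w : ℕ → ℕ → ℕ → ℝ := fun n s i => u n s i - φ n i - ct * (s * (1/(n:ℝ)^4)) with hw
  have lw : ∀ X ∈ Icc (0:ℝ) 1, ∀ t ∈ Ici (0:ℝ), Tendsto (fun z : ℕ × ℕ × ℕ => w z.1 z.2.1 z.2.2) (Lf X t)
      (𝓝 (a X t - f X - ct * t)) :=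
    fun X hX t ht => ((ha X hX t ht).sub (hf X hX t ht)).sub ((Lf_t X t).const_mul ct)
  have c1 := (lw X hX t' ht').comp (tendsto_floor hX ht')
  have c2 := (lw 0 z1 t ht).comp (tendsto_floor z1 ht)
  have c3 := (floor_t ht).const_mul (-κ)
  have key : ∀ e > 0, |(a X t' - f X - ct * t') - (a 0 t - f 0 - ct * t)| ≤
      A * (4 * B * Real.exp (-κ * t) + 4 * e / κ) + t' * e := by
    intro e hpos
    obtain ⟨n3, hn3⟩ := he e hpos
    have c4 : Tendsto (fun n : ℕ => A * (4 * B * Real.exp (-κ * (((⌊t * (n:ℝ)^4⌋₊:ℕ):ℝ) * (1/(n:ℝ)^4))) + 4 * e / κ) + t' * e)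
        (hyperfilter ℕ : Filter ℕ) (𝓝 (A * (4 * B * Real.exp (-κ * t) + 4 * e / κ) + t' * e)) :=
      ((((Real.continuous_exp.tendsto _).comp c3).const_mul (4*B)).add_const _ |>.const_mul A).add_const _
    refine le_of_tendsto_of_tendsto (c1.sub c2).abs c4 ?_
    filter_upwards [hyper_ge n1, hyper_ge n2, hyper_ge n3, hyper_ge n4] with n hn1 hn2 hn3' hn4
    simp only [Function.comp]
    set s := ⌊t * (n:ℝ)^4⌋₊ with hs
    set s' := ⌊t' * (n:ℝ)^4⌋₊ with hs'
    have hss : s ≤ s' := Nat.floor_le_floor (mul_le_mul_of_nonneg_right htt' (by positivity))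
    have hn0 : (0:ℝ) < n := by exact_mod_cast h.pos n hn1
    have hs't : (s':ℝ) * (1/(n:ℝ)^4) ≤ t' := by
      have := Nat.floor_le (mul_nonneg ht' (by positivity : 0 ≤ (n:ℝ)^4))
      rw [mul_one_div, div_le_iff₀ (by positivity)]
      exact this
    have hstep : ∀ j, LinStep ν l L C n (1/(n:ℝ)^4) e (w n j) (w n (j+1)) :=
      fun j => h.diff_step hn1 (hφ n hn1) (hn3 n hn3') j
    have hosc := hdec n hn2 (h.cfl n hn1) e B (w n) hpos.le hB hstep
      (fun i hi => by have := hb n hn4 i hi; simpa [hw] using this) s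
    set O := A * (4 * B * Real.exp (-κ * (s * (1/(n:ℝ)^4))) + 4 * e / κ) with hO
    have hd := drift (s := s) (Q1 := w n s 0 - O) (Q2 := w n s 0 + O) h.ν_pos h.hl h.hC.le (h.cfl n hn1) hstep (fun i hi => by
      have := abs_le.1 (hosc i hi 0 (Nat.zero_le _))
      constructor <;> linarith) (s' - s) ⌊X * n⌋₊ (floor_le hX.2 n)
    rw [Nat.add_sub_cancel' hss] at hd
    have hq : ((s' - s : ℕ):ℝ) * (1/(n:ℝ)^4) * e ≤ t' * e := by
      refine mul_le_mul_of_nonneg_right (le_trans ?_ hs't) hpos.le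
      exact mul_le_mul_of_nonneg_right (by exact_mod_cast Nat.sub_le _ _) (by positivity)
    have e0 : ⌊(0:ℝ) * n⌋₊ = 0 := by simp
    rw [e0, abs_le]
    constructor <;> linarith [hd.1, hd.2]
  have lim : Tendsto (fun e : ℝ => A * (4 * B * Real.exp (-κ * t) + 4 * e / κ) + t' * e) (𝓝[>] 0)
      (𝓝 (A * (4 * B * Real.exp (-κ * t) + 4 * 0 / κ) + t' * 0)) := by
    refine tendsto_nhdsWithin_of_tendsto_nhds (Continuous.tendsto ?_ 0)
    fun_prop
  have := ge_of_tendsto lim (by filter_upwards [self_mem_nhdsWithin] with e he using key e he)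
  refine this.trans (le_of_eq ?_)
  ring

end RF

namespace RF

variable {N : ℕ} {α b k : ℝ} {y y' y'' : ℝ → ℝ}

lemma sqrt_mem' {X : ℝ} (hX : X ∈ Icc (0:ℝ) 1) : Real.sqrt X ∈ Icc (0:ℝ) 1 :=
  ⟨Real.sqrt_nonneg _, Real.sqrt_le_one.2 hX.2⟩

lemma init_mod (hα : 0 < α) (hy : IsC2Data k y y' y'') (hH : ∀ r ∈ Icc (0:ℝ) 1, 0 < Hof N y' y'' r) :
    ∀ ε > 0, ∃ K, 0 ≤ K ∧ ∃ n0 : ℕ, ∀ n ≥ n0, ∀ i ≤ n, ∀ j ≤ n,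
      |Fd N α b n (Ud k n (usum (y 0) y' y'' n)) i - Fd N α b n (Ud k n (usum (y 0) y' y'' n)) j|
        ≤ ε + K * |(i:ℝ)/n - (j:ℝ)/n| := by
  intro ε hε
  obtain ⟨n0, h0⟩ := data_Fd N (b := b) hα hy hH (by positivity : 0 < ε/4)
  have hG := Gof_cont N (b := b) hα hy
  have hG2 : ContinuousOn (fun X => Gof N α b y' y'' (Real.sqrt X)) (Icc 0 1) :=
    hG.comp Real.continuous_sqrt.continuousOn (fun X hX => sqrt_mem' hX)
  obtain ⟨δ, hδ, h1⟩ := unif_mod hG2 (by positivity : 0 < ε/4)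
  obtain ⟨B, hB⟩ := isCompact_Icc.exists_bound_of_continuousOn hG2
  have hB0 : 0 ≤ B := (norm_nonneg _).trans (hB 0 ⟨le_rfl, zero_le_one⟩)
  refine ⟨2 * B / δ, by positivity, max n0 1, fun n hn i hi j hj => ?_⟩
  have hn1 : 0 < n := (le_max_right n0 1).trans hn
  have hc : ∀ i ≤ n, Ud k n (usum (y 0) y' y'' n) i = (fun i : ℕ => Us y' y'' ((i:ℝ)/n)) i :=
    fun i hi => Ud_usum hy.2.2.2.2 hn1 hi
  rw [(Hd_congr (ν := N) (α := α) (b := b) hc hi).2, (Hd_congr (ν := N) (α := α) (b := b) hc hj).2]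
  have a1 := (h0 n ((le_max_left _ _).trans hn) i hi).2
  have a2 := (h0 n ((le_max_left _ _).trans hn) j hj).2
  have xi : (i:ℝ)/n ∈ Icc (0:ℝ) 1 := ⟨xg_nonneg _ _, xg_le_one hi⟩
  have xj : (j:ℝ)/n ∈ Icc (0:ℝ) 1 := ⟨xg_nonneg _ _, xg_le_one hj⟩
  have hK : 0 ≤ 2 * B / δ * |(i:ℝ)/n - (j:ℝ)/n| := by positivity
  rcases le_total |(i:ℝ)/n - (j:ℝ)/n| δ with hd | hd
  · have a3 := h1 _ xi _ xj hd
    rw [abs_le] at a1 a2 a3 ⊢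
    constructor <;> linarith
  · have a3 := hB _ xi
    have a4 := hB _ xj
    have a5 : 2 * B / δ * δ ≤ 2 * B / δ * |(i:ℝ)/n - (j:ℝ)/n| := mul_le_mul_of_nonneg_left hd (by positivity)
    rw [div_mul_cancel₀ _ hδ.ne'] at a5
    rw [Real.norm_eq_abs] at a3 a4
    rw [abs_le] at a1 a2 a3 a4 ⊢
    constructor <;> linarith

lemma usum_lim (hy : IsC2Data k y y' y'') :
    Lim (fun n _ i => usum (y 0) y' y'' n i) (fun X _ => y (Real.sqrt X)) := by
  intro X hX t ht
  have hc : ContinuousOn (fun X : ℝ => y (Real.sqrt X)) (Icc 0 1) := by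
    have : ContinuousOn y (Icc 0 1) := fun r hr => (hy.1 r hr).continuousWithinAt
    exact this.comp Real.continuous_sqrt.continuousOn (fun X hX => sqrt_mem' hX)
  have c2 : Tendsto (fun z : ℕ × ℕ × ℕ => y (Real.sqrt ((z.2.2:ℝ)/z.1))) (Lf X t) (𝓝 (y (Real.sqrt X))) := by
    refine (hc X hX).tendsto.comp (tendsto_nhdsWithin_iff.2 ⟨Lf_X X t, ?_⟩)
    filter_upwards [Lf_le X t] with z hz using ⟨xg_nonneg _ _, xg_le_one hz⟩
  have c3 : Tendsto (fun z : ℕ × ℕ × ℕ => usum (y 0) y' y'' z.1 z.2.2 - y (Real.sqrt ((z.2.2:ℝ)/z.1))) (Lf X t) (𝓝 0) := by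
    rw [Metric.tendsto_nhds]
    intro ε hε
    obtain ⟨n0, hn0⟩ := sum_consist hy (half_pos hε)
    filter_upwards [Lf_ev X t n0] with z hz
    rw [Real.dist_eq, sub_zero]
    have := hn0 z.1 hz.1 _ hz.2
    linarith
  have := c3.add c2
  rw [zero_add] at this
  exact this.congr (fun z => by ring)

lemma usum_inv {m M P ε : ℝ} (hα : 0 < α) (hy : IsC2Data k y y' y'')
    (hH : ∀ r ∈ Icc (0:ℝ) 1, 0 < Hof N y' y'' r) (hε : 0 < ε)
    (hG : ∀ r ∈ Icc (0:ℝ) 1, m + ε ≤ Gof N α b y' y'' r ∧ Gof N α b y' y'' r ≤ M - ε)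
    (hP : ∀ r ∈ Icc (0:ℝ) 1, |y' r| ≤ P) :
    ∃ n0 : ℕ, ∀ n ≥ n0, Inv N α b n m M P (Ud k n (usum (y 0) y' y'' n)) := by
  obtain ⟨n0, h0⟩ := sample_inv N hα hy hH hε hG hP
  refine ⟨max n0 1, fun n hn => ?_⟩
  exact Inv_congr (fun i hi => Ud_usum hy.2.2.2.2 ((le_max_right n0 1).trans hn) hi)
    (h0 n ((le_max_left _ _).trans hn))

lemma usum_bd (hy : IsC2Data k y y' y'') :
    ∃ B, 0 ≤ B ∧ ∃ n0 : ℕ, ∀ n ≥ n0, ∀ i ≤ n, |usum (y 0) y' y'' n i| ≤ B := by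
  have : ContinuousOn y (Icc 0 1) := fun r hr => (hy.1 r hr).continuousWithinAt
  obtain ⟨B, hB⟩ := isCompact_Icc.exists_bound_of_continuousOn this
  have hB0 : 0 ≤ B := (norm_nonneg _).trans (hB 0 ⟨le_rfl, zero_le_one⟩)
  obtain ⟨n0, hn0⟩ := sum_consist hy one_pos
  refine ⟨B + 1, by positivity, n0, fun n hn i hi => ?_⟩
  have h1 := hn0 n hn i hi
  have h2 := hB _ (sqrt_mem hi)
  rw [Real.norm_eq_abs] at h2
  rw [abs_le] at *
  constructor <;> linarith

set_option maxHeartbeats 1000000 in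
theorem main_thm (N : ℕ) (hN : 1 < N) (α b k : ℝ) (hα : 0 < α) (hb : b ≤ 0) (hk : 0 < k)
    (u₀ u₀' u₀'' : ℝ → ℝ) (hdata : IsC2Data k u₀ u₀' u₀'')
    (hH0 : ∀ r ∈ Set.Icc (0 : ℝ) 1,
      0 < meanCurv N r (u₀' r) (u₀'' r) ∧
      0 < oddPow (meanCurv N r (u₀' r) (u₀'' r)) α + b)
    (ct RΦ : ℝ) (Φ Φ' Φ'' : ℝ → ℝ) (hct : 0 < ct)
    (hΦ : IsProfileSolOn N α b ct (Ico 0 RΦ) Φ Φ' Φ'') (hRΦ : 1 < RΦ) (hΦk : Φ' 1 = k) :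
    ∃ u ur urr ut : ℝ → ℝ → ℝ,
      IsFlowSol N α b k u₀ u₀' u₀'' (Set.Ici 0) u ur urr ut ∧
      (∀ t ∈ Set.Ici (0 : ℝ), ∀ r ∈ Set.Icc (0 : ℝ) 1,
        0 < meanCurv N r (ur r t) (urr r t)) ∧
      (∀ v vr vrr vt : ℝ → ℝ → ℝ,
        IsFlowSol N α b k u₀ u₀' u₀'' (Set.Ici 0) v vr vrr vt →
        (∀ t ∈ Set.Ici (0 : ℝ), ∀ r ∈ Set.Icc (0 : ℝ) 1,
          0 < meanCurv N r (vr r t) (vrr r t)) →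
        ∀ t ∈ Set.Ici (0 : ℝ), ∀ r ∈ Set.Icc (0 : ℝ) 1, v r t = u r t) ∧
      ∃ M : ℝ,
        Filter.Tendsto
          (fun t : ℝ => ⨆ r : Set.Icc (0 : ℝ) 1, |u r.1 t - Φ r.1 - ct * t|)
          Filter.atTop (nhds M) := by
  obtain ⟨hC, hΦ0, hHΦ, hGΦ⟩ := profile_data hα hb hct hΦ hRΦ hΦk
  have hHu : ∀ r ∈ Icc (0:ℝ) 1, 0 < Hof N u₀' u₀'' r := fun r hr => (hH0 r hr).1
  have hGu : ∀ r ∈ Icc (0:ℝ) 1, 0 < Gof N α b u₀' u₀'' r := by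
    intro r hr
    have h1 := (hH0 r hr).2
    unfold oddPow at h1
    rw [if_pos (hH0 r hr).1.le] at h1
    exact mul_pos h1 (Real.sqrt_pos.2 (by positivity))
  have hGc := Gof_cont N (b := b) hα hdata
  have hne : (Icc (0:ℝ) 1).Nonempty := ⟨0, le_rfl, zero_le_one⟩
  obtain ⟨r1, hr1, hmin⟩ := isCompact_Icc.exists_isMinOn hne hGc
  obtain ⟨r2, hr2, hmax⟩ := isCompact_Icc.exists_isMaxOn hne hGc
  obtain ⟨P1, hP1⟩ := isCompact_Icc.exists_bound_of_continuousOn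
    (fun r hr => (hdata.2.1 r hr).continuousWithinAt : ContinuousOn u₀' (Icc 0 1))
  obtain ⟨P2, hP2⟩ := isCompact_Icc.exists_bound_of_continuousOn
    (fun r hr => (hC.2.1 r hr).continuousWithinAt : ContinuousOn Φ' (Icc 0 1))
  set g0 := Gof N α b u₀' u₀'' r1 with hg0
  set g1 := Gof N α b u₀' u₀'' r2 with hg1
  have g0p : 0 < g0 := hGu r1 hr1
  set m := min g0 ct / 2 with hm
  have hmp : 0 < m := by have := lt_min g0p hct; positivity
  have m1 : 2 * m ≤ g0 := by have := min_le_left g0 ct; linarith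
  have m2 : 2 * m ≤ ct := by have := min_le_right g0 ct; linarith
  set M := max g1 ct + m with hM
  have M1 : g1 + m ≤ M := by have := le_max_left g1 ct; linarith
  have M2 : ct + m ≤ M := by have := le_max_right g1 ct; linarith
  set P := max k (max P1 P2) with hP
  have hkP : k ≤ P := le_max_left _ _
  have p1 : P1 ≤ P := (le_max_left _ _).trans (le_max_right _ _)
  have p2 : P2 ≤ P := (le_max_right _ _).trans (le_max_right _ _)
  obtain ⟨n1, hn1⟩ := usum_inv (m := m) (M := M) (P := P) hα hdata hHu hmp (fun r hr => by
    have a : g0 ≤ Gof N α b u₀' u₀'' r := hmin hr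
    have b : Gof N α b u₀' u₀'' r ≤ g1 := hmax hr
    constructor <;> linarith) (fun r hr => (hP1 r hr).trans p1)
  obtain ⟨n2, hn2⟩ := usum_inv (m := m) (M := M) (P := P) hα hC hHΦ hmp (fun r hr => by
    rw [hGΦ r hr]
    constructor <;> linarith) (fun r hr => (hP2 r hr).trans p2)
  have hν : (2:ℝ) ≤ N := by exact_mod_cast hN
  obtain ⟨l, L, C, H1, H2, S, n3, hn3, hS⟩ := sch_exists (u0 := fun n => usum (u₀ 0) u₀' u₀'' n) (n0 := max n1 n2)
    hν hα hb hmp (by linarith : m ≤ M) hk hkP (fun n hn => hn1 n ((le_max_left _ _).trans hn))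
  obtain ⟨a, w, g, ha, hw, hg⟩ := hS.lims (A := |u₀ 0|) (init_mod hα hdata hHu)
    (fun n _ => by simp [sch, usum])
  obtain ⟨ur, urr, ut, hsol, hpos⟩ := flow_of_lims hS hdata (fun n => rfl) ha hw hg
  refine ⟨_, ur, urr, ut, hsol, hpos, ?_, ?_⟩
  · intro v vr vrr vt hv hvp t ht r hr
    exact le_antisymm (flow_le hα hsol hpos hv hvp t ht r hr) (flow_le hα hv hvp hsol hpos t ht r hr)
  · obtain ⟨B1, hB1, n5, hb1⟩ := usum_bd hdata
    obtain ⟨B2, hB2, n6, hb2⟩ := usum_bd hC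
    obtain ⟨A, κ, hκ, hcv⟩ := hS.conv (φ := fun n => usum (Φ 0) Φ' Φ'' n) (ct := ct) (B := B1 + B2) (n4 := max n5 n6)
      (by positivity) (fun n hn => hn2 n ((le_max_right _ _).trans (hn3.trans hn)))
      (fun ε hε => by
        obtain ⟨n0, h0⟩ := data_Fd N (b := b) hα hC hHΦ hε
        refine ⟨max n0 1, fun n hn i hi => ?_⟩
        have h1 := (h0 n ((le_max_left _ _).trans hn) i hi).2
        rw [hGΦ _ (sqrt_mem hi)] at h1
        rw [(Hd_congr (ν := N) (α := α) (b := b)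
          (fun i hi => Ud_usum hC.2.2.2.2 ((le_max_right n0 1).trans hn) hi) hi).2]
        exact h1)
      (fun n hn i hi => by
        have e1 := hb1 n ((le_max_left _ _).trans hn) i hi
        have e2 := hb2 n ((le_max_right _ _).trans hn) i hi
        exact (abs_sub _ _).trans (add_le_add e1 e2))
      ha (usum_lim hC)
    obtain ⟨M', hM'⟩ := sup_conv (W := fun X t => a X t - Φ (Real.sqrt X) - ct * t) hκ hcv
    refine ⟨M', hM'.congr (fun t => ?_)⟩
    refine iSup_congr (fun r => ?_)
    rw [Real.sqrt_sq r.2.1]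

end RF

/-- global existence and convergence, case `b ≤ 0 < k`: the flow has a
unique global classical solution with positive mean curvature, and
`sup_{r∈[0,1]} |u(r,t) − Φ̃(r) − c̃t| → M` for some `M ∈ ℝ` as `t → ∞`. -/
theorem stmt16 (N : ℕ) (hN : 1 < N) (α b k : ℝ) (hα : 0 < α) (hb : b ≤ 0) (hk : 0 < k)
    (hbk : (-b) ^ (1 / α) * Real.sqrt (1 + k ^ 2) < k * (N : ℝ))
    (u₀ u₀' u₀'' : ℝ → ℝ) (hdata : IsC2Data k u₀ u₀' u₀'')
    (hH0 : ∀ r ∈ Set.Icc (0 : ℝ) 1,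
      0 < meanCurv N r (u₀' r) (u₀'' r) ∧
      0 < oddPow (meanCurv N r (u₀' r) (u₀'' r)) α + b)
    (ct RΦ : ℝ) (Φ Φ' Φ'' : ℝ → ℝ) (hct : 0 < ct)
    (hΦ : IsMaxProfileSol N α b ct RΦ Φ Φ' Φ'') (hRΦ : 1 < RΦ) (hΦk : Φ' 1 = k) :
    ∃ u ur urr ut : ℝ → ℝ → ℝ,
      IsFlowSol N α b k u₀ u₀' u₀'' (Set.Ici 0) u ur urr ut ∧
      (∀ t ∈ Set.Ici (0 : ℝ), ∀ r ∈ Set.Icc (0 : ℝ) 1,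
        0 < meanCurv N r (ur r t) (urr r t)) ∧
      (∀ v vr vrr vt : ℝ → ℝ → ℝ,
        IsFlowSol N α b k u₀ u₀' u₀'' (Set.Ici 0) v vr vrr vt →
        (∀ t ∈ Set.Ici (0 : ℝ), ∀ r ∈ Set.Icc (0 : ℝ) 1,
          0 < meanCurv N r (vr r t) (vrr r t)) →
        ∀ t ∈ Set.Ici (0 : ℝ), ∀ r ∈ Set.Icc (0 : ℝ) 1, v r t = u r t) ∧
      ∃ M : ℝ,
        Filter.Tendsto
          (fun t : ℝ => ⨆ r : Set.Icc (0 : ℝ) 1, |u r.1 t - Φ r.1 - ct * t|)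
          Filter.atTop (nhds M) := by
  exact RF.main_thm N hN α b k hα hb hk u₀ u₀' u₀'' hdata hH0 ct RΦ Φ Φ' Φ'' hct hΦ.2.1 hRΦ hΦk
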